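/- For every β > 0 there exists a constant C > 0 depending only on β such that for every integer n ≥ 1 and every θ ∈ (0,π], sup_{x ∈ ℝ} | P[ √(π²β/(2 ln(2+nθ))) · (N_n(0,θ) − nθ/(2π)) ≤ x ] − (1/√(2π)) ∫_{−∞}^x e^{−t²/2} dt | ≤ C · (ln(2+nθ))^{−1/2}, where P denotes probability with respect to μ_{β,n}. -/

import Mathlib

open MeasureTheory ProbabilityTheory Filter

noncomputable section

/-- The normalization constant `C_{β,n} = (2π)^n Γ(1+βn/2)/Γ(1+β/2)^n`. -/
def cbeConst (β : ℝ) (n : ℕ) : ℝ :=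
  (2 * Real.pi) ^ n * Real.Gamma (1 + β * n / 2) / Real.Gamma (1 + β / 2) ^ n

/-- The circular β-ensemble: the measure on `[0,2π)^n` with density
`(1/C_{β,n}) ∏_{j<k} |e^{iθ_j} − e^{iθ_k}|^β` with respect to Lebesgue measure. -/
def cbe (β : ℝ) (n : ℕ) : Measure (Fin n → ℝ) :=
  ((volume : Measure (Fin n → ℝ)).restrict
      (Set.univ.pi fun _ => Set.Ico 0 (2 * Real.pi))).withDensity
    (fun y => ENNReal.ofReal ((1 / cbeConst β n) *
      ∏ p ∈ Finset.univ.filter (fun p : Fin n × Fin n => p.1 < p.2),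
        ‖Complex.exp (Complex.I * (y p.1 : ℂ)) - Complex.exp (Complex.I * (y p.2 : ℂ))‖ ^ β))

/-- `countIn a b y` is the number of indices `j` with `y j ∈ [a, b)`. -/
def countIn {n : ℕ} (a b : ℝ) (y : Fin n → ℝ) : ℕ :=
  (Finset.univ.filter fun j => a ≤ y j ∧ y j < b).card

/-- The macroscopic scale `2 + (j+1)θ` after `j` steps of the phase recursion. -/
def scale (θ : ℝ) (j : ℕ) : ℝ := 2 + (j + 1) * θ

/-- The summable weight `(j+1)^{-3/2}`. -/
def decay (j : ℕ) : ℝ := ((j : ℝ) + 1) ^ (-(3 / 2) : ℝ)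

lemma two_le_scale {θ : ℝ} (hθ : 0 < θ) (j : ℕ) : 2 ≤ scale θ j := by
  unfold scale; have : 0 ≤ ((j : ℝ) + 1) * θ := by positivity
  linarith

lemma scale_succ (θ : ℝ) (j : ℕ) : scale θ (j + 1) = scale θ j + θ := by
  unfold scale; push_cast; ring

lemma decay_nonneg (j : ℕ) : 0 ≤ decay j := by unfold decay; positivity

lemma abs_one_add_rpow_sub_le {p h : ℝ} (hp : 0 ≤ p) (hp1 : p ≤ 1) (hh : 0 ≤ h) :
    |(1 + h) ^ p - 1 - p * h| ≤ p * h ^ 2 := by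
  have h1 : (1 + h) ^ p ≤ 1 + p * h := rpow_one_add_le_one_add_mul_self (by linarith) hp hp1
  have hpos : 0 < 1 + h := by linarith
  have h2 : 1 + p * Real.log (1 + h) ≤ (1 + h) ^ p := by
    rw [Real.rpow_def_of_pos hpos]
    have := Real.add_one_le_exp (Real.log (1 + h) * p)
    linarith
  have h3 : h - h ^ 2 ≤ Real.log (1 + h) := by
    have := Real.one_sub_inv_le_log_of_pos hpos
    refine le_trans ?_ this
    rw [← sub_nonneg]
    have : 1 - (1 + h)⁻¹ - (h - h ^ 2) = h ^ 3 / (1 + h) := by field_simp; ring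
    rw [this]; positivity
  rw [abs_le]
  constructor <;> nlinarith

lemma sum_div_scale_le {θ : ℝ} (hθ : 0 < θ) (N : ℕ) :
    ∑ j ∈ Finset.range N, θ / (scale θ j * √(scale θ j)) ≤ 2 := by
  have key : ∀ y : ℝ, 1 ≤ y →
      θ / ((y + θ) * √(y + θ)) ≤ 2 / √y - 2 / √(y + θ) := by
    intro y hy
    have ha : 0 < √y := Real.sqrt_pos.2 (by linarith)
    have hb : 0 < √(y + θ) := Real.sqrt_pos.2 (by linarith)
    have hab : √y ≤ √(y + θ) := Real.sqrt_le_sqrt (by linarith)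
    have e1 : √y ^ 2 = y := Real.sq_sqrt (by linarith)
    have e2 : √(y + θ) ^ 2 = y + θ := Real.sq_sqrt (by linarith)
    have hθe : θ = √(y + θ) ^ 2 - √y ^ 2 := by linarith
    set a := √y
    set c := √(y + θ)
    rw [← e2, hθe, div_sub_div _ _ ha.ne' hb.ne', div_le_div_iff₀ (by positivity) (by positivity)]
    have : 0 ≤ (c - a) * (c * (2 * c ^ 2 - a * c - a ^ 2)) := by
      apply mul_nonneg (by linarith)
      apply mul_nonneg hb.le; nlinarith
    nlinarith
  have : ∑ j ∈ Finset.range N, θ / (scale θ j * √(scale θ j)) ≤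
      2 / √(2 + (0 : ℕ) * θ) - 2 / √(2 + N * θ) := by
    rw [← Finset.sum_range_sub' (fun j : ℕ => 2 / √(2 + j * θ)) N]
    apply Finset.sum_le_sum
    intro j _
    have := key (2 + j * θ) (by have : 0 ≤ (j : ℝ) * θ := by positivity
                                linarith)
    have e1 : scale θ j = 2 + j * θ + θ := by unfold scale; ring
    have e2 : 2 + ((j + 1 : ℕ) : ℝ) * θ = 2 + j * θ + θ := by push_cast; ring
    simp only [e1, e2]
    exact this
  refine this.trans ?_
  have h2 : 2 / √(2 + (0 : ℕ) * θ) ≤ 2 := by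
    apply div_le_self (by norm_num)
    simp
  have : 0 ≤ 2 / √(2 + N * θ) := by positivity
  linarith

lemma exists_sum_rpow_scale_mul_decay_le : ∃ C : ℝ, 0 ≤ C ∧ ∀ θ : ℝ, 0 < θ → θ ≤ Real.pi →
    ∀ p : ℝ, 0 ≤ p → p ≤ 1 / 4 → ∀ N : ℕ,
      ∑ j ∈ Finset.range N, scale θ j ^ p * decay j ≤ C := by
  have hs : Summable (fun j : ℕ => 6 * ((j : ℝ) + 1) ^ (-(5 / 4) : ℝ)) := by
    have h := (summable_nat_add_iff 1).2 (Real.summable_nat_rpow.2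
      (by norm_num : (-(5 / 4) : ℝ) < -1))
    simpa using h.mul_left 6
  refine ⟨∑' j : ℕ, 6 * ((j : ℝ) + 1) ^ (-(5 / 4) : ℝ), tsum_nonneg (fun j => by positivity), ?_⟩
  intro θ hθ hθπ p hp hp4 N
  refine le_trans (Finset.sum_le_sum fun j _ => ?_)
    (hs.sum_le_tsum (Finset.range N) (fun j _ => by positivity))
  have hx := two_le_scale hθ j
  have hx6 : scale θ j ≤ 6 * ((j : ℝ) + 1) := by
    unfold scale
    have := Real.pi_lt_four
    have hj : (0 : ℝ) ≤ j := by positivity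
    nlinarith
  have h1 : scale θ j ^ p ≤ 6 * ((j : ℝ) + 1) ^ (1 / 4 : ℝ) := by
    calc scale θ j ^ p ≤ scale θ j ^ (1 / 4 : ℝ) :=
          Real.rpow_le_rpow_of_exponent_le (by linarith) hp4
      _ ≤ (6 * ((j : ℝ) + 1)) ^ (1 / 4 : ℝ) := by gcongr
      _ = 6 ^ (1 / 4 : ℝ) * ((j : ℝ) + 1) ^ (1 / 4 : ℝ) :=
        Real.mul_rpow (by norm_num) (by positivity)
      _ ≤ 6 ^ (1 : ℝ) * ((j : ℝ) + 1) ^ (1 / 4 : ℝ) := by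
          gcongr <;> norm_num
      _ = _ := by rw [Real.rpow_one]
  calc scale θ j ^ p * decay j ≤ 6 * ((j : ℝ) + 1) ^ (1 / 4 : ℝ) * decay j := by
        gcongr; exact decay_nonneg j
    _ = _ := by
        unfold decay
        rw [mul_assoc, ← Real.rpow_add (by positivity)]
        norm_num

lemma sub_one_mul_sum_pow_mul (E : ℂ) (A : ℕ → ℂ) (N : ℕ) :
    (E - 1) * ∑ j ∈ Finset.range N, E ^ j * A j =
      E ^ N * A N - A 0 - ∑ j ∈ Finset.range N, E ^ (j + 1) * (A (j + 1) - A j) := by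
  induction N with
  | zero => simp
  | succ N ih => rw [Finset.sum_range_succ, mul_add, ih, Finset.sum_range_succ]; ring

lemma exists_norm_oscillating_sum_le (D : ℝ) (hD : 0 ≤ D) : ∃ C : ℝ, 0 ≤ C ∧
    ∀ θ : ℝ, 0 < θ → θ ≤ Real.pi → ∀ p : ℝ, 0 ≤ p → p ≤ 1 / 4 →
    ∀ E : ℂ, ‖E‖ = 1 → 2 * θ / Real.pi ≤ ‖E - 1‖ →
    ∀ Z : ℕ → ℂ, (∀ j, ‖Z j‖ ≤ 1) → (∀ j, ‖Z (j + 1) - Z j‖ ≤ D * (θ / scale θ j + decay j)) →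
    ∀ N : ℕ, ‖∑ j ∈ Finset.range N, E ^ (j + 1) *
      (((scale θ j ^ p * (θ / scale θ j) : ℝ) : ℂ) * Z j)‖
      ≤ C := by
  obtain ⟨C2, hC2, hsum⟩ := exists_sum_rpow_scale_mul_decay_le
  refine ⟨Real.pi / 2 * (3 + 2 * D + D * C2), by positivity, ?_⟩
  intro θ hθ hθπ p hp hp4 E hE hE1 Z hZ hZd N
  set a : ℕ → ℝ := fun j => scale θ j ^ p * (θ / scale θ j) with ha
  have hx := two_le_scale hθ
  have hxpos : ∀ j, 0 < scale θ j := fun j => by linarith [hx j]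
  have ha' : ∀ j, a j = θ * scale θ j ^ (p - 1) := fun j => by
    simp only [ha]; rw [Real.rpow_sub_one (hxpos j).ne']; ring
  have ha0 : ∀ j, 0 ≤ a j := fun j => by
    have := hxpos j
    simp only [ha]; positivity
  have hanti : ∀ j, a (j + 1) ≤ a j := fun j => by
    rw [ha', ha']
    refine mul_le_mul_of_nonneg_left ?_ hθ.le
    exact Real.rpow_le_rpow_of_nonpos (hxpos j) (by rw [scale_succ]; linarith) (by linarith)
  have haθ : ∀ j, a j ≤ θ := fun j => by
    rw [ha']
    have : scale θ j ^ (p - 1) ≤ 1 :=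
      Real.rpow_le_one_of_one_le_of_nonpos (by linarith [hx j]) (by linarith)
    nlinarith
  have hA : ∀ j, ‖(a (j + 1) : ℂ) * Z (j + 1) - (a j : ℂ) * Z j‖ ≤
      (a j - a (j + 1)) + θ * (D * (θ / (scale θ j * √(scale θ j))) +
        D * (scale θ j ^ p * decay j)) := fun j => by
    have e : (a (j + 1) : ℂ) * Z (j + 1) - (a j : ℂ) * Z j =
        ((a (j + 1) - a j : ℝ) : ℂ) * Z (j + 1) + (a j : ℂ) * (Z (j + 1) - Z j) := by
      push_cast; ring
    rw [e]
    refine (norm_add_le _ _).trans (add_le_add ?_ ?_)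
    · rw [norm_mul, Complex.norm_real, Real.norm_eq_abs, abs_sub_comm,
        abs_of_nonneg (by linarith [hanti j])]
      have := hZ (j + 1)
      have := hanti j
      nlinarith [norm_nonneg (Z (j + 1))]
    · rw [norm_mul, Complex.norm_real, Real.norm_eq_abs, abs_of_nonneg (ha0 j)]
      refine (mul_le_mul_of_nonneg_left (hZd j) (ha0 j)).trans ?_
      have h1 : a j * (θ / scale θ j) ≤ θ * (θ / (scale θ j * √(scale θ j))) := by
        have hp2 : scale θ j ^ p ≤ √(scale θ j) := by
          rw [Real.sqrt_eq_rpow]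
          exact Real.rpow_le_rpow_of_exponent_le (by linarith [hx j]) (by linarith)
        have hs : 0 < √(scale θ j) := Real.sqrt_pos.2 (hxpos j)
        have hs2 : √(scale θ j) * √(scale θ j) = scale θ j := Real.mul_self_sqrt (hxpos j).le
        calc a j * (θ / scale θ j) ≤ (√(scale θ j) * (θ / scale θ j)) * (θ / scale θ j) := by
              have := hxpos j
              simp only [ha]; gcongr
          _ = θ * (θ / (scale θ j * √(scale θ j))) := by
              have h0 := (hxpos j).ne'
              field_simp
              nlinarith
      have h2 : a j * decay j ≤ θ * (scale θ j ^ p * decay j) := by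
        have hd := decay_nonneg j
        have : 1 ≤ scale θ j ^ p := Real.one_le_rpow (by linarith [hx j]) hp
        have h3 : a j * decay j ≤ θ * decay j := mul_le_mul_of_nonneg_right (haθ j) hd
        have h4 : decay j ≤ scale θ j ^ p * decay j := le_mul_of_one_le_left hd this
        exact h3.trans (mul_le_mul_of_nonneg_left h4 hθ.le)
      calc a j * (D * (θ / scale θ j + decay j))
          = D * (a j * (θ / scale θ j)) + D * (a j * decay j) := by ring
        _ ≤ D * (θ * (θ / (scale θ j * √(scale θ j)))) +
            D * (θ * (scale θ j ^ p * decay j)) := by gcongr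
        _ = _ := by ring
  have hparts := sub_one_mul_sum_pow_mul E (fun j => (a j : ℂ) * Z j) N
  have hbound : ‖(E - 1) * ∑ j ∈ Finset.range N, E ^ j * ((a j : ℂ) * Z j)‖ ≤
      θ * (3 + 2 * D + D * C2) := by
    rw [hparts]
    have hn : ∀ j, ‖(a j : ℂ) * Z j‖ ≤ a j := fun j => by
      rw [norm_mul, Complex.norm_real, Real.norm_eq_abs, abs_of_nonneg (ha0 j)]
      exact mul_le_of_le_one_right (ha0 j) (hZ j)
    have h1 : ‖E ^ N * ((a N : ℂ) * Z N)‖ ≤ θ := by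
      rw [norm_mul, norm_pow, hE, one_pow, one_mul]; exact (hn N).trans (haθ N)
    have h2 : ‖(a 0 : ℂ) * Z 0‖ ≤ θ := (hn 0).trans (haθ 0)
    have h3 : ‖∑ j ∈ Finset.range N, E ^ (j + 1) *
        ((a (j + 1) : ℂ) * Z (j + 1) - (a j : ℂ) * Z j)‖ ≤
        θ + θ * (2 * D + D * C2) := by
      refine (norm_sum_le _ _).trans ?_
      refine (Finset.sum_le_sum (g := fun j => (a j - a (j + 1)) +
        θ * (D * (θ / (scale θ j * √(scale θ j))) +
        D * (scale θ j ^ p * decay j))) fun j _ => ?_).trans ?_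
      · rw [norm_mul, norm_pow, hE, one_pow, one_mul]; exact hA j
      · rw [Finset.sum_add_distrib, Finset.sum_range_sub', ← Finset.mul_sum, Finset.sum_add_distrib,
          ← Finset.mul_sum, ← Finset.mul_sum]
        have := sum_div_scale_le hθ N
        have := hsum θ hθ hθπ p hp hp4 N
        have := haθ 0
        have := ha0 N
        have : D * ∑ j ∈ Finset.range N, θ / (scale θ j * √(scale θ j)) +
            D * ∑ j ∈ Finset.range N, scale θ j ^ p * decay j ≤ D * 2 + D * C2 := by gcongr
        have := mul_le_mul_of_nonneg_left this hθ.le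
        linarith
    have := norm_sub_le (E ^ N * ((a N : ℂ) * Z N) - (a 0 : ℂ) * Z 0)
      (∑ j ∈ Finset.range N, E ^ (j + 1) * ((a (j + 1) : ℂ) * Z (j + 1) - (a j : ℂ) * Z j))
    have := norm_sub_le (E ^ N * ((a N : ℂ) * Z N)) ((a 0 : ℂ) * Z 0)
    linarith
  have e : ∑ j ∈ Finset.range N, E ^ (j + 1) * ((a j : ℂ) * Z j) =
      E * ∑ j ∈ Finset.range N, E ^ j * ((a j : ℂ) * Z j) := by
    rw [Finset.mul_sum]; refine Finset.sum_congr rfl fun j _ => ?_; ring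
  rw [e, norm_mul, hE, one_mul]
  rw [norm_mul] at hbound
  set S := ‖∑ j ∈ Finset.range N, E ^ j * ((a j : ℂ) * Z j)‖
  have hS : 0 ≤ S := norm_nonneg _
  have h5 : 2 * θ / Real.pi * S ≤ θ * (3 + 2 * D + D * C2) :=
    (mul_le_mul_of_nonneg_right hE1 hS).trans hbound
  have hpi := Real.pi_pos
  have h6 : 2 * θ / Real.pi * S = θ * (2 / Real.pi * S) := by ring
  rw [h6] at h5
  have h7 := le_of_mul_le_mul_left h5 hθ
  calc S = Real.pi / 2 * (2 / Real.pi * S) := by field_simp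
    _ ≤ _ := by gcongr

lemma norm_exp_mul_I_sub_one_ge {θ : ℝ} (hθ : 0 < θ) (hθπ : θ ≤ Real.pi) :
    2 * θ / Real.pi ≤ ‖Complex.exp (θ * Complex.I) - 1‖ := by
  rw [mul_comm (θ : ℂ), Complex.norm_exp_I_mul_ofReal_sub_one, Real.norm_eq_abs]
  refine le_trans ?_ (le_abs_self _)
  have := Real.mul_le_sin (x := θ / 2) (by linarith) (by linarith)
  calc 2 * θ / Real.pi = 2 * (2 / Real.pi * (θ / 2)) := by ring
    _ ≤ _ := by gcongr

/-- The average of the frequency-shifted values `Y j (u ± 1)` against `e^{± i (j+1) θ}`. -/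
def shiftAvg (θ : ℝ) (Y : ℕ → ℝ → ℂ) (j : ℕ) (u : ℝ) : ℂ :=
  (Complex.exp (θ * Complex.I) ^ (j + 1) * Y j (u + 1) +
    Complex.exp (-θ * Complex.I) ^ (j + 1) * Y j (u - 1)) / 2

lemma norm_shiftAvg_le {θ : ℝ} {Y : ℕ → ℝ → ℂ} (hY : ∀ j u, ‖Y j u‖ ≤ 1) (j : ℕ) (u : ℝ) :
    ‖shiftAvg θ Y j u‖ ≤ 1 := by
  unfold shiftAvg
  have h1 : ‖Complex.exp (θ * Complex.I)‖ = 1 := Complex.norm_exp_ofReal_mul_I θ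
  have h2 : ‖Complex.exp (-θ * Complex.I)‖ = 1 := by
    have := Complex.norm_exp_ofReal_mul_I (-θ); push_cast at this; exact this
  rw [norm_div]
  have := norm_add_le (Complex.exp (θ * Complex.I) ^ (j + 1) * Y j (u + 1))
    (Complex.exp (-θ * Complex.I) ^ (j + 1) * Y j (u - 1))
  rw [norm_mul, norm_mul, norm_pow, norm_pow, h1, h2] at this
  have := hY j (u + 1)
  have := hY j (u - 1)
  rw [show ‖(2 : ℂ)‖ = 2 by simp, div_le_one (by norm_num)]
  simp at *
  linarith

theorem exists_recursion_bound (b C₀ : ℝ) (hb : 0 < b) (hC₀ : 0 ≤ C₀) :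
    ∃ c : ℝ, 0 < c ∧ c ≤ 1 / 2 ∧ ∃ C : ℝ, 0 ≤ C ∧ ∀ θ : ℝ, 0 < θ → θ ≤ Real.pi →
    ∀ Y : ℕ → ℝ → ℂ, (∀ u, Y 0 u = 1) → (∀ j u, ‖Y j u‖ ≤ 1) →
    (∀ j u, |u| ≤ 2 → ‖Y (j + 1) u - Y j u +
        ((b * u ^ 2 * (θ / scale θ j) : ℝ) : ℂ) * (Y j u - shiftAvg θ Y j u)‖ ≤
      C₀ * u ^ 2 * (θ / scale θ j ^ 2 + decay j)) →
    ∀ n s, |s| ≤ c → ‖Y n s - ((scale θ n ^ (-(b * s ^ 2)) : ℝ) : ℂ)‖ ≤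
      C * s ^ 2 * scale θ n ^ (-(b * s ^ 2)) := by
  obtain ⟨C2, hC2, hsum⟩ := exists_sum_rpow_scale_mul_decay_le
  set D := 8 * b + 4 * C₀ with hDdef
  have hD : 0 ≤ D := by positivity
  obtain ⟨C3, hC3, hosc⟩ := exists_norm_oscillating_sum_le D hD
  refine ⟨min (1 / 2) (1 / (2 * √b)), by positivity, min_le_left _ _,
    5 * b + b * C3 + (C₀ * (2 + C2) + 8 * b + 3 * b * D * (8 + 2 * C2)), by positivity, ?_⟩
  intro θ hθ hθπ Y hY0 hY1 hR n s hs
  have hs1 : |s| ≤ 1 / 2 := hs.trans (min_le_left _ _)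
  set p := b * s ^ 2 with hp
  have hp0 : 0 ≤ p := by positivity
  have hp4 : p ≤ 1 / 4 := by
    have h1 : |s| ≤ 1 / (2 * √b) := hs.trans (min_le_right _ _)
    have h2 : s ^ 2 ≤ (1 / (2 * √b)) ^ 2 := by rw [← sq_abs]; gcongr
    have h3 : (1 / (2 * √b)) ^ 2 = 1 / (4 * b) := by
      rw [div_pow, mul_pow, Real.sq_sqrt hb.le]; norm_num
    rw [h3] at h2
    calc p ≤ b * (1 / (4 * b)) := mul_le_mul_of_nonneg_left h2 hb.le
      _ = 1 / 4 := by field_simp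
  have hx := two_le_scale hθ
  have hxpos : ∀ j, 0 < scale θ j := fun j => by linarith [hx j]
  have hpi4 := Real.pi_lt_four
  set h : ℕ → ℝ := fun j => θ / scale θ j with hh
  have hh0 : ∀ j, 0 ≤ h j := fun j => by have := hxpos j; simp only [hh]; positivity
  have hh2 : ∀ j, h j ≤ 2 := fun j => by
    simp only [hh]; rw [div_le_iff₀ (hxpos j)]; linarith [hx j]
  set e : ℕ → ℝ := fun j => scale θ j ^ p with he
  have he0 : ∀ j, 0 < e j := fun j => Real.rpow_pos_of_pos (hxpos j) _
  set τ : ℕ → ℝ := fun j => θ / (scale θ j * √(scale θ j)) with hτ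
  have hτ0 : ∀ j, 0 ≤ τ j := fun j => by have := hxpos j; simp only [hτ]; positivity
  have heτ : ∀ j, e j * (θ / scale θ j ^ 2) ≤ τ j := fun j => by
    have hp2 : e j ≤ √(scale θ j) := by
      rw [Real.sqrt_eq_rpow]
      exact Real.rpow_le_rpow_of_exponent_le (by linarith [hx j]) (by linarith)
    have h0 := hxpos j
    have hs : 0 < √(scale θ j) := Real.sqrt_pos.2 h0
    have hs2 : √(scale θ j) * √(scale θ j) = scale θ j := Real.mul_self_sqrt h0.le
    calc e j * (θ / scale θ j ^ 2) ≤ √(scale θ j) * (θ / scale θ j ^ 2) := by gcongr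
      _ = τ j := by
        simp only [hτ]
        field_simp
        nlinarith
  have hxh : ∀ j, θ / scale θ j ^ 2 ≤ h j := fun j => by
    have h0 := hxpos j
    simp only [hh]
    gcongr
    nlinarith [hx j]
  have heh : ∀ j, e j * h j ^ 2 ≤ 4 * τ j := fun j => by
    have h1 : h j ^ 2 = θ * (θ / scale θ j ^ 2) := by simp only [hh]; ring
    have h2 : 0 ≤ e j * (θ / scale θ j ^ 2) := by have := he0 j; positivity
    calc e j * h j ^ 2 = θ * (e j * (θ / scale θ j ^ 2)) := by rw [h1]; ring
      _ ≤ 4 * (e j * (θ / scale θ j ^ 2)) := by gcongr; linarith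
      _ ≤ _ := by gcongr; exact heτ j
  have hdiff : ∀ j u, |u| ≤ 2 → ‖Y (j + 1) u - Y j u‖ ≤ D * (h j + decay j) := fun j u hu => by
    have h1 := hR j u hu
    have hu2 : u ^ 2 ≤ 4 := by rw [← sq_abs]; nlinarith [abs_nonneg u]
    have h2 : ‖((b * u ^ 2 * (θ / scale θ j) : ℝ) : ℂ) * (Y j u - shiftAvg θ Y j u)‖ ≤
        8 * b * h j := by
      rw [norm_mul, Complex.norm_real, Real.norm_eq_abs,
        abs_of_nonneg (by have := hh0 j; simp only [hh] at this; positivity)]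
      have h3 : ‖Y j u - shiftAvg θ Y j u‖ ≤ 2 :=
        (norm_sub_le _ _).trans (by linarith [hY1 j u, norm_shiftAvg_le (θ := θ) hY1 j u])
      calc b * u ^ 2 * (θ / scale θ j) * ‖Y j u - shiftAvg θ Y j u‖ ≤ b * 4 * h j * 2 := by
            have := hh0 j
            gcongr
        _ = _ := by ring
    have h4 : C₀ * u ^ 2 * (θ / scale θ j ^ 2 + decay j) ≤ C₀ * 4 * (h j + decay j) := by
      have := decay_nonneg j
      have := hxpos j
      gcongr
      exact hxh j
    have h5 := norm_sub_le (Y (j + 1) u - Y j u +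
        ((b * u ^ 2 * (θ / scale θ j) : ℝ) : ℂ) * (Y j u - shiftAvg θ Y j u))
        (((b * u ^ 2 * (θ / scale θ j) : ℝ) : ℂ) * (Y j u - shiftAvg θ Y j u))
    rw [add_sub_cancel_right] at h5
    have := mul_nonneg hb.le (decay_nonneg j)
    rw [hDdef]
    linarith
  have hstep : ∀ j, e (j + 1) = e j * (1 + h j) ^ p := fun j => by
    have h0 := hxpos j
    simp only [he, hh]
    rw [← Real.mul_rpow h0.le (by positivity), scale_succ]
    congr 1; field_simp
  have hbern : ∀ j, |(1 + h j) ^ p - 1 - p * h j| ≤ p * h j ^ 2 := fun j =>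
    abs_one_add_rpow_sub_le hp0 (by linarith) (hh0 j)
  have hb1 : ∀ j, |e (j + 1) - e j - p * h j * e j| ≤ p * (4 * τ j) := fun j => by
    have : e (j + 1) - e j - p * h j * e j = e j * ((1 + h j) ^ p - 1 - p * h j) := by
      rw [hstep]; ring
    rw [this, abs_mul, abs_of_pos (he0 j)]
    calc e j * |(1 + h j) ^ p - 1 - p * h j| ≤ e j * (p * h j ^ 2) := by
          have := he0 j; gcongr; exact hbern j
      _ = p * (e j * h j ^ 2) := by ring
      _ ≤ _ := mul_le_mul_of_nonneg_left (heh j) hp0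
  have hb2 : ∀ j, |e (j + 1) - e j| ≤ 3 * p * (e j * h j) := fun j => by
    have : e (j + 1) - e j = e j * ((1 + h j) ^ p - 1 - p * h j) + e j * (p * h j) := by
      rw [hstep]; ring
    rw [this]
    refine (abs_add_le _ _).trans ?_
    rw [abs_mul, abs_mul, abs_of_pos (he0 j), abs_of_nonneg (mul_nonneg hp0 (hh0 j))]
    have h1 : |(1 + h j) ^ p - 1 - p * h j| ≤ p * (2 * h j) :=
      (hbern j).trans (by gcongr; nlinarith [hh0 j, hh2 j])
    have := mul_le_mul_of_nonneg_left h1 (he0 j).le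
    linarith
  set w : ℕ → ℂ := fun j => Y (j + 1) s - Y j s +
    ((b * s ^ 2 * (θ / scale θ j) : ℝ) : ℂ) * (Y j s - shiftAvg θ Y j s) with hw
  have hincr : ∀ j, (e (j + 1) : ℂ) * Y (j + 1) s - (e j : ℂ) * Y j s =
      ((p : ℂ) * ((e j * h j : ℝ) : ℂ) * shiftAvg θ Y j s) +
      ((e j : ℂ) * w j + ((e (j + 1) - e j - p * h j * e j : ℝ) : ℂ) * Y j s +
        ((e (j + 1) - e j : ℝ) : ℂ) * (Y (j + 1) s - Y j s)) := fun j => by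
    simp only [hw, hp, hh]; push_cast; ring
  have hrem : ∀ j, ‖(e j : ℂ) * w j + ((e (j + 1) - e j - p * h j * e j : ℝ) : ℂ) * Y j s +
        ((e (j + 1) - e j : ℝ) : ℂ) * (Y (j + 1) s - Y j s)‖ ≤
      s ^ 2 * ((C₀ + 4 * b + 12 * b * D) * τ j + (C₀ + 6 * b * D) * (e j * decay j)) := fun j => by
    have hd := decay_nonneg j
    have n1 : ‖(e j : ℂ) * w j‖ ≤ C₀ * s ^ 2 * (τ j + e j * decay j) := by
      rw [norm_mul, Complex.norm_real, Real.norm_eq_abs, abs_of_pos (he0 j)]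
      calc e j * ‖w j‖ ≤ e j * (C₀ * s ^ 2 * (θ / scale θ j ^ 2 + decay j)) := by
            have := he0 j; gcongr; exact hR j s (by linarith)
        _ = C₀ * s ^ 2 * (e j * (θ / scale θ j ^ 2) + e j * decay j) := by ring
        _ ≤ _ := by gcongr; exact heτ j
    have n2 : ‖((e (j + 1) - e j - p * h j * e j : ℝ) : ℂ) * Y j s‖ ≤ p * (4 * τ j) := by
      rw [norm_mul, Complex.norm_real, Real.norm_eq_abs]
      calc _ ≤ |e (j + 1) - e j - p * h j * e j| * 1 := by gcongr; exact hY1 j s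
        _ ≤ _ := by rw [mul_one]; exact hb1 j
    have n3 : ‖((e (j + 1) - e j : ℝ) : ℂ) * (Y (j + 1) s - Y j s)‖ ≤
        3 * p * D * (4 * τ j + 2 * (e j * decay j)) := by
      rw [norm_mul, Complex.norm_real, Real.norm_eq_abs]
      have := hh0 j
      have := he0 j
      calc _ ≤ 3 * p * (e j * h j) * (D * (h j + decay j)) := by
            gcongr
            · exact hb2 j
            · exact hdiff j s (by linarith)
        _ = 3 * p * D * (e j * h j ^ 2 + h j * (e j * decay j)) := by ring
        _ ≤ _ := mul_le_mul_of_nonneg_left (add_le_add (heh j)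
            (mul_le_mul_of_nonneg_right (hh2 j) (by positivity))) (by positivity)
    refine (norm_add₃_le).trans ?_
    calc _ ≤ C₀ * s ^ 2 * (τ j + e j * decay j) + p * (4 * τ j) +
          3 * p * D * (4 * τ j + 2 * (e j * decay j)) := by gcongr
      _ = _ := by rw [hp]; ring
  have hE : ∀ N,
      ‖∑ j ∈ Finset.range N, (p : ℂ) * ((e j * h j : ℝ) : ℂ) * shiftAvg θ Y j s‖ ≤ p * C3 := by
    intro N
    have o1 := hosc θ hθ hθπ p hp0 hp4 (Complex.exp (θ * Complex.I))
      (Complex.norm_exp_ofReal_mul_I θ)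
      (norm_exp_mul_I_sub_one_ge hθ hθπ) (fun j => Y j (s + 1)) (fun j => hY1 j _)
      (fun j => hdiff j _ (by have := abs_add_le s 1; rw [abs_one] at this; linarith)) N
    have hconj : Complex.exp (-θ * Complex.I) = (starRingEnd ℂ) (Complex.exp (θ * Complex.I)) := by
      rw [← Complex.exp_conj]; congr 1; simp
    have o2 := hosc θ hθ hθπ p hp0 hp4 (Complex.exp (-θ * Complex.I))
      (by rw [hconj, RCLike.norm_conj]; exact Complex.norm_exp_ofReal_mul_I θ)
      (by
        have : Complex.exp (-θ * Complex.I) - 1 =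
            (starRingEnd ℂ) (Complex.exp (θ * Complex.I) - 1) := by
          rw [hconj]; simp
        rw [this, RCLike.norm_conj]; exact norm_exp_mul_I_sub_one_ge hθ hθπ)
      (fun j => Y j (s - 1)) (fun j => hY1 j _)
      (fun j => hdiff j _ (by have := abs_sub s 1; rw [abs_one] at this; linarith)) N
    have e1 : ∑ j ∈ Finset.range N, (p : ℂ) * ((e j * h j : ℝ) : ℂ) * shiftAvg θ Y j s =
        (p : ℂ) * ((∑ j ∈ Finset.range N, Complex.exp (θ * Complex.I) ^ (j + 1) *
            (((scale θ j ^ p * (θ / scale θ j) : ℝ) : ℂ) * Y j (s + 1)) +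
          ∑ j ∈ Finset.range N, Complex.exp (-θ * Complex.I) ^ (j + 1) *
            (((scale θ j ^ p * (θ / scale θ j) : ℝ) : ℂ) * Y j (s - 1))) / 2) := by
      rw [← Finset.sum_add_distrib, Finset.sum_div, Finset.mul_sum]
      refine Finset.sum_congr rfl fun j _ => ?_
      simp only [he, hh, shiftAvg]; ring
    rw [e1, norm_mul, Complex.norm_real, Real.norm_eq_abs, abs_of_nonneg hp0]
    gcongr
    rw [norm_div, show ‖(2 : ℂ)‖ = 2 by simp, div_le_iff₀ (by norm_num)]
    refine (norm_add_le _ _).trans ?_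
    linarith
  have hG : ‖(e n : ℂ) * Y n s - (e 0 : ℂ) * Y 0 s‖ ≤ p * C3 +
      s ^ 2 * ((C₀ + 4 * b + 12 * b * D) * 2 + (C₀ + 6 * b * D) * C2) := by
    rw [← Finset.sum_range_sub (fun j => (e j : ℂ) * Y j s) n,
      Finset.sum_congr rfl (fun j _ => hincr j),
      Finset.sum_add_distrib]
    refine (norm_add_le _ _).trans (add_le_add (hE n) ((norm_sum_le _ _).trans
      ((Finset.sum_le_sum fun j _ => hrem j).trans ?_)))
    rw [← Finset.mul_sum, Finset.sum_add_distrib, ← Finset.mul_sum, ← Finset.mul_sum]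
    gcongr
    · exact sum_div_scale_le hθ n
    · exact hsum θ hθ hθπ p hp0 hp4 n
  have hG0 : ‖(e 0 : ℂ) * Y 0 s - 1‖ ≤ 5 * p := by
    rw [hY0, mul_one, ← Complex.ofReal_one, ← Complex.ofReal_sub, Complex.norm_real,
      Real.norm_eq_abs]
    have h1 : 1 ≤ e 0 := Real.one_le_rpow (by linarith [hx 0]) hp0
    have h2 : e 0 ≤ 1 + p * (1 + θ) := by
      have := rpow_one_add_le_one_add_mul_self (s := 1 + θ) (p := p) (by linarith) hp0 (by linarith)
      refine le_trans (le_of_eq ?_) this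
      simp only [he, scale]; congr 1; push_cast; ring
    rw [abs_of_nonneg (by linarith)]
    nlinarith
  have hG1 : ‖(e n : ℂ) * Y n s - 1‖ ≤ (5 * b + b * C3 +
      (C₀ * (2 + C2) + 8 * b + 3 * b * D * (8 + 2 * C2))) * s ^ 2 := by
    have := norm_add_le ((e n : ℂ) * Y n s - (e 0 : ℂ) * Y 0 s) ((e 0 : ℂ) * Y 0 s - 1)
    rw [sub_add_sub_cancel] at this
    calc _ ≤ p * C3 + s ^ 2 * ((C₀ + 4 * b + 12 * b * D) * 2 + (C₀ + 6 * b * D) * C2) + 5 * p := by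
          linarith
      _ = _ := by rw [hp]; ring
  have hfin : Y n s - ((scale θ n ^ (-p) : ℝ) : ℂ) =
      ((scale θ n ^ (-p) : ℝ) : ℂ) * ((e n : ℂ) * Y n s - 1) := by
    have : ((scale θ n ^ (-p) : ℝ) : ℂ) * (e n : ℂ) = 1 := by
      rw [← Complex.ofReal_mul]; simp only [he]
      rw [← Real.rpow_add (hxpos n)]; simp
    rw [mul_sub, ← mul_assoc, this]; ring
  rw [hfin, norm_mul, Complex.norm_real, Real.norm_eq_abs,
    abs_of_pos (Real.rpow_pos_of_pos (hxpos n) _), mul_comm]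
  gcongr
  exact Real.rpow_nonneg (hxpos n).le _

/-- The (unnormalized) Fejér-type kernel whose Fourier transform is supported in `[-T, T]`. -/
def fejer (T x : ℝ) : ℝ := ∫ t in (0 : ℝ)..T, (T - t) * Real.cos (t * x)

lemma sq_mul_fejer (T x : ℝ) : x ^ 2 * fejer T x = 1 - Real.cos (T * x) := by
  have hd : ∀ t ∈ Set.uIcc 0 T, HasDerivAt
      (fun t : ℝ => (T - t) * (x * Real.sin (t * x)) - Real.cos (t * x))
      (x ^ 2 * ((T - t) * Real.cos (t * x))) t := by
    intro t _
    have h1 : HasDerivAt (fun t : ℝ => t * x) x t := by simpa using (hasDerivAt_id t).mul_const x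
    have h2 : HasDerivAt (fun t : ℝ => T - t) (-1) t := by
      simpa using (hasDerivAt_id t).const_sub T
    refine ((h2.mul ((h1.sin).const_mul x)).sub h1.cos).congr_deriv ?_
    ring
  have := intervalIntegral.integral_eq_sub_of_hasDerivAt hd
    (Continuous.intervalIntegrable (by fun_prop) _ _)
  rw [fejer, ← intervalIntegral.integral_const_mul, this]
  simp only [sub_self, zero_mul, Real.sin_zero, Real.cos_zero, mul_zero]
  ring

lemma continuous_fejer (T : ℝ) : Continuous (fejer T) := by
  unfold fejer
  exact intervalIntegral.continuous_parametric_intervalIntegral_of_continuous' (by fun_prop) _ _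

lemma fejer_neg (T x : ℝ) : fejer T (-x) = fejer T x := by simp [fejer]

lemma fejer_zero (T : ℝ) : fejer T 0 = T ^ 2 / 2 := by
  simp only [fejer, mul_zero, Real.cos_zero, mul_one]
  rw [intervalIntegral.integral_sub (by simp) (by simp)]
  simp
  ring

lemma fejer_nonneg (T x : ℝ) : 0 ≤ fejer T x := by
  rcases eq_or_ne x 0 with rfl | hx
  · rw [fejer_zero]; positivity
  · have h := sq_mul_fejer T x
    have := Real.cos_le_one (T * x)
    have h2 : 0 < x ^ 2 := by positivity
    by_contra hlt
    push Not at hlt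
    nlinarith

lemma fejer_le {T : ℝ} (hT : 0 ≤ T) (x : ℝ) : fejer T x ≤ T ^ 2 := by
  have : ‖∫ t in (0 : ℝ)..T, (T - t) * Real.cos (t * x)‖ ≤ T * |T - 0| := by
    apply intervalIntegral.norm_integral_le_of_norm_le_const
    intro t ht
    rw [Set.uIoc_of_le hT] at ht
    rw [norm_mul, Real.norm_eq_abs, Real.norm_eq_abs]
    calc |T - t| * |Real.cos (t * x)| ≤ T * 1 := by
          gcongr
          · rw [abs_of_nonneg (by linarith [ht.2])]; linarith [ht.1]
          · exact Real.abs_cos_le_one _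
      _ = T := mul_one T
  rw [sub_zero, abs_of_nonneg hT] at this
  rw [sq]
  exact (le_abs_self _).trans this

lemma integrable_fejer {T : ℝ} (hT : 0 ≤ T) : Integrable (fejer T) := by
  refine (integrable_inv_one_add_sq.const_mul (T ^ 2 + 2)).mono'
    (continuous_fejer T).aestronglyMeasurable (Eventually.of_forall fun x => ?_)
  rw [Real.norm_eq_abs, abs_of_nonneg (fejer_nonneg T x), ← div_eq_mul_inv,
    le_div_iff₀ (by positivity)]
  nlinarith [sq_mul_fejer T x, fejer_le hT x, Real.neg_one_le_cos (T * x)]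

lemma integral_fejer_pos {T : ℝ} (hT : 0 < T) : 0 < ∫ x, fejer T x := by
  refine integral_pos_of_integrable_nonneg_nonzero (x := 0) (continuous_fejer T)
    (integrable_fejer hT.le) (fejer_nonneg T) ?_
  rw [fejer_zero]; positivity

/-- One-sided unsmoothing: a function that decreases at rate at most `K` is controlled from above
by its convolution against a nonnegative kernel. -/
lemma le_of_convolution_le {k : ℝ → ℝ} (hk0 : ∀ x, 0 ≤ k x) (hki : Integrable k)
    {M h : ℝ} (hM : 0 < M) (hkM : ∫ x, k x = M)
    (hkh : 3 / 4 * M ≤ ∫ x in Set.Icc (-h) h, k x)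
    {d : ℝ → ℝ} (hdm : Measurable d) {D K ε : ℝ} (hK : 0 ≤ K) (hε : 0 ≤ ε)
    (hdD : ∀ x, |d x| ≤ D)
    (hd : ∀ x w, 0 ≤ w → d x - K * w ≤ d (x + w))
    (hS : ∀ x, ∫ z, d (x - z) * k z ≤ ε) (x : ℝ) :
    d x ≤ 2 * K * h + 4 / (3 * M) * ε + D / 3 := by
  have hD : 0 ≤ D := (abs_nonneg _).trans (hdD 0)
  by_cases hneg : d x - 2 * K * h < 0
  · have : 0 ≤ 4 / (3 * M) * ε := by positivity
    linarith
  push Not at hneg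
  have hint : Integrable (fun z => d (x + h - z) * k z) := by
    refine hki.bdd_mul (c := D) (hdm.comp (by fun_prop)).aestronglyMeasurable
      (Eventually.of_forall fun z => ?_)
    rw [Real.norm_eq_abs]; exact hdD _
  have h1 : (d x - 2 * K * h) * ∫ z in Set.Icc (-h) h, k z ≤
      ∫ z in Set.Icc (-h) h, d (x + h - z) * k z := by
    rw [← integral_const_mul]
    refine setIntegral_mono_on (hki.integrableOn.const_mul _) hint.integrableOn
      measurableSet_Icc fun z hz => ?_
    refine mul_le_mul_of_nonneg_right ?_ (hk0 z)
    have := hd x (h - z) (by linarith [hz.2])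
    have e : x + (h - z) = x + h - z := by ring
    rw [e] at this
    nlinarith [hz.1, hz.2]
  have h2 : -D * ∫ z in (Set.Icc (-h) h)ᶜ, k z ≤
      ∫ z in (Set.Icc (-h) h)ᶜ, d (x + h - z) * k z := by
    rw [← integral_const_mul]
    refine setIntegral_mono_on (hki.integrableOn.const_mul _) hint.integrableOn
      measurableSet_Icc.compl fun z _ => ?_
    exact mul_le_mul_of_nonneg_right (neg_le_of_abs_le (hdD _)) (hk0 z)
  have h3 := integral_add_compl (measurableSet_Icc (a := -h) (b := h)) hki
  have h4 := integral_add_compl (measurableSet_Icc (a := -h) (b := h)) hint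
  have h5 := hS (x + h)
  rw [hkM] at h3
  set m := ∫ z in Set.Icc (-h) h, k z
  set m' := ∫ z in (Set.Icc (-h) h)ᶜ, k z
  have h6 : (d x - 2 * K * h) * (3 / 4 * M) ≤ ε + D * (M / 4) := by
    have a1 : (d x - 2 * K * h) * (3 / 4 * M) ≤ (d x - 2 * K * h) * m := by gcongr
    have a2 : D * m' ≤ D * (M / 4) := mul_le_mul_of_nonneg_left (by linarith) hD
    linarith
  have h7 : d x - 2 * K * h ≤ (ε + D * (M / 4)) / (3 / 4 * M) := by
    rwa [le_div_iff₀ (by positivity)]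
  have h8 : (ε + D * (M / 4)) / (3 / 4 * M) = 4 / (3 * M) * ε + D / 3 := by
    field_simp
    try ring
  linarith

lemma abs_le_of_abs_convolution_le {k : ℝ → ℝ} (hk0 : ∀ x, 0 ≤ k x) (hki : Integrable k)
    (hke : ∀ x, k (-x) = k x)
    {M h : ℝ} (hM : 0 < M) (hkM : ∫ x, k x = M)
    (hkh : 3 / 4 * M ≤ ∫ x in Set.Icc (-h) h, k x)
    {d : ℝ → ℝ} (hdm : Measurable d) {D K ε : ℝ} (hK : 0 ≤ K) (hε : 0 ≤ ε)
    (hdD : ∀ x, |d x| ≤ D)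
    (hd : ∀ x w, 0 ≤ w → d x - K * w ≤ d (x + w))
    (hS : ∀ x, |∫ z, d (x - z) * k z| ≤ ε) (x : ℝ) :
    |d x| ≤ 3 * K * h + 2 / M * ε := by
  have key : ∀ x, |d x| ≤ 2 * K * h + 4 / (3 * M) * ε + (⨆ y, |d y|) / 3 := by
    intro x
    have hb : ∀ y, |d y| ≤ ⨆ y, |d y| := fun y =>
      le_ciSup (f := fun y => |d y|) ⟨D, by rintro _ ⟨y, rfl⟩; exact hdD y⟩ y
    rw [abs_le']
    refine ⟨le_of_convolution_le hk0 hki hM hkM hkh hdm hK hε hb hd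
      (fun x => (le_abs_self _).trans (hS x)) x, ?_⟩
    have := le_of_convolution_le hk0 hki hM hkM hkh (d := fun x => - d (-x))
      (by fun_prop) hK hε (fun x => by rw [abs_neg]; exact hb _)
      (fun x w hw => by
        have := hd (-x - w) w hw
        rw [sub_add_cancel] at this
        rw [neg_add]
        have e : -x + -w = -x - w := by ring
        rw [e]; linarith)
      (fun x => by
        have e : ∫ z, -d (-(x - z)) * k z = -∫ z, d (-x - z) * k z := by
          rw [← integral_neg_eq_self (fun z => d (-x - z) * k z), ← integral_neg]
          congr 1; ext z
          rw [hke]; ring_nf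
        rw [e]
        exact (neg_le_abs _).trans (hS (-x))) (-x)
    simpa using this
  have hsup : (⨆ y, |d y|) ≤ 2 * K * h + 4 / (3 * M) * ε + (⨆ y, |d y|) / 3 := ciSup_le key
  refine (key x).trans ?_
  have : 2 / M * ε = 3 / 2 * (4 / (3 * M) * ε) := by field_simp; ring
  rw [this]
  linarith

/-- The antiderivative of the kernel vanishing at `-∞`. -/
def fejerCdf (T x : ℝ) : ℝ := ∫ z in Set.Iic x, fejer T z

lemma fejerCdf_sub {T : ℝ} (hT : 0 ≤ T) (x y v : ℝ) :
    fejerCdf T (x - v) - fejerCdf T (y - v) = ∫ u in y..x, fejer T (u - v) := by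
  rw [fejerCdf, fejerCdf, intervalIntegral.integral_Iic_sub_Iic
    (integrable_fejer hT).integrableOn (integrable_fejer hT).integrableOn,
    intervalIntegral.integral_comp_sub_right]

lemma continuous_fejerCdf {T : ℝ} (hT : 0 ≤ T) : Continuous (fejerCdf T) := by
  have : fejerCdf T = fun x => fejerCdf T 0 + ∫ u in (0 : ℝ)..x, fejer T u := by
    ext x
    have := fejerCdf_sub hT x 0 0
    simp only [sub_zero] at this
    rw [← this]; ring
  rw [this]
  exact continuous_const.add (intervalIntegral.continuous_primitive
    (fun a b => (continuous_fejer T).intervalIntegrable a b) 0)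

lemma abs_fejerCdf_le {T : ℝ} (hT : 0 ≤ T) (x : ℝ) : |fejerCdf T x| ≤ ∫ z, fejer T z := by
  rw [fejerCdf, abs_of_nonneg (integral_nonneg (fejer_nonneg T))]
  exact setIntegral_le_integral (integrable_fejer hT) (Eventually.of_forall (fejer_nonneg T))

lemma tendsto_fejerCdf {T : ℝ} (hT : 0 ≤ T) : Tendsto (fejerCdf T) atBot (nhds 0) := by
  have h := intervalIntegral_tendsto_integral_Iic (μ := volume) 0
    (integrable_fejer hT).integrableOn tendsto_id
  have h2 := h.const_sub (fejerCdf T 0)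
  rw [fejerCdf, sub_self] at h2
  refine h2.congr fun x => ?_
  have := fejerCdf_sub hT 0 x 0
  simp only [sub_zero] at this
  rw [id, ← this, fejerCdf, fejerCdf]
  ring

section

variable (μ : Measure ℝ) [IsProbabilityMeasure μ] {T : ℝ}

lemma integrable_fejerCdf (hT : 0 ≤ T) (x : ℝ) : Integrable (fun v => fejerCdf T (x - v)) μ := by
  refine (integrable_const (∫ z, fejer T z)).mono'
    ((continuous_fejerCdf hT).comp (by fun_prop)).aestronglyMeasurable
    (Eventually.of_forall fun v => ?_)
  exact abs_fejerCdf_le hT _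

lemma integral_measureReal_Iic_mul_fejer (hT : 0 ≤ T) (x : ℝ) :
    ∫ z, μ.real (Set.Iic (x - z)) * fejer T z = ∫ v, fejerCdf T (x - v) ∂μ := by
  have hs : MeasurableSet {p : ℝ × ℝ | p.1 + p.2 ≤ x} :=
    measurableSet_le (by fun_prop) (by fun_prop)
  have hi : Integrable (Function.uncurry fun z v : ℝ =>
      {p : ℝ × ℝ | p.1 + p.2 ≤ x}.indicator (fun p => fejer T p.1) (z, v)) (volume.prod μ) :=
    ((integrable_fejer hT).comp_fst μ).indicator hs
  have := integral_integral_swap hi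
  convert this using 3 with z v
  · have e : ∀ v, {p : ℝ × ℝ | p.1 + p.2 ≤ x}.indicator (fun p => fejer T p.1) (z, v) =
        (Set.Iic (x - z)).indicator (fun _ => fejer T z) v := by
      intro v
      simp only [Set.indicator, Set.mem_ofPred_eq, Set.mem_Iic]
      congr 1
      rw [eq_iff_iff]; constructor <;> intro h <;> linarith
    simp only [e]
    rw [integral_indicator_const _ measurableSet_Iic, smul_eq_mul]
  · rw [fejerCdf, ← integral_indicator measurableSet_Iic]
    congr 1; ext z
    simp only [Set.indicator, Set.mem_ofPred_eq, Set.mem_Iic]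
    congr 1
    rw [eq_iff_iff]; constructor <;> intro h <;> linarith

/-- The average over `μ` of the integrated cosine wave of frequency `t` on `[y, x]`. -/
def waveAvg (x y t : ℝ) : ℝ := ∫ v, (∫ u in y..x, Real.cos (t * (u - v))) ∂μ

lemma abs_integral_cos_le (x y t v : ℝ) : |∫ u in y..x, Real.cos (t * (u - v))| ≤ |x - y| := by
  have := intervalIntegral.norm_integral_le_of_norm_le_const (a := y) (b := x) (C := 1)
    (f := fun u => Real.cos (t * (u - v))) (fun u _ => Real.abs_cos_le_one _)
  simpa using this

lemma continuous_integral_cos (x y : ℝ) :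
    Continuous fun p : ℝ × ℝ => ∫ u in y..x, Real.cos (p.1 * (u - p.2)) :=
  intervalIntegral.continuous_parametric_intervalIntegral_of_continuous' (by fun_prop) _ _

lemma integrable_mul_waves (x y : ℝ) : Integrable (Function.uncurry fun v t : ℝ =>
    (T - t) * ∫ u in y..x, Real.cos (t * (u - v))) (μ.prod (volume.restrict (Set.Ioc 0 T))) := by
  have h1 : Integrable (fun t : ℝ => |T - t| * |x - y|) (volume.restrict (Set.Ioc 0 T)) :=
    Continuous.integrableOn_Ioc (by fun_prop)
  refine (h1.comp_snd μ).mono' ?_ (Eventually.of_forall ?_)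
  · refine Continuous.aestronglyMeasurable ?_
    have := (continuous_integral_cos x y).comp (by fun_prop :
      Continuous fun p : ℝ × ℝ => (p.2, p.1))
    exact (by fun_prop : Continuous fun p : ℝ × ℝ => T - p.2).mul this
  · rintro ⟨v, t⟩
    simp only [Function.uncurry_apply_pair, norm_mul, Real.norm_eq_abs]
    exact mul_le_mul_of_nonneg_left (abs_integral_cos_le x y t v) (abs_nonneg _)

lemma intervalIntegrable_waveAvg (hT : 0 ≤ T) (x y : ℝ) :
    IntervalIntegrable (fun t => (T - t) * waveAvg μ x y t) volume 0 T := by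
  rw [intervalIntegrable_iff_integrableOn_Ioc_of_le hT]
  have := (integrable_mul_waves μ (T := T) x y).integral_prod_right
  simpa only [Function.uncurry_apply_pair, integral_const_mul, waveAvg, IntegrableOn] using this

lemma integral_fejerCdf_sub (hT : 0 ≤ T) (x y : ℝ) :
    ∫ v, fejerCdf T (x - v) ∂μ - ∫ v, fejerCdf T (y - v) ∂μ =
      ∫ t in (0 : ℝ)..T, (T - t) * waveAvg μ x y t := by
  rw [← integral_sub (integrable_fejerCdf μ hT x) (integrable_fejerCdf μ hT y)]
  have h1 : ∀ v, fejerCdf T (x - v) - fejerCdf T (y - v) =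
      ∫ t in (0 : ℝ)..T, (T - t) * ∫ u in y..x, Real.cos (t * (u - v)) := by
    intro v
    rw [fejerCdf_sub hT]
    simp only [fejer]
    rw [intervalIntegral_intervalIntegral_swap]
    · simp only [intervalIntegral.integral_const_mul]
    · have hc : Continuous (Function.uncurry fun u t : ℝ => (T - t) * Real.cos (t * (u - v))) := by
        fun_prop
      exact (hc.continuousOn.integrableOn_compact
        (isCompact_uIcc.prod isCompact_uIcc)).mono_set
          (Set.prod_mono Set.uIoc_subset_uIcc Set.uIoc_subset_uIcc)
  simp only [h1, intervalIntegral.integral_of_le hT]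
  rw [integral_integral_swap (integrable_mul_waves μ x y)]
  simp only [integral_const_mul, waveAvg]

lemma mul_waveAvg (x y t : ℝ) :
    t * waveAvg μ x y t =
      ((Complex.exp (-(t * x : ℝ) * Complex.I) - Complex.exp (-(t * y : ℝ) * Complex.I)) *
        charFun μ t * -1).im := by
  have h1 : ∀ v, t * (∫ u in y..x, Real.cos (t * (u - v))) =
      ((Complex.exp (-(t * x : ℝ) * Complex.I) - Complex.exp (-(t * y : ℝ) * Complex.I)) * -1 *
        Complex.exp (t * v * Complex.I)).im := by
    intro v
    have hd : ∀ u ∈ Set.uIcc y x, HasDerivAt (fun u : ℝ => Real.sin (t * (u - v)))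
        (t * Real.cos (t * (u - v))) u := by
      intro u _
      have h1 : HasDerivAt (fun u : ℝ => t * (u - v)) t u := by
        simpa using ((hasDerivAt_id u).sub_const v).const_mul t
      exact h1.sin.congr_deriv (by ring)
    rw [← intervalIntegral.integral_const_mul, intervalIntegral.integral_eq_sub_of_hasDerivAt hd
      (Continuous.intervalIntegrable (by fun_prop) _ _)]
    have e : ∀ w : ℝ, Complex.exp (-(t * w : ℝ) * Complex.I) * Complex.exp (t * v * Complex.I) =
        Complex.exp ((-(t * (w - v)) : ℝ) * Complex.I) := by
      intro w
      rw [← Complex.exp_add]; congr 1; push_cast; ring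
    rw [mul_assoc, mul_comm (-1 : ℂ), ← mul_assoc, sub_mul, e, e, mul_neg_one, Complex.neg_im,
      Complex.sub_im, Complex.exp_ofReal_mul_I_im, Complex.exp_ofReal_mul_I_im, Real.sin_neg,
      Real.sin_neg]
    ring
  rw [waveAvg, ← integral_const_mul]
  simp only [h1]
  rw [mul_right_comm, charFun_apply_real, ← integral_const_mul]
  have hi : Integrable (fun v : ℝ => Complex.exp (t * v * Complex.I)) μ := by
    refine (integrable_const (1 : ℝ)).mono' (by fun_prop) (Eventually.of_forall fun v => ?_)
    rw [← Complex.ofReal_mul, Complex.norm_exp_ofReal_mul_I]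
  exact integral_im (𝕜 := ℂ) (hi.const_mul _)

end

/-- Esseen's smoothing inequality, for characteristic functions compared on a fixed interval. -/
theorem exists_esseen_smoothing {T : ℝ} (hT : 0 < T) : ∃ A : ℝ, 0 ≤ A ∧
    ∀ (μ ν : Measure ℝ) [IsProbabilityMeasure μ] [IsProbabilityMeasure ν] (K : ℝ), 0 ≤ K →
      (∀ x y, x ≤ y → ν.real (Set.Ioc x y) ≤ K * (y - x)) →
      ∀ g : ℝ → ℝ, IntervalIntegrable g volume 0 T →
      (∀ t ∈ Set.Ioc 0 T, ‖charFun μ t - charFun ν t‖ ≤ t * g t) →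
      ∀ x, |μ.real (Set.Iic x) - ν.real (Set.Iic x)| ≤ A * ((∫ t in (0 : ℝ)..T, g t) + K) := by
  obtain ⟨h, hh, hkh⟩ : ∃ h : ℝ, 0 ≤ h ∧
      3 / 4 * ∫ x, fejer T x ≤ ∫ x in Set.Icc (-h) h, fejer T x := by
    have hpos := integral_fejer_pos hT
    have ht := intervalIntegral_tendsto_integral (integrable_fejer hT.le)
      tendsto_neg_atTop_atBot tendsto_id
    have ev := (ht.eventually_const_lt (show 3 / 4 * ∫ x, fejer T x < ∫ x, fejer T x by linarith))
    obtain ⟨h, h1, h2⟩ := (ev.and (eventually_ge_atTop 0)).exists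
    refine ⟨h, h2, ?_⟩
    rw [intervalIntegral.integral_of_le (by simp; linarith)] at h1
    rw [integral_Icc_eq_integral_Ioc]
    exact h1.le
  set M := ∫ x, fejer T x with hM
  have hMpos : 0 < M := integral_fejer_pos hT
  refine ⟨3 * h + 2 / M * (2 * T), by positivity, ?_⟩
  intro μ ν _ _ K hK hν g hg hφ x
  have hg0 : ∀ t ∈ Set.Ioc 0 T, 0 ≤ g t := fun t ht => by
    have := (norm_nonneg _).trans (hφ t ht)
    exact (mul_nonneg_iff_of_pos_left ht.1).1 this
  have hG : 0 ≤ ∫ t in (0 : ℝ)..T, g t := by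
    rw [intervalIntegral.integral_of_le hT.le]
    exact setIntegral_nonneg measurableSet_Ioc hg0
  have hQ : ∀ x y, ∀ t ∈ Set.Ioc 0 T, |waveAvg μ x y t - waveAvg ν x y t| ≤ 2 * g t := by
    intro x y t ht
    have h1 : t * (waveAvg μ x y t - waveAvg ν x y t) =
        ((Complex.exp (-(t * x : ℝ) * Complex.I) - Complex.exp (-(t * y : ℝ) * Complex.I)) *
        (charFun μ t - charFun ν t) * -1).im := by
      rw [mul_sub, mul_waveAvg, mul_waveAvg, ← Complex.sub_im]
      congr 1; ring
    have h2 : t * |waveAvg μ x y t - waveAvg ν x y t| ≤ t * (2 * g t) := by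
      rw [← abs_of_pos ht.1, ← abs_mul, abs_of_pos ht.1, h1]
      refine (Complex.abs_im_le_norm _).trans ?_
      rw [norm_mul, norm_mul, norm_neg, norm_one, mul_one]
      have h3 : ‖Complex.exp (-(t * x : ℝ) * Complex.I) -
          Complex.exp (-(t * y : ℝ) * Complex.I)‖ ≤ 2 := by
        refine (norm_sub_le _ _).trans ?_
        rw [← Complex.ofReal_neg, ← Complex.ofReal_neg, Complex.norm_exp_ofReal_mul_I,
          Complex.norm_exp_ofReal_mul_I]
        norm_num
      have := mul_le_mul h3 (hφ t ht) (norm_nonneg _) (by norm_num)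
      linarith
    exact le_of_mul_le_mul_left h2 ht.1
  set S : ℝ → ℝ := fun x => ∫ v, fejerCdf T (x - v) ∂μ - ∫ v, fejerCdf T (x - v) ∂ν with hS
  have hSsub : ∀ x y, |S x - S y| ≤ 2 * T * ∫ t in (0 : ℝ)..T, g t := by
    intro x y
    have e : S x - S y = ∫ t in (0 : ℝ)..T, (T - t) * (waveAvg μ x y t - waveAvg ν x y t) := by
      simp only [mul_sub]
      rw [intervalIntegral.integral_sub, ← integral_fejerCdf_sub μ hT.le,
        ← integral_fejerCdf_sub ν hT.le]
      · simp only [hS]; ring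
      · simpa only [mul_sub] using intervalIntegrable_waveAvg μ hT.le x y
      · simpa only [mul_sub] using intervalIntegrable_waveAvg ν hT.le x y
    rw [e, ← intervalIntegral.integral_const_mul]
    rw [← Real.norm_eq_abs]
    refine intervalIntegral.norm_integral_le_of_norm_le hT.le
      (Eventually.of_forall fun t ht => ?_) (hg.const_mul _)
    rw [norm_mul, Real.norm_eq_abs, Real.norm_eq_abs, abs_of_nonneg (by linarith [ht.2])]
    calc (T - t) * |waveAvg μ x y t - waveAvg ν x y t| ≤ T * (2 * g t) :=
          mul_le_mul (by linarith [ht.1]) (hQ x y t ht) (abs_nonneg _) hT.le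
      _ = _ := by ring
  have hlim : Tendsto S atBot (nhds 0) := by
    have : ∀ (ρ : Measure ℝ) [IsProbabilityMeasure ρ],
        Tendsto (fun x => ∫ v, fejerCdf T (x - v) ∂ρ) atBot (nhds 0) := by
      intro ρ _
      have := tendsto_integral_filter_of_dominated_convergence (μ := ρ) (l := atBot)
        (F := fun x v => fejerCdf T (x - v)) (f := fun _ => 0) (fun _ => M)
        (Eventually.of_forall fun x => (integrable_fejerCdf ρ hT.le x).aestronglyMeasurable)
        (Eventually.of_forall fun x => Eventually.of_forall fun v => abs_fejerCdf_le hT.le _)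
        (integrable_const _)
        (Eventually.of_forall fun v => (tendsto_fejerCdf hT.le).comp
          (tendsto_atBot_add_const_right _ (-v) tendsto_id))
      simpa using this
    simpa using (this μ).sub (this ν)
  have hSb : ∀ x, |S x| ≤ 2 * T * ∫ t in (0 : ℝ)..T, g t := by
    intro x
    have h1 : Tendsto (fun y => |S x - S y|) atBot (nhds |S x - 0|) := (hlim.const_sub _).abs
    rw [sub_zero] at h1
    exact le_of_tendsto h1 (Eventually.of_forall fun y => hSsub x y)
  have hmono : ∀ (ρ : Measure ℝ) [IsProbabilityMeasure ρ],
      Monotone fun x => ρ.real (Set.Iic x) := fun ρ _ x y hxy =>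
    measureReal_mono (Set.Iic_subset_Iic.2 hxy)
  have hint : ∀ (ρ : Measure ℝ) [IsProbabilityMeasure ρ] (x : ℝ),
      Integrable fun z => ρ.real (Set.Iic (x - z)) * fejer T z := by
    intro ρ _ x
    refine (integrable_fejer hT.le).bdd_mul (c := 1)
      ((hmono ρ).measurable.comp (by fun_prop)).aestronglyMeasurable
      (Eventually.of_forall fun z => ?_)
    rw [Real.norm_eq_abs, abs_of_nonneg measureReal_nonneg]
    exact measureReal_le_one
  have := abs_le_of_abs_convolution_le (fejer_nonneg T) (integrable_fejer hT.le) (fejer_neg T)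
    hMpos hM.symm hkh (d := fun x => μ.real (Set.Iic x) - ν.real (Set.Iic x))
    ((hmono μ).measurable.sub (hmono ν).measurable) (D := 1) hK
    (ε := 2 * T * ∫ t in (0 : ℝ)..T, g t) (by positivity)
    (fun x => by
      have a1 : μ.real (Set.Iic x) ≤ 1 := measureReal_le_one
      have a2 : ν.real (Set.Iic x) ≤ 1 := measureReal_le_one
      have a3 : 0 ≤ μ.real (Set.Iic x) := measureReal_nonneg
      have a4 : 0 ≤ ν.real (Set.Iic x) := measureReal_nonneg
      rw [abs_le]; constructor <;> linarith)
    (fun x w hw => by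
      have a1 := hmono μ (show x ≤ x + w by linarith)
      have a2 : ν.real (Set.Iic (x + w)) = ν.real (Set.Iic x) + ν.real (Set.Ioc x (x + w)) := by
        rw [← Set.Iic_union_Ioc_eq_Iic (show x ≤ x + w by linarith), measureReal_union _
          measurableSet_Ioc]
        exact Set.Iic_disjoint_Ioc le_rfl
      have a3 := hν x (x + w) (by linarith)
      rw [add_sub_cancel_left] at a3
      simp only at a1 ⊢
      linarith)
    (fun x => by
      simp only [sub_mul]
      rw [integral_sub (hint μ x) (hint ν x), integral_measureReal_Iic_mul_fejer μ hT.le,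
        integral_measureReal_Iic_mul_fejer ν hT.le]
      exact hSb x) x
  refine this.trans ?_
  have b1 : 0 ≤ h * ∫ t in (0 : ℝ)..T, g t := by positivity
  have b2 : 0 ≤ 2 / M * (2 * T) * K := by positivity
  linarith

/-- Twice the argument of `1 - w`: the phase shift in one step of the Prüfer recursion. -/
def phase (w : ℂ) : ℝ := 2 * (1 - w).arg

@[fun_prop]
lemma measurable_phase : Measurable phase := by
  unfold phase
  fun_prop

lemma re_one_sub_pos {w : ℂ} (hw : ‖w‖ < 1) : 0 < (1 - w).re := by
  have := Complex.re_le_norm w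
  simp only [Complex.sub_re, Complex.one_re]
  linarith

lemma abs_phase_lt_pi {w : ℂ} (hw : ‖w‖ < 1) : |phase w| < Real.pi := by
  have := Complex.abs_arg_lt_pi_div_two_iff.2 (Or.inl (re_one_sub_pos hw))
  rw [phase, abs_mul, abs_two]
  linarith

lemma phase_eq_log_im (w : ℂ) : phase w = 2 * (Complex.log (1 - w)).im := by
  rw [phase, Complex.log_im]

lemma abs_phase_add_im_le {w : ℂ} (hw : ‖w‖ < 1) : |phase w + 2 * w.im| ≤ 20 * ‖w‖ ^ 2 := by
  have him := Complex.abs_im_le_norm w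
  rcases le_or_gt ‖w‖ (1 / 2) with h | h
  · have h1 := Complex.norm_log_one_add_sub_self_le (z := -w) (by rwa [norm_neg])
    rw [norm_neg] at h1
    have h2 : (1 - ‖w‖)⁻¹ ≤ 2 := by
      rw [inv_le_comm₀ (by linarith) (by norm_num)]; linarith
    have h3 : |(Complex.log (1 - w)).im + w.im| ≤ ‖w‖ ^ 2 := by
      have h4 := (Complex.abs_im_le_norm _).trans h1
      have e : (Complex.log (1 + -w) - -w).im = (Complex.log (1 - w)).im + w.im := by
        simp [sub_eq_add_neg]
      rw [e] at h4
      refine h4.trans ?_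
      nlinarith [sq_nonneg ‖w‖]
    have e : phase w + 2 * w.im = 2 * ((Complex.log (1 - w)).im + w.im) := by
      rw [phase_eq_log_im]; ring
    rw [e, abs_mul, abs_two]
    nlinarith [sq_nonneg ‖w‖]
  · refine (abs_add_le _ _).trans ?_
    have := abs_phase_lt_pi hw
    rw [abs_mul, abs_two]
    nlinarith [Real.pi_lt_four]

lemma abs_phase_le {w : ℂ} (hw : ‖w‖ < 1) : |phase w| ≤ 22 * ‖w‖ := by
  have h1 := abs_phase_add_im_le hw
  have him := Complex.abs_im_le_norm w
  have h2 : |phase w| ≤ |phase w + 2 * w.im| + |2 * w.im| := by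
    have := abs_sub (phase w + 2 * w.im) (2 * w.im)
    rwa [add_sub_cancel_right] at this
  rw [abs_mul, abs_two] at h2
  nlinarith [norm_nonneg w]

lemma hasDerivAt_phase {α : ℂ} (hα : ‖α‖ < 1) (x : ℝ) :
    HasDerivAt (fun x : ℝ => x - phase (α * Complex.exp (x * Complex.I)))
      ((1 - ‖α‖ ^ 2) / ‖1 - α * Complex.exp (x * Complex.I)‖ ^ 2) x := by
  set w := α * Complex.exp (x * Complex.I) with hw
  have hn : ‖w‖ = ‖α‖ := by rw [hw, norm_mul, Complex.norm_exp_ofReal_mul_I, mul_one]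
  have hre := re_one_sub_pos (hn ▸ hα : ‖w‖ < 1)
  have h0 : (1 - w) ≠ 0 := fun h => by rw [h] at hre; simp at hre
  have h1 : HasDerivAt (fun x : ℝ => (x : ℂ) * Complex.I) Complex.I x := by
    simpa using (Complex.ofRealCLM.hasDerivAt (x := x)).mul_const Complex.I
  have h2 : HasDerivAt (fun x : ℝ => 1 - α * Complex.exp (x * Complex.I)) (-(w * Complex.I)) x :=
    ((h1.cexp.const_mul α).const_sub 1).congr_deriv (by rw [hw]; ring)
  have h3 : HasDerivAt (fun x : ℝ => Complex.log (1 - α * Complex.exp (x * Complex.I)))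
      (-(w * Complex.I) / (1 - w)) x :=
    h2.clog_real (Or.inl hre)
  have h4 : HasDerivAt (fun x : ℝ => (Complex.log (1 - α * Complex.exp (x * Complex.I))).im)
      (-(w * Complex.I) / (1 - w)).im x :=
    (Complex.imCLM.hasFDerivAt.comp_hasDerivAt x h3)
  have h5 := (hasDerivAt_id x).sub (h4.const_mul 2)
  simp only [phase_eq_log_im]
  refine h5.congr_deriv ?_
  rw [← hn, ← Complex.normSq_eq_norm_sq, ← Complex.normSq_eq_norm_sq, Complex.div_im]
  have h6 : Complex.normSq (1 - w) ≠ 0 := by simpa using h0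
  field_simp
  simp [Complex.normSq_apply]
  ring

lemma strictMono_sub_phase {α : ℂ} (hα : ‖α‖ < 1) :
    StrictMono fun x : ℝ => x - phase (α * Complex.exp (x * Complex.I)) := by
  refine strictMono_of_hasDerivAt_pos (hasDerivAt_phase hα) fun x => ?_
  have hn : ‖α * Complex.exp (x * Complex.I)‖ < 1 := by
    rwa [norm_mul, Complex.norm_exp_ofReal_mul_I, mul_one]
  have hre := re_one_sub_pos hn
  have h0 : (1 - α * Complex.exp (x * Complex.I)) ≠ 0 := fun h => by rw [h] at hre; simp at hre
  have : ‖α‖ ^ 2 < 1 := by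
    have := norm_nonneg α
    nlinarith
  have := norm_pos_iff.2 h0
  apply div_pos <;> [linarith; positivity]

lemma continuous_sub_phase {α : ℂ} (hα : ‖α‖ < 1) :
    Continuous fun x : ℝ => x - phase (α * Complex.exp (x * Complex.I)) :=
  continuous_iff_continuousAt.2 fun x => (hasDerivAt_phase hα x).continuousAt

/-- The density, up to normalization, of a Verblunsky coefficient. -/
def discDensity (a : ℝ) (w : ℂ) : ℝ :=
  if ‖w‖ < 1 then a / Real.pi * (1 - ‖w‖ ^ 2) ^ (a - 1) else 0

/-- The rotation invariant distribution on the unit disc with density proportional to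
`(1 - |α|²)^(a-1)`. -/
def discMeasure (a : ℝ) : Measure ℂ :=
  volume.withDensity fun w => ENNReal.ofReal (discDensity a w)

@[fun_prop]
lemma measurable_discDensity (a : ℝ) : Measurable (discDensity a) := by
  unfold discDensity
  refine Measurable.ite (measurableSet_lt (by fun_prop) (by fun_prop)) (by fun_prop) (by fun_prop)

lemma discDensity_nonneg {a : ℝ} (ha : 0 ≤ a) (w : ℂ) : 0 ≤ discDensity a w := by
  unfold discDensity
  split_ifs with h
  · have : 0 ≤ 1 - ‖w‖ ^ 2 := by have := norm_nonneg w; nlinarith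
    positivity
  · exact le_rfl

lemma integrableOn_integral_radial {a : ℝ} (ha : 0 < a) :
    IntegrableOn (fun r : ℝ => r * (1 - r ^ 2) ^ (a - 1)) (Set.Ioc 0 1) ∧
      ∫ r in (0 : ℝ)..1, r * (1 - r ^ 2) ^ (a - 1) = 1 / (2 * a) := by
  have hc : ContinuousOn (fun r : ℝ => -(1 - r ^ 2) ^ a / (2 * a)) (Set.Icc 0 1) := by
    apply Continuous.continuousOn
    exact ((Continuous.rpow_const (by fun_prop) fun _ => Or.inr ha.le).neg).div_const _
  have hd : ∀ r ∈ Set.Ioo (0 : ℝ) 1, HasDerivAt (fun r : ℝ => -(1 - r ^ 2) ^ a / (2 * a))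
      (r * (1 - r ^ 2) ^ (a - 1)) r := by
    intro r hr
    have h0 : 0 < 1 - r ^ 2 := by nlinarith [hr.1, hr.2]
    have h1 : HasDerivAt (fun r : ℝ => 1 - r ^ 2) (-(2 * r)) r :=
      ((hasDerivAt_pow 2 r).const_sub 1).congr_deriv (by norm_num)
    refine ((h1.rpow_const (p := a) (Or.inl h0.ne')).neg.div_const (2 * a)).congr_deriv ?_
    field_simp
  have hi := intervalIntegral.integrableOn_deriv_of_nonneg hc hd (fun r hr => by
    have h0 : 0 < 1 - r ^ 2 := by nlinarith [hr.1, hr.2]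
    have := hr.1
    positivity)
  refine ⟨hi, ?_⟩
  rw [intervalIntegral.integral_eq_sub_of_hasDerivAt_of_le zero_le_one hc hd
    ((intervalIntegrable_iff_integrableOn_Ioc_of_le zero_le_one).2 hi)]
  simp [Real.zero_rpow ha.ne']
  ring

lemma integrable_integral_discDensity {a : ℝ} (ha : 0 < a) :
    Integrable (discDensity a) ∧ ∫ w, discDensity a w = 1 := by
  set f : ℝ → ℝ := fun r => if r < 1 then a / Real.pi * (1 - r ^ 2) ^ (a - 1) else 0 with hf
  have e1 : discDensity a = fun w : ℂ => f ‖w‖ := rfl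
  obtain ⟨h1, h2⟩ := integrableOn_integral_radial ha
  have e2 : (fun r : ℝ => r ^ (Module.finrank ℝ ℂ - 1) • f r) =
      (Set.Iio 1).indicator (fun r : ℝ => a / Real.pi * (r * (1 - r ^ 2) ^ (a - 1))) := by
    ext r
    simp only [hf, Set.indicator, Set.mem_Iio, Complex.finrank_real_complex, smul_eq_mul]
    split_ifs <;> (simp; try ring)
  have e3 : Set.Ioi (0 : ℝ) ∩ Set.Iio 1 = Set.Ioo 0 1 := rfl
  constructor
  · rw [e1, integrable_fun_norm_addHaar, e2, IntegrableOn, integrable_indicator_iff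
      measurableSet_Iio, IntegrableOn, Measure.restrict_restrict measurableSet_Iio, Set.inter_comm,
      e3]
    exact (h1.mono_set Set.Ioo_subset_Ioc_self).const_mul _
  · rw [e1, integral_fun_norm_addHaar, e2, setIntegral_indicator measurableSet_Iio, e3,
      integral_const_mul, ← integral_Ioc_eq_integral_Ioo,
      ← intervalIntegral.integral_of_le zero_le_one, h2, measureReal_def, Complex.volume_ball]
    simp
    field_simp

lemma isProbabilityMeasure_discMeasure {a : ℝ} (ha : 0 < a) :
    IsProbabilityMeasure (discMeasure a) := by
  obtain ⟨h1, h2⟩ := integrable_integral_discDensity ha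
  constructor
  rw [discMeasure, withDensity_apply _ MeasurableSet.univ, Measure.restrict_univ,
    ← ofReal_integral_eq_lintegral_ofReal h1 (Eventually.of_forall (discDensity_nonneg ha.le)), h2,
    ENNReal.ofReal_one]

lemma discMeasure_norm_lt (a : ℝ) : ∀ᵐ w ∂discMeasure a, ‖w‖ < 1 := by
  rw [discMeasure, ae_withDensity_iff (by fun_prop)]
  refine Eventually.of_forall fun w hw => ?_
  by_contra h
  simp [discDensity, h] at hw

lemma integral_discMeasure {E : Type*} [NormedAddCommGroup E] [NormedSpace ℝ E] {a : ℝ}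
    (ha : 0 < a) (f : ℂ → E) :
    ∫ w, f w ∂discMeasure a = ∫ w, discDensity a w • f w := by
  rw [discMeasure, integral_withDensity_eq_integral_toReal_smul (by fun_prop)
    (Eventually.of_forall fun _ => ENNReal.ofReal_lt_top)]
  simp only [ENNReal.toReal_ofReal (discDensity_nonneg ha.le _)]

lemma measurePreserving_discMeasure (a : ℝ) {e : ℂ → ℂ} (he : MeasurePreserving e volume volume)
    (hn : ∀ w, ‖e w‖ = ‖w‖) : MeasurePreserving e (discMeasure a) (discMeasure a) := by
  refine ⟨he.measurable, ?_⟩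
  ext s hs
  rw [Measure.map_apply he.measurable hs, discMeasure, withDensity_apply _ hs,
    withDensity_apply _ (he.measurable hs), ← he.setLIntegral_comp_preimage hs (by fun_prop)]
  simp only [discDensity, hn]

lemma measurePreserving_discMeasure_mul (a : ℝ) {c : ℂ} (hc : ‖c‖ = 1) :
    MeasurePreserving (fun w => w * c) (discMeasure a) (discMeasure a) := by
  refine measurePreserving_discMeasure a ?_ fun w => by rw [norm_mul, hc, mul_one]
  have h : c ∈ Submonoid.unitSphere ℂ := by simpa [Submonoid.unitSphere] using hc
  have e : (fun w => w * c) = rotation ⟨c, h⟩ := funext fun w => mul_comm w c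
  rw [e]
  exact (rotation ⟨c, h⟩).measurePreserving

lemma integral_norm_moments {a : ℝ} (ha : 0 < a) :
    ∫ w, ‖w‖ ^ 2 ∂discMeasure a = 1 / (a + 1) ∧
      ∫ w, ‖w‖ ^ 4 ∂discMeasure a = 2 / ((a + 1) * (a + 2)) := by
  have key : ∀ a, 0 < a → ∀ w, discDensity a w * (1 - ‖w‖ ^ 2) =
      a / (a + 1) * discDensity (a + 1) w := by
    intro a ha w
    simp only [discDensity]
    split_ifs with h
    · have h0 : 0 < 1 - ‖w‖ ^ 2 := by have := norm_nonneg w; nlinarith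
      have : (1 - ‖w‖ ^ 2) ^ (a + 1 - 1) = (1 - ‖w‖ ^ 2) ^ (a - 1) * (1 - ‖w‖ ^ 2) := by
        rw [← Real.rpow_add_one h0.ne']; ring_nf
      rw [this]
      field_simp
    · simp
  obtain ⟨i0, j0⟩ := integrable_integral_discDensity ha
  obtain ⟨i1, j1⟩ := integrable_integral_discDensity (show 0 < a + 1 by linarith)
  obtain ⟨i2, j2⟩ := integrable_integral_discDensity (show 0 < a + 2 by linarith)
  constructor
  · have e : ∀ w, discDensity a w • ‖w‖ ^ 2 =
        discDensity a w - a / (a + 1) * discDensity (a + 1) w := by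
      intro w; rw [← key a ha, smul_eq_mul]; ring
    rw [integral_discMeasure ha]
    simp only [e]
    rw [integral_sub i0 (i1.const_mul _), integral_const_mul, j0, j1]
    field_simp; ring
  · have e : ∀ w, discDensity a w • ‖w‖ ^ 4 =
        discDensity a w - 2 * (a / (a + 1)) * discDensity (a + 1) w +
          a / (a + 2) * discDensity (a + 2) w := by
      intro w
      have k1 := key a ha w
      have k2 := key (a + 1) (by linarith) w
      rw [show a + 1 + 1 = a + 2 by ring] at k2
      have k3 : discDensity (a + 2) w =
          (a + 2) / (a + 1) * (discDensity (a + 1) w * (1 - ‖w‖ ^ 2)) := by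
        rw [k2]; field_simp
      have k4 : discDensity (a + 1) w = (a + 1) / a * (discDensity a w * (1 - ‖w‖ ^ 2)) := by
        rw [k1]; field_simp
      rw [k3, k4, smul_eq_mul]
      field_simp
      ring
    rw [integral_discMeasure ha]
    simp only [e]
    have i3 : Integrable fun w => discDensity a w - 2 * (a / (a + 1)) * discDensity (a + 1) w :=
      i0.sub (i1.const_mul _)
    rw [integral_add i3 (i2.const_mul _), integral_sub i0 (i1.const_mul _),
      integral_const_mul, integral_const_mul, j0, j1, j2]
    field_simp; ring

/-- The increment of the relative Prüfer phase produced by a Verblunsky coefficient `w` when the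
current relative phase is `d`. -/
def phaseIncr (d : ℝ) (w : ℂ) : ℝ := phase w - phase (w * Complex.exp (d * Complex.I))

@[fun_prop]
lemma measurable_phaseIncr : Measurable (Function.uncurry phaseIncr) := by
  unfold phaseIncr Function.uncurry
  fun_prop

lemma norm_mul_exp (w : ℂ) (d : ℝ) : ‖w * Complex.exp (d * Complex.I)‖ = ‖w‖ := by
  rw [norm_mul, Complex.norm_exp_ofReal_mul_I, mul_one]

lemma abs_phaseIncr_le (d : ℝ) {w : ℂ} (hw : ‖w‖ < 1) : |phaseIncr d w| ≤ 44 * ‖w‖ := by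
  have h1 := abs_phase_le hw
  have h2 := abs_phase_le (w := w * Complex.exp (d * Complex.I)) (by rwa [norm_mul_exp])
  rw [norm_mul_exp] at h2
  refine (abs_sub _ _).trans ?_
  linarith

/-- The linearization of `phaseIncr` at the origin. -/
def linIncr (d : ℝ) (w : ℂ) : ℝ := 2 * (w * (Complex.exp (d * Complex.I) - 1)).im

lemma abs_phaseIncr_sub_linIncr_le (d : ℝ) {w : ℂ} (hw : ‖w‖ < 1) :
    |phaseIncr d w - linIncr d w| ≤ 40 * ‖w‖ ^ 2 := by
  have h1 := abs_phase_add_im_le hw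
  have h2 := abs_phase_add_im_le (w := w * Complex.exp (d * Complex.I)) (by rwa [norm_mul_exp])
  rw [norm_mul_exp] at h2
  have e : phaseIncr d w - linIncr d w = (phase w + 2 * w.im) -
      (phase (w * Complex.exp (d * Complex.I)) + 2 * (w * Complex.exp (d * Complex.I)).im) := by
    rw [phaseIncr, linIncr, mul_sub, mul_one, Complex.sub_im]; ring
  rw [e]
  refine (abs_sub _ _).trans ?_
  linarith

lemma abs_linIncr_le (d : ℝ) (w : ℂ) : |linIncr d w| ≤ 4 * ‖w‖ := by
  rw [linIncr, abs_mul, abs_two]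
  have h := Complex.abs_im_le_norm (w * (Complex.exp (d * Complex.I) - 1))
  rw [norm_mul] at h
  have h2 : ‖Complex.exp (d * Complex.I) - 1‖ ≤ 2 := by
    refine (norm_sub_le _ _).trans ?_
    rw [Complex.norm_exp_ofReal_mul_I, norm_one]; norm_num
  nlinarith [norm_nonneg w]

lemma norm_exp_phaseIncr_sub_le (d : ℝ) {w : ℂ} (hw : ‖w‖ < 1) {u : ℝ} (hu : |u| ≤ 2) :
    ‖Complex.exp (Complex.I * (u * phaseIncr d w : ℝ)) -
      (1 + Complex.I * (u * phaseIncr d w : ℝ) - ((u ^ 2 / 2 * linIncr d w ^ 2 : ℝ) : ℂ))‖ ≤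
      (2 * 44 ^ 3 * Real.exp 88 + 960) * (u ^ 2 * ‖w‖ ^ 3) := by
  set X := phaseIncr d w
  set Y := linIncr d w
  have hX : |X| ≤ 44 * ‖w‖ := abs_phaseIncr_le d hw
  have hXY : |X - Y| ≤ 40 * ‖w‖ ^ 2 := abs_phaseIncr_sub_linIncr_le d hw
  have hY : |Y| ≤ 4 * ‖w‖ := abs_linIncr_le d w
  have hw0 := norm_nonneg w
  have h1 := Complex.norm_exp_sub_sum_le_norm_mul_exp (Complex.I * (u * X : ℝ)) 3
  rw [norm_mul, Complex.norm_I, one_mul, Complex.norm_real, Real.norm_eq_abs, abs_mul] at h1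
  have e1 : ∑ m ∈ Finset.range 3, (Complex.I * (u * X : ℝ)) ^ m / (m.factorial : ℂ) =
      1 + Complex.I * (u * X : ℝ) - ((u ^ 2 / 2 * X ^ 2 : ℝ) : ℂ) := by
    simp only [Finset.sum_range_succ, Finset.sum_range_zero, Nat.factorial]
    push_cast
    have := Complex.I_sq
    linear_combination (u : ℂ) ^ 2 * X ^ 2 / 2 * this
  rw [e1] at h1
  have h2 : (|u| * |X|) ^ 3 * Real.exp (|u| * |X|) ≤
      2 * 44 ^ 3 * Real.exp 88 * (u ^ 2 * ‖w‖ ^ 3) := by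
    have a1 : |u| * |X| ≤ 88 := by
      calc |u| * |X| ≤ 2 * (44 * 1) := by gcongr; exact hX.trans (by linarith)
        _ = 88 := by norm_num
    have a2 : (|u| * |X|) ^ 3 ≤ 2 * 44 ^ 3 * (u ^ 2 * ‖w‖ ^ 3) := by
      calc (|u| * |X|) ^ 3 = |u| * (u ^ 2 * |X| ^ 3) := by rw [← sq_abs u]; ring
        _ ≤ 2 * (u ^ 2 * (44 * ‖w‖) ^ 3) := by gcongr
        _ = _ := by ring
    calc _ ≤ (2 * 44 ^ 3 * (u ^ 2 * ‖w‖ ^ 3)) * Real.exp 88 := by gcongr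
      _ = _ := by ring
  have h3 : ‖((u ^ 2 / 2 * Y ^ 2 : ℝ) : ℂ) - ((u ^ 2 / 2 * X ^ 2 : ℝ) : ℂ)‖ ≤
      960 * (u ^ 2 * ‖w‖ ^ 3) := by
    rw [← Complex.ofReal_sub, Complex.norm_real, Real.norm_eq_abs]
    have : u ^ 2 / 2 * Y ^ 2 - u ^ 2 / 2 * X ^ 2 = - (u ^ 2 / 2 * ((X - Y) * (X + Y))) := by ring
    rw [this, abs_neg, abs_mul, abs_mul, abs_of_nonneg (by positivity : 0 ≤ u ^ 2 / 2)]
    have h4 : |X + Y| ≤ 48 * ‖w‖ := (abs_add_le _ _).trans (by linarith)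
    calc u ^ 2 / 2 * (|X - Y| * |X + Y|) ≤ u ^ 2 / 2 * ((40 * ‖w‖ ^ 2) * (48 * ‖w‖)) := by gcongr
      _ = _ := by ring
  have e2 : Complex.exp (Complex.I * (u * X : ℝ)) -
      (1 + Complex.I * (u * X : ℝ) - ((u ^ 2 / 2 * Y ^ 2 : ℝ) : ℂ)) =
      (Complex.exp (Complex.I * (u * X : ℝ)) -
        (1 + Complex.I * (u * X : ℝ) - ((u ^ 2 / 2 * X ^ 2 : ℝ) : ℂ))) +
      (((u ^ 2 / 2 * Y ^ 2 : ℝ) : ℂ) - ((u ^ 2 / 2 * X ^ 2 : ℝ) : ℂ)) := by ring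
  rw [e2]
  refine (norm_add_le _ _).trans ?_
  linarith

lemma integral_comp_of_measurePreserving {X E : Type*} [MeasurableSpace X]
    [NormedAddCommGroup E] [NormedSpace ℝ E] {μ : Measure X} {f : X → X}
    (hf : MeasurePreserving f μ μ) {g : X → E} (hg : AEStronglyMeasurable g μ) :
    ∫ x, g (f x) ∂μ = ∫ x, g x ∂μ := by
  rw [← integral_map hf.aemeasurable (by rwa [hf.map_eq]), hf.map_eq]

lemma integrable_comp_of_measurePreserving {X E : Type*} [MeasurableSpace X]
    [NormedAddCommGroup E] {μ : Measure X} {f : X → X}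
    (hf : MeasurePreserving f μ μ) {g : X → E} (hg : Integrable g μ) :
    Integrable (fun x => g (f x)) μ := by
  rw [← hf.map_eq] at hg
  exact hg.comp_measurable hf.measurable

section

variable {a : ℝ}

lemma integrable_discMeasure_of_bound (ha : 0 < a) {E : Type*} [NormedAddCommGroup E] {f : ℂ → E}
    (hf : AEStronglyMeasurable f (discMeasure a)) {C : ℝ} (h : ∀ w, ‖w‖ < 1 → ‖f w‖ ≤ C) :
    Integrable f (discMeasure a) := by
  have := isProbabilityMeasure_discMeasure ha
  exact (integrable_const C).mono' hf ((discMeasure_norm_lt a).mono h)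

lemma integral_phaseIncr (ha : 0 < a) (d : ℝ) : ∫ w, phaseIncr d w ∂discMeasure a = 0 := by
  have i1 : Integrable phase (discMeasure a) :=
    integrable_discMeasure_of_bound ha (by fun_prop) (C := Real.pi)
      fun w hw => (abs_phase_lt_pi hw).le
  have hp := measurePreserving_discMeasure_mul a (Complex.norm_exp_ofReal_mul_I d)
  have i2 : Integrable (fun w => phase (w * Complex.exp (d * Complex.I))) (discMeasure a) :=
    integrable_comp_of_measurePreserving hp i1
  have e0 : ∫ w, phase (w * Complex.exp (d * Complex.I)) ∂discMeasure a =
      ∫ w, phase w ∂discMeasure a :=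
    integral_comp_of_measurePreserving hp i1.aestronglyMeasurable
  simp only [phaseIncr]
  rw [integral_sub i1 i2, e0, sub_self]

lemma integral_linIncr_sq (ha : 0 < a) (d : ℝ) :
    ∫ w, linIncr d w ^ 2 ∂discMeasure a = 4 * (1 - Real.cos d) / (a + 1) := by
  set c := Complex.exp (d * Complex.I) - 1 with hc
  have hb : ∀ w : ℂ, ‖w‖ < 1 → ‖(w * c).im ^ 2‖ ≤ ‖c‖ ^ 2 := by
    intro w hw
    rw [norm_pow, Real.norm_eq_abs]
    have h := Complex.abs_im_le_norm (w * c)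
    rw [norm_mul] at h
    have : ‖w‖ * ‖c‖ ≤ 1 * ‖c‖ := by gcongr
    gcongr
    linarith
  have i1 : Integrable (fun w : ℂ => (w * c).im ^ 2) (discMeasure a) :=
    integrable_discMeasure_of_bound ha (by fun_prop) hb
  have hp := measurePreserving_discMeasure_mul a Complex.norm_I
  have e0 : ∫ w : ℂ, (w * Complex.I * c).im ^ 2 ∂discMeasure a =
      ∫ w : ℂ, (w * c).im ^ 2 ∂discMeasure a :=
    integral_comp_of_measurePreserving hp (g := fun w => (w * c).im ^ 2) i1.aestronglyMeasurable
  have i2 : Integrable (fun w : ℂ => (w * Complex.I * c).im ^ 2) (discMeasure a) :=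
    integrable_comp_of_measurePreserving hp (g := fun w => (w * c).im ^ 2) i1
  have e1 : ∀ w : ℂ, (w * c).im ^ 2 + (w * Complex.I * c).im ^ 2 = ‖c‖ ^ 2 * ‖w‖ ^ 2 := by
    intro w
    have : w * Complex.I * c = (w * c) * Complex.I := by ring
    rw [this, ← mul_pow, ← norm_mul, mul_comm c w, ← Complex.normSq_eq_norm_sq,
      Complex.normSq_apply]
    simp only [Complex.mul_I_im]
    ring
  have e2 : ∫ w : ℂ, (w * c).im ^ 2 ∂discMeasure a = ‖c‖ ^ 2 * (1 / (a + 1)) / 2 := by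
    have := integral_add i1 i2
    simp only [e1] at this
    rw [integral_const_mul, (integral_norm_moments ha).1, e0] at this
    linarith
  have e3 : ‖c‖ ^ 2 = 2 * (1 - Real.cos d) := by
    rw [← Complex.normSq_eq_norm_sq, Complex.normSq_apply, hc]
    simp only [Complex.sub_re, Complex.exp_ofReal_mul_I_re, Complex.one_re, Complex.sub_im,
      Complex.exp_ofReal_mul_I_im, Complex.one_im]
    nlinarith [Real.sin_sq_add_cos_sq d]
  simp only [linIncr, mul_pow]
  rw [integral_const_mul, e2, e3]
  ring

lemma integral_norm_pow_three_le (ha : 0 < a) :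
    ∫ w, ‖w‖ ^ 3 ∂discMeasure a ≤ 2 * a ^ (-(3 / 2) : ℝ) := by
  obtain ⟨m2, m4⟩ := integral_norm_moments ha
  have hb : ∀ n : ℕ, Integrable (fun w : ℂ => ‖w‖ ^ n) (discMeasure a) := fun n =>
    integrable_discMeasure_of_bound ha (by fun_prop) (C := 1) fun w hw => by
      rw [norm_pow, norm_norm]; exact pow_le_one₀ (norm_nonneg _) hw.le
  have hs := Real.sqrt_pos.2 ha
  have hss := Real.sq_sqrt ha.le
  have h1 : ∫ w, ‖w‖ ^ 3 ∂discMeasure a ≤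
      ∫ w, ((1 / (2 * √a)) * ‖w‖ ^ 2 + √a / 2 * ‖w‖ ^ 4) ∂discMeasure a := by
    refine integral_mono (hb 3) (((hb 2).const_mul _).add ((hb 4).const_mul _)) fun w => ?_
    have : (1 / (2 * √a)) * ‖w‖ ^ 2 + √a / 2 * ‖w‖ ^ 4 - ‖w‖ ^ 3 =
        ‖w‖ ^ 2 / (2 * √a) * (√a * ‖w‖ - 1) ^ 2 := by
      field_simp; ring
    have h : 0 ≤ ‖w‖ ^ 2 / (2 * √a) * (√a * ‖w‖ - 1) ^ 2 := by positivity
    simp only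
    linarith
  rw [integral_add ((hb 2).const_mul _) ((hb 4).const_mul _), integral_const_mul,
    integral_const_mul, m2, m4] at h1
  refine h1.trans ?_
  have e : a ^ (-(3 / 2) : ℝ) = 1 / (a * √a) := by
    rw [Real.rpow_neg ha.le, one_div, Real.sqrt_eq_rpow, ← Real.rpow_one_add' ha.le (by norm_num)]
    norm_num
  rw [e]
  have b1 : 1 / (2 * √a) * (1 / (a + 1)) ≤ 1 / 2 * (1 / (a * √a)) := by
    have : 1 / (2 * √a) * (1 / a) = 1 / 2 * (1 / (a * √a)) := by field_simp
    rw [← this]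
    gcongr
    linarith
  have b2 : √a / 2 * (2 / ((a + 1) * (a + 2))) ≤ 1 / (a * √a) := by
    have : √a / 2 * (2 / (a * a)) = 1 / (a * √a) := by
      field_simp; linarith
    rw [← this]
    gcongr <;> linarith
  have : 0 ≤ 1 / (a * √a) := by positivity
  linarith

lemma norm_integral_exp_phaseIncr_sub_le (ha : 0 < a) (d : ℝ) {u : ℝ} (hu : |u| ≤ 2) :
    ‖∫ w, Complex.exp (Complex.I * (u * phaseIncr d w : ℝ)) ∂discMeasure a -
      ((1 - 2 * u ^ 2 * (1 - Real.cos d) / (a + 1) : ℝ) : ℂ)‖ ≤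
      2 * (2 * 44 ^ 3 * Real.exp 88 + 960) * u ^ 2 * a ^ (-(3 / 2) : ℝ) := by
  have := isProbabilityMeasure_discMeasure ha
  have hm : Measurable (phaseIncr d) := measurable_phaseIncr.comp (by fun_prop :
    Measurable fun w : ℂ => (d, w))
  have i1 : Integrable (fun w => Complex.exp (Complex.I * (u * phaseIncr d w : ℝ)))
      (discMeasure a) :=
    integrable_discMeasure_of_bound ha (by fun_prop) (C := 1) fun w _ => by
      rw [mul_comm, Complex.norm_exp_ofReal_mul_I]
  have i2 : Integrable (phaseIncr d) (discMeasure a) :=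
    integrable_discMeasure_of_bound ha (by fun_prop) (C := 44) fun w hw =>
      (abs_phaseIncr_le d hw).trans (by linarith)
  have i3 : Integrable (fun w => linIncr d w ^ 2) (discMeasure a) := by
    refine integrable_discMeasure_of_bound ha (C := 16) ?_ fun w hw => ?_
    · unfold linIncr; fun_prop
    · rw [norm_pow, Real.norm_eq_abs]
      have h := abs_linIncr_le d w
      have h0 := abs_nonneg (linIncr d w)
      nlinarith
  have i4 : Integrable (fun w : ℂ => ‖w‖ ^ 3) (discMeasure a) :=
    integrable_discMeasure_of_bound ha (by fun_prop) (C := 1) fun w hw => by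
      rw [norm_pow, norm_norm]; exact pow_le_one₀ (norm_nonneg _) hw.le
  have i2' : Integrable (fun w => Complex.I * ((u * phaseIncr d w : ℝ) : ℂ)) (discMeasure a) :=
    ((i2.const_mul u).ofReal (𝕜 := ℂ)).const_mul _
  have i3' : Integrable (fun w => ((u ^ 2 / 2 * linIncr d w ^ 2 : ℝ) : ℂ)) (discMeasure a) :=
    (i3.const_mul (u ^ 2 / 2)).ofReal (𝕜 := ℂ)
  have i5 : Integrable (fun w => 1 + Complex.I * ((u * phaseIncr d w : ℝ) : ℂ)) (discMeasure a) :=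
    (integrable_const (1 : ℂ)).add i2'
  have e : ∫ w, (1 + Complex.I * ((u * phaseIncr d w : ℝ) : ℂ) -
      ((u ^ 2 / 2 * linIncr d w ^ 2 : ℝ) : ℂ)) ∂discMeasure a =
      ((1 - 2 * u ^ 2 * (1 - Real.cos d) / (a + 1) : ℝ) : ℂ) := by
    rw [integral_sub i5 i3', integral_add (integrable_const _) i2', integral_const_mul,
      integral_complex_ofReal, integral_complex_ofReal, integral_const_mul, integral_const_mul,
      integral_phaseIncr ha, integral_linIncr_sq ha]
    simp
    ring
  have i6 : Integrable (fun w => 1 + Complex.I * ((u * phaseIncr d w : ℝ) : ℂ) -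
      ((u ^ 2 / 2 * linIncr d w ^ 2 : ℝ) : ℂ)) (discMeasure a) := i5.sub i3'
  rw [← e, ← integral_sub i1 i6]
  refine (norm_integral_le_of_norm_le (i4.const_mul
    ((2 * 44 ^ 3 * Real.exp 88 + 960) * u ^ 2))
    ((discMeasure_norm_lt a).mono fun w hw => ?_)).trans ?_
  · rw [mul_assoc]; exact norm_exp_phaseIncr_sub_le d hw hu
  · rw [integral_const_mul]
    calc _ ≤ (2 * 44 ^ 3 * Real.exp 88 + 960) * u ^ 2 * (2 * a ^ (-(3 / 2) : ℝ)) := by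
          gcongr; exact integral_norm_pow_three_le ha
      _ = _ := by ring

end

/-- The law of the relative Prüfer phase after `k` Verblunsky steps. -/
def phaseLaw (β θ : ℝ) : ℕ → Measure ℝ
  | 0 => Measure.dirac θ
  | k + 1 => ((phaseLaw β θ k).prod (discMeasure ((k + 1) * β / 2))).map
      fun p => p.1 + θ + phaseIncr p.1 p.2

section

variable {β θ : ℝ}

lemma measurable_phaseStep : Measurable fun p : ℝ × ℂ => p.1 + θ + phaseIncr p.1 p.2 :=
  (by fun_prop : Measurable fun p : ℝ × ℂ => p.1 + θ).add measurable_phaseIncr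

lemma isProbabilityMeasure_phaseLaw (hβ : 0 < β) (θ : ℝ) (k : ℕ) :
    IsProbabilityMeasure (phaseLaw β θ k) := by
  induction k with
  | zero => exact Measure.dirac.isProbabilityMeasure
  | succ k ih =>
    have := isProbabilityMeasure_discMeasure (show 0 < ((k : ℝ) + 1) * β / 2 by positivity)
    exact Measure.isProbabilityMeasure_map measurable_phaseStep.aemeasurable

lemma phaseStep_nonneg (hθ : 0 ≤ θ) {d : ℝ} (hd : 0 ≤ d) {w : ℂ} (hw : ‖w‖ < 1) :
    0 ≤ d + θ + phaseIncr d w := by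
  have := (strictMono_sub_phase hw).monotone hd
  simp only [Complex.ofReal_zero, zero_mul, Complex.exp_zero, mul_one] at this
  rw [phaseIncr]
  linarith

lemma ae_prod_norm_lt (hβ : 0 < β) (θ : ℝ) {a : ℝ} (ha : 0 < a) (k : ℕ) :
    ∀ᵐ p ∂(phaseLaw β θ k).prod (discMeasure a), ‖p.2‖ < 1 := by
  have := isProbabilityMeasure_phaseLaw hβ θ k
  have := isProbabilityMeasure_discMeasure ha
  rw [Measure.ae_prod_iff_ae_ae (measurableSet_lt (by fun_prop) (by fun_prop))]
  exact Eventually.of_forall fun _ => discMeasure_norm_lt a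

lemma phaseLaw_nonneg (hβ : 0 < β) (hθ : 0 ≤ θ) (k : ℕ) : ∀ᵐ d ∂phaseLaw β θ k, 0 ≤ d := by
  induction k with
  | zero => rw [phaseLaw, ae_dirac_iff measurableSet_Ici]; exact hθ
  | succ k ih =>
    have := isProbabilityMeasure_phaseLaw hβ θ k
    have ha : 0 < ((k : ℝ) + 1) * β / 2 := by positivity
    have := isProbabilityMeasure_discMeasure ha
    rw [phaseLaw, ae_map_iff measurable_phaseStep.aemeasurable measurableSet_Ici]
    filter_upwards [ae_prod_norm_lt hβ θ ha k,
      Measure.quasiMeasurePreserving_fst.ae ih] with p h1 h2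
    exact phaseStep_nonneg hθ h2 h1

lemma integrable_integral_phaseLaw (hβ : 0 < β) (θ : ℝ) (k : ℕ) :
    Integrable (fun d => d) (phaseLaw β θ k) ∧ ∫ d, d ∂phaseLaw β θ k = (k + 1) * θ := by
  induction k with
  | zero =>
    refine ⟨integrable_dirac (by simp), ?_⟩
    simp [phaseLaw]
  | succ k ih =>
    have := isProbabilityMeasure_phaseLaw hβ θ k
    have ha : 0 < ((k : ℝ) + 1) * β / 2 := by positivity
    have := isProbabilityMeasure_discMeasure ha
    obtain ⟨ih1, ih2⟩ := ih
    set ν := discMeasure (((k : ℝ) + 1) * β / 2)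
    have i1 : Integrable (fun p : ℝ × ℂ => phaseIncr p.1 p.2) ((phaseLaw β θ k).prod ν) :=
      (integrable_const (44 : ℝ)).mono' measurable_phaseIncr.aestronglyMeasurable
        ((ae_prod_norm_lt hβ θ ha k).mono fun p hp =>
          (abs_phaseIncr_le p.1 hp).trans (by linarith))
    have i2 : Integrable (fun p : ℝ × ℂ => p.1 + θ) ((phaseLaw β θ k).prod ν) :=
      (ih1.comp_fst ν).add (integrable_const _)
    have hae : AEStronglyMeasurable (fun d : ℝ => d) (phaseLaw β θ (k + 1)) := by fun_prop
    constructor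
    · rw [phaseLaw] at hae ⊢
      rw [integrable_map_measure hae measurable_phaseStep.aemeasurable]
      exact i2.add i1
    · rw [phaseLaw] at hae ⊢
      rw [integral_map measurable_phaseStep.aemeasurable hae, integral_add i2 i1,
        integral_add (ih1.comp_fst ν) (integrable_const _), integral_prod _ i1]
      have e1 : ∫ p : ℝ × ℂ, p.1 ∂(phaseLaw β θ k).prod ν = (k + 1) * θ := by
        rw [integral_fun_fst (fun d : ℝ => d), ih2]; simp
      have e2 : ∀ d : ℝ, ∫ w, phaseIncr d w ∂ν = 0 := integral_phaseIncr ha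
      simp only [e1, e2]
      simp
      ring

lemma one_sub_cos_le {x : ℝ} (hx : 0 ≤ x) : 1 - Real.cos x ≤ x := by
  have := Real.one_sub_sq_div_two_le_cos (x := x)
  have := Real.neg_one_le_cos x
  rcases le_or_gt x 2 with h | h <;> nlinarith

/-- The characteristic function of the centred phase. -/
def phaseChar (β θ : ℝ) (j : ℕ) (u : ℝ) : ℂ :=
  ∫ d, Complex.exp (Complex.I * (u * (d - (j + 1) * θ) : ℝ)) ∂phaseLaw β θ j

lemma norm_exp_I_mul (x : ℝ) : ‖Complex.exp (Complex.I * x)‖ = 1 := by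
  rw [mul_comm, Complex.norm_exp_ofReal_mul_I]

lemma norm_phaseChar_le (hβ : 0 < β) (θ : ℝ) (j : ℕ) (u : ℝ) : ‖phaseChar β θ j u‖ ≤ 1 := by
  have := isProbabilityMeasure_phaseLaw hβ θ j
  refine (norm_integral_le_of_norm_le_const (C := 1)
    (Eventually.of_forall fun d => (norm_exp_I_mul _).le)).trans ?_
  simp

lemma integrable_of_norm_le_one {X : Type*} [MeasurableSpace X] {μ : Measure X}
    [IsProbabilityMeasure μ] {f : X → ℂ} (hf : Measurable f) {C : ℝ} (h : ∀ x, ‖f x‖ ≤ C) :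
    Integrable f μ :=
  (integrable_const C).mono' hf.aestronglyMeasurable (Eventually.of_forall h)

/-- The part of the phase characteristic function that drives the recursion. -/
def phaseGap (β θ : ℝ) (j : ℕ) (u : ℝ) : ℂ :=
  ∫ d, Complex.exp (Complex.I * (u * (d - (j + 1) * θ) : ℝ)) * ((1 - Real.cos d : ℝ) : ℂ)
    ∂phaseLaw β θ j

lemma phaseGap_eq (hβ : 0 < β) (θ : ℝ) (j : ℕ) (u : ℝ) :
    phaseGap β θ j u = phaseChar β θ j u - shiftAvg θ (phaseChar β θ) j u := by
  have := isProbabilityMeasure_phaseLaw hβ θ j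
  have hi : ∀ u : ℝ, Integrable (fun d : ℝ =>
      Complex.exp (Complex.I * (u * (d - (j + 1) * θ) : ℝ))) (phaseLaw β θ j) := fun u =>
    integrable_of_norm_le_one (by fun_prop) fun d => (norm_exp_I_mul _).le
  simp only [phaseGap, phaseChar, shiftAvg]
  have i : Integrable (fun d : ℝ => (Complex.exp (θ * Complex.I) ^ (j + 1) *
      Complex.exp (Complex.I * ((u + 1) * (d - (j + 1) * θ) : ℝ)) +
      Complex.exp (-θ * Complex.I) ^ (j + 1) *
      Complex.exp (Complex.I * ((u - 1) * (d - (j + 1) * θ) : ℝ))) / 2) (phaseLaw β θ j) :=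
    (((hi _).const_mul _).add ((hi _).const_mul _)).div_const _
  rw [← integral_const_mul, ← integral_const_mul,
    ← integral_add ((hi _).const_mul _) ((hi _).const_mul _), ← integral_div,
    ← integral_sub (hi u) i]
  refine integral_congr_ae (Eventually.of_forall fun d => ?_)
  simp only
  have h1 : Complex.exp (θ * Complex.I) ^ (j + 1) *
      Complex.exp (Complex.I * ((u + 1) * (d - (j + 1) * θ) : ℝ)) =
      Complex.exp (Complex.I * (u * (d - (j + 1) * θ) : ℝ)) * Complex.exp (d * Complex.I) := by
    rw [← Complex.exp_nat_mul, ← Complex.exp_add, ← Complex.exp_add]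
    congr 1; push_cast; ring
  have h2 : Complex.exp (-θ * Complex.I) ^ (j + 1) *
      Complex.exp (Complex.I * ((u - 1) * (d - (j + 1) * θ) : ℝ)) =
      Complex.exp (Complex.I * (u * (d - (j + 1) * θ) : ℝ)) * Complex.exp (-d * Complex.I) := by
    rw [← Complex.exp_nat_mul, ← Complex.exp_add, ← Complex.exp_add]
    congr 1; push_cast; ring
  rw [h1, h2, Complex.ofReal_sub, Complex.ofReal_cos, Complex.cos, Complex.ofReal_one]
  ring

lemma norm_phaseGap_le (hβ : 0 < β) (hθ : 0 ≤ θ) (j : ℕ) (u : ℝ) :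
    ‖phaseGap β θ j u‖ ≤ min 2 ((j + 1) * θ) := by
  have := isProbabilityMeasure_phaseLaw hβ θ j
  obtain ⟨i1, i2⟩ := integrable_integral_phaseLaw hβ θ j
  have hn : ∀ d : ℝ, ‖Complex.exp (Complex.I * (u * (d - (j + 1) * θ) : ℝ)) *
      ((1 - Real.cos d : ℝ) : ℂ)‖ = 1 - Real.cos d := by
    intro d
    rw [norm_mul, norm_exp_I_mul, one_mul, Complex.norm_real, Real.norm_eq_abs,
      abs_of_nonneg (by linarith [Real.cos_le_one d])]
  refine le_min ?_ ?_
  · refine (norm_integral_le_of_norm_le_const (C := 2)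
      (Eventually.of_forall fun d => ?_)).trans (by simp)
    rw [hn]; linarith [Real.neg_one_le_cos d]
  · rw [← i2]
    refine norm_integral_le_of_norm_le i1 ((phaseLaw_nonneg hβ hθ j).mono fun d hd => ?_)
    rw [hn]
    exact one_sub_cos_le hd

lemma norm_phaseChar_succ_le (hβ : 0 < β) (θ : ℝ) (j : ℕ) {u : ℝ} (hu : |u| ≤ 2) :
    ‖phaseChar β θ (j + 1) u - phaseChar β θ j u +
      ((2 * u ^ 2 / ((j + 1) * β / 2 + 1) : ℝ) : ℂ) * phaseGap β θ j u‖ ≤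
      2 * (2 * 44 ^ 3 * Real.exp 88 + 960) * u ^ 2 * ((j + 1) * β / 2) ^ (-(3 / 2) : ℝ) := by
  have := isProbabilityMeasure_phaseLaw hβ θ j
  have ha : 0 < ((j : ℝ) + 1) * β / 2 := by positivity
  set a := ((j : ℝ) + 1) * β / 2
  have := isProbabilityMeasure_discMeasure ha
  have hm := measurable_phaseIncr
  have hm' : Measurable fun p : ℝ × ℂ => phaseIncr p.1 p.2 := hm
  set E : ℝ → ℂ := fun d => Complex.exp (Complex.I * (u * (d - (j + 1) * θ) : ℝ)) with hE
  have hEn : ∀ d, ‖E d‖ = 1 := fun d => norm_exp_I_mul _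
  have hEm : Measurable E := by fun_prop
  have i1 : Integrable (fun p : ℝ × ℂ => E p.1 *
      Complex.exp (Complex.I * (u * phaseIncr p.1 p.2 : ℝ)))
      ((phaseLaw β θ j).prod (discMeasure a)) :=
    integrable_of_norm_le_one (C := 1) (by fun_prop) fun p => by
      rw [norm_mul, hEn, norm_exp_I_mul, one_mul]
  have e1 : phaseChar β θ (j + 1) u = ∫ d, E d * ∫ w,
      Complex.exp (Complex.I * (u * phaseIncr d w : ℝ)) ∂discMeasure a ∂phaseLaw β θ j := by
    rw [phaseChar, phaseLaw, integral_map measurable_phaseStep.aemeasurable (by fun_prop)]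
    have e : ∀ p : ℝ × ℂ, Complex.exp (Complex.I *
        (u * (p.1 + θ + phaseIncr p.1 p.2 - ((j + 1 : ℕ) + 1) * θ) : ℝ)) = E p.1 *
        Complex.exp (Complex.I * (u * phaseIncr p.1 p.2 : ℝ)) := by
      intro p
      rw [hE, ← Complex.exp_add]
      congr 1; push_cast; ring
    simp only [e]
    rw [integral_prod _ i1]
    simp only [integral_const_mul]
  have i2 : Integrable (fun d => E d * ∫ w,
      Complex.exp (Complex.I * (u * phaseIncr d w : ℝ)) ∂discMeasure a) (phaseLaw β θ j) := by
    have := i1.integral_prod_left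
    simpa only [integral_const_mul] using this
  have i3 : Integrable E (phaseLaw β θ j) :=
    integrable_of_norm_le_one hEm fun d => (hEn d).le
  have i4 : Integrable (fun d => E d * ((1 - Real.cos d : ℝ) : ℂ)) (phaseLaw β θ j) :=
    integrable_of_norm_le_one (C := 2) (by fun_prop) fun d => by
      rw [norm_mul, hEn, one_mul, Complex.norm_real, Real.norm_eq_abs,
        abs_of_nonneg (by linarith [Real.cos_le_one d])]
      linarith [Real.neg_one_le_cos d]
  have e2 : phaseChar β θ (j + 1) u - phaseChar β θ j u +
      ((2 * u ^ 2 / (a + 1) : ℝ) : ℂ) * phaseGap β θ j u =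
      ∫ d, E d * (∫ w, Complex.exp (Complex.I * (u * phaseIncr d w : ℝ)) ∂discMeasure a -
        ((1 - 2 * u ^ 2 * (1 - Real.cos d) / (a + 1) : ℝ) : ℂ)) ∂phaseLaw β θ j := by
    have i5 : Integrable (fun d => (E d * ∫ w,
      Complex.exp (Complex.I * (u * phaseIncr d w : ℝ)) ∂discMeasure a) - E d) (phaseLaw β θ j) :=
      i2.sub i3
    rw [e1, phaseChar, phaseGap, ← integral_const_mul, ← integral_sub i2 i3,
      ← integral_add i5 (i4.const_mul _)]
    refine integral_congr_ae (Eventually.of_forall fun d => ?_)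
    simp only
    push_cast
    ring
  rw [e2]
  refine (norm_integral_le_of_norm_le_const (Eventually.of_forall fun d => ?_)).trans
    (by rw [probReal_univ, mul_one])
  rw [norm_mul, hEn, one_mul]
  exact norm_integral_exp_phaseIncr_sub_le ha d hu

lemma exists_phaseChar_recursion (hβ : 0 < β) : ∃ C₀ : ℝ, 0 ≤ C₀ ∧ ∀ θ : ℝ, 0 < θ → ∀ (j : ℕ)
    (u : ℝ), |u| ≤ 2 → ‖phaseChar β θ (j + 1) u - phaseChar β θ j u +
      ((4 / β * u ^ 2 * (θ / scale θ j) : ℝ) : ℂ) *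
        (phaseChar β θ j u - shiftAvg θ (phaseChar β θ) j u)‖ ≤
      C₀ * u ^ 2 * (θ / scale θ j ^ 2 + decay j) := by
  set A : ℝ := 2 * (2 * 44 ^ 3 * Real.exp 88 + 960) * (β / 2) ^ (-(3 / 2) : ℝ)
  have hA : 0 ≤ A := by positivity
  refine ⟨8 * (4 / β) + (16 / β ^ 2 + A), by positivity, fun θ hθ j u hu => ?_⟩
  have hK : (0 : ℝ) < (j : ℝ) + 1 := by positivity
  have hsc : scale θ j = 2 + (j + 1) * θ := rfl
  have hs : 0 < scale θ j := by rw [hsc]; positivity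
  have h1 := norm_phaseChar_succ_le hβ θ j hu
  have h2 := norm_phaseGap_le hβ hθ.le j u
  rw [← phaseGap_eq hβ]
  have hd : decay j = ((j : ℝ) + 1) ^ (-(3 / 2) : ℝ) := rfl
  have h3 : 2 * (2 * 44 ^ 3 * Real.exp 88 + 960) * u ^ 2 * ((j + 1) * β / 2) ^ (-(3 / 2) : ℝ) =
      A * u ^ 2 * decay j := by
    rw [hd, mul_div_assoc, Real.mul_rpow hK.le (by positivity)]; ring
  rw [h3] at h1
  set G := phaseGap β θ j u
  set a := ((j : ℝ) + 1) * β / 2 with ha'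
  have ha : 0 < a := by positivity
  have hG2 : ‖G‖ ≤ 2 := h2.trans (min_le_left _ _)
  have hG4 : ‖G‖ ≤ 4 * ((j + 1) * θ) / scale θ j := by
    rw [le_div_iff₀ hs, hsc]
    have g2 : ‖G‖ ≤ (j + 1) * θ := h2.trans (min_le_right _ _)
    have hx : 0 < ((j : ℝ) + 1) * θ := by positivity
    nlinarith [norm_nonneg G]
  have e : phaseChar β θ (j + 1) u - phaseChar β θ j u +
      ((4 / β * u ^ 2 * (θ / scale θ j) : ℝ) : ℂ) * G =
      (phaseChar β θ (j + 1) u - phaseChar β θ j u + ((2 * u ^ 2 / (a + 1) : ℝ) : ℂ) * G) +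
      (((u ^ 2 * (2 / a - 2 / (a + 1)) : ℝ) : ℂ) * G -
        ((u ^ 2 * (4 / β * (2 / ((j + 1) * scale θ j))) : ℝ) : ℂ) * G) := by
    have e2 : 4 / β * u ^ 2 * (θ / scale θ j) = 2 * u ^ 2 / (a + 1) +
        (u ^ 2 * (2 / a - 2 / (a + 1)) - u ^ 2 * (4 / β * (2 / ((j + 1) * scale θ j)))) := by
      have e3 : θ / scale θ j = 1 / (j + 1) - 2 / ((j + 1) * scale θ j) := by
        field_simp; rw [hsc]; ring
      have e4 : 2 / a = 4 / β * (1 / (j + 1)) := by rw [ha']; field_simp; norm_num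
      rw [e3, e4]; ring
    rw [e2]; push_cast; ring
  rw [e]
  have n1 : ‖((u ^ 2 * (2 / a - 2 / (a + 1)) : ℝ) : ℂ) * G‖ ≤ 16 / β ^ 2 * u ^ 2 * decay j := by
    rw [norm_mul, Complex.norm_real, Real.norm_eq_abs]
    have p1 : 2 / a - 2 / (a + 1) = 2 / (a * (a + 1)) := by field_simp; ring
    have p2 : 2 / (a * (a + 1)) ≤ 2 / (a * a) := by gcongr; linarith
    have p3 : 2 / (a * a) = 8 / β ^ 2 * ((j : ℝ) + 1) ^ (-2 : ℝ) := by
      rw [Real.rpow_neg hK.le, Real.rpow_two, ha']; field_simp; norm_num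
    have p4 : ((j : ℝ) + 1) ^ (-2 : ℝ) ≤ decay j := by
      rw [hd]
      exact Real.rpow_le_rpow_of_exponent_le (by linarith [j.cast_nonneg (α := ℝ)]) (by norm_num)
    have p5 : 0 ≤ 2 / (a * (a + 1)) := by positivity
    rw [p1, abs_of_nonneg (by positivity)]
    have p6 : 2 / (a * (a + 1)) ≤ 8 / β ^ 2 * decay j := by
      rw [p3] at p2
      exact p2.trans (by gcongr)
    have hdn := decay_nonneg j
    have p7 : 0 ≤ 8 / β ^ 2 * decay j := by positivity
    calc u ^ 2 * (2 / (a * (a + 1))) * ‖G‖ ≤ u ^ 2 * (8 / β ^ 2 * decay j) * 2 :=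
          mul_le_mul (mul_le_mul_of_nonneg_left p6 (sq_nonneg u)) hG2
            (norm_nonneg _) (by positivity)
      _ = _ := by ring
  have n2 : ‖((u ^ 2 * (4 / β * (2 / ((j + 1) * scale θ j))) : ℝ) : ℂ) * G‖ ≤
      8 * (4 / β) * u ^ 2 * (θ / scale θ j ^ 2) := by
    rw [norm_mul, Complex.norm_real, Real.norm_eq_abs, abs_of_nonneg (by positivity)]
    calc _ ≤ u ^ 2 * (4 / β * (2 / ((j + 1) * scale θ j))) *
          (4 * ((j + 1) * θ) / scale θ j) := by gcongr
      _ = _ := by field_simp; ring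
  refine (norm_add_le _ _).trans ?_
  have n3 := norm_sub_le (((u ^ 2 * (2 / a - 2 / (a + 1)) : ℝ) : ℂ) * G)
    (((u ^ 2 * (4 / β * (2 / ((j + 1) * scale θ j))) : ℝ) : ℂ) * G)
  have hdn := decay_nonneg j
  have z1 : 0 ≤ 8 * (4 / β) * u ^ 2 * decay j := by positivity
  have z2 : 0 ≤ (16 / β ^ 2 + A) * u ^ 2 * (θ / scale θ j ^ 2) := by positivity
  linarith

lemma phaseChar_zero (u : ℝ) : phaseChar β θ 0 u = 1 := by
  simp [phaseChar, phaseLaw]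

lemma map_phaseLaw_charFun (j : ℕ) (u : ℝ) :
    charFun ((phaseLaw β θ j).map fun d => d - (j + 1) * θ) u = phaseChar β θ j u := by
  rw [charFun_apply_real, integral_map (by fun_prop) (by fun_prop), phaseChar]
  refine integral_congr_ae (Eventually.of_forall fun d => ?_)
  simp only
  congr 1; push_cast; ring

lemma gaussianReal_real_Ioc_le {v : NNReal} (hv : v ≠ 0) {x y : ℝ} (hxy : x ≤ y) :
    (gaussianReal 0 v).real (Set.Ioc x y) ≤ (√(2 * Real.pi * v))⁻¹ * (y - x) := by
  have hp : ∀ t, gaussianPDFReal 0 v t ≤ (√(2 * Real.pi * v))⁻¹ := fun t => by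
    rw [gaussianPDFReal]
    refine mul_le_of_le_one_right (by positivity) (Real.exp_le_one_iff.2 ?_)
    rw [neg_div]
    exact neg_nonpos.2 (by positivity)
  have h := gaussianReal_apply_eq_integral 0 hv (Set.Ioc x y)
  rw [measureReal_def, h, ENNReal.toReal_ofReal
    (setIntegral_nonneg measurableSet_Ioc fun t _ => gaussianPDFReal_nonneg 0 v t)]
  refine (setIntegral_mono (integrable_gaussianPDFReal 0 v).integrableOn
    (integrableOn_const (by simp)) hp).trans ?_
  simp [hxy, mul_comm]

/-- Berry–Esseen bound for the relative Prüfer phase. -/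
theorem exists_phaseLaw_bound (hβ : 0 < β) : ∃ A : ℝ, 0 ≤ A ∧ ∀ (k : ℕ) (θ : ℝ), 0 < θ →
    θ ≤ Real.pi → ∀ x : ℝ, |(phaseLaw β θ k).real {d | d - (k + 1) * θ ≤ x} -
      (gaussianReal 0 (8 / β * Real.log (scale θ k)).toNNReal).real (Set.Iic x)| ≤
      A / √(Real.log (scale θ k)) := by
  obtain ⟨C₀, hC₀, hrec⟩ := exists_phaseChar_recursion hβ
  obtain ⟨c, hc, hc2, C, hC, hbound⟩ := exists_recursion_bound (4 / β) C₀ (by positivity) hC₀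
  obtain ⟨A, hA, hsm⟩ := exists_esseen_smoothing hc
  refine ⟨A * (C * √(Real.pi / (4 / β)) + (√(2 * Real.pi * (8 / β)))⁻¹), by positivity,
    fun k θ hθ hθ' x => ?_⟩
  have hs : 2 ≤ scale θ k := two_le_scale hθ k
  have hs0 : 0 < scale θ k := by linarith
  have hL : 0 < Real.log (scale θ k) := Real.log_pos (by linarith)
  set L := Real.log (scale θ k) with hLdef
  have := isProbabilityMeasure_phaseLaw hβ θ k
  have hmeas : Measurable fun d : ℝ => d - (k + 1) * θ := by fun_prop
  have := Measure.isProbabilityMeasure_map (μ := phaseLaw β θ k) hmeas.aemeasurable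
  have hv : (8 / β * L).toNNReal ≠ 0 := by
    rw [Ne, Real.toNNReal_eq_zero, not_le]; positivity
  have hvc : (((8 / β * L).toNNReal : NNReal) : ℝ) = 8 / β * L :=
    Real.coe_toNNReal _ (by positivity)
  have hcf : ∀ t : ℝ, charFun (gaussianReal 0 (8 / β * L).toNNReal) t =
      ((scale θ k ^ (-(4 / β * t ^ 2)) : ℝ) : ℂ) := by
    intro t
    rw [charFun_gaussianReal, hvc, Real.rpow_def_of_pos hs0, Complex.ofReal_exp]
    congr 1
    push_cast
    rw [← hLdef]
    ring
  have hb := hbound θ hθ hθ' (phaseChar β θ) phaseChar_zero (norm_phaseChar_le hβ θ)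
    (hrec θ hθ) k
  have h := hsm ((phaseLaw β θ k).map fun d => d - (k + 1) * θ)
    (gaussianReal 0 (8 / β * L).toNNReal) (√(2 * Real.pi * (8 / β * L)))⁻¹ (by positivity)
    (fun x y hxy => by simpa only [hvc] using gaussianReal_real_Ioc_le hv hxy)
    (fun t => C * Real.exp (-(4 / β * L) * t ^ 2)) (Continuous.intervalIntegrable (by fun_prop) _ _)
    (fun t ht => by
      rw [map_phaseLaw_charFun, hcf]
      have ht1 : |t| ≤ c := by rw [abs_of_pos ht.1]; exact ht.2
      have ht2 : t ≤ 1 := by linarith [ht.2]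
      refine (hb t ht1).trans ?_
      have e : scale θ k ^ (-(4 / β * t ^ 2)) = Real.exp (-(4 / β * L) * t ^ 2) := by
        rw [Real.rpow_def_of_pos hs0]; congr 1; rw [← hLdef]; ring
      rw [e]
      have : 0 ≤ C * Real.exp (-(4 / β * L) * t ^ 2) := by positivity
      have h2 : t * t ≤ t * 1 := mul_le_mul_of_nonneg_left ht2 ht.1.le
      calc C * t ^ 2 * Real.exp (-(4 / β * L) * t ^ 2) =
          t * t * (C * Real.exp (-(4 / β * L) * t ^ 2)) := by ring
        _ ≤ t * 1 * (C * Real.exp (-(4 / β * L) * t ^ 2)) := mul_le_mul_of_nonneg_right h2 this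
        _ = _ := by ring) x
  rw [map_measureReal_apply hmeas measurableSet_Iic] at h
  refine h.trans ?_
  rw [mul_div_assoc]
  refine mul_le_mul_of_nonneg_left ?_ hA
  rw [add_div]
  refine add_le_add ?_ (le_of_eq ?_)
  · rw [intervalIntegral.integral_of_le hc.le, integral_const_mul, mul_div_assoc]
    refine mul_le_mul_of_nonneg_left ?_ hC
    refine (setIntegral_le_integral (integrable_exp_neg_mul_sq (by positivity))
      (Eventually.of_forall fun t => (Real.exp_pos _).le)).trans ?_
    rw [integral_gaussian, ← Real.sqrt_div' _ hL.le, div_div]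
  · rw [← Real.sqrt_inv, ← Real.sqrt_inv, ← Real.sqrt_div' _ hL.le]
    congr 1
    field_simp

end

/-- The value at `z` of the polynomial with coefficient vector `P`. -/
def evalCoeffs {k : ℕ} (P : Fin k → ℂ) (z : ℂ) : ℂ := ∑ j, P j * z ^ (j : ℕ)

/-- The coefficient vector of the reversed conjugate polynomial. -/
def revConj {k : ℕ} (P : Fin k → ℂ) : Fin k → ℂ := fun j => star (P j.rev)

/-- Append a vanishing leading coefficient. -/
def padZero {k : ℕ} (L : Fin k → ℂ) : Fin (k + 1) → ℂ := Fin.snoc L 0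

/-- One step of the Szegő recursion. -/
def szegoStep {k : ℕ} (L : Fin k → ℂ) (α : ℂ) : Fin (k + 1) → ℂ :=
  padZero L - α • revConj (padZero L)

/-- The last Verblunsky coefficient of a coefficient vector. -/
def lastVerblunsky {k : ℕ} (P : Fin (k + 1) → ℂ) : ℂ := -P (Fin.last k) / star (P 0)

/-- Undo one step of the Szegő recursion. -/
def szegoUnstep {k : ℕ} (P : Fin (k + 1) → ℂ) : Fin k → ℂ :=
  fun j => (P j.castSucc + lastVerblunsky P * revConj P j.castSucc) /
    ((1 - ‖lastVerblunsky P‖ ^ 2 : ℝ) : ℂ)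

/-- Coefficient vectors all of whose Verblunsky coefficients lie in the unit disc. -/
def IsVerblunsky : ∀ k : ℕ, (Fin (k + 1) → ℂ) → Prop
  | 0, P => P 0 ≠ 0
  | k + 1, P => P 0 ≠ 0 ∧ ‖lastVerblunsky P‖ < 1 ∧ IsVerblunsky k (szegoUnstep P)

section

variable {k : ℕ}

lemma revConj_revConj (P : Fin k → ℂ) : revConj (revConj P) = P := by
  ext j; simp [revConj]

lemma revConj_add (P Q : Fin k → ℂ) : revConj (P + Q) = revConj P + revConj Q := by
  ext j; simp [revConj]

lemma revConj_sub (P Q : Fin k → ℂ) : revConj (P - Q) = revConj P - revConj Q := by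
  ext j; simp [revConj]

lemma revConj_smul (c : ℂ) (P : Fin k → ℂ) : revConj (c • P) = star c • revConj P := by
  ext j; simp [revConj]

@[simp] lemma padZero_castSucc (L : Fin k → ℂ) (j : Fin k) : padZero L j.castSucc = L j :=
  Fin.snoc_castSucc (α := fun _ => ℂ) _ _ _

@[simp] lemma padZero_last (L : Fin k → ℂ) : padZero L (Fin.last k) = 0 :=
  Fin.snoc_last (α := fun _ => ℂ) _ _

@[simp] lemma padZero_zero (L : Fin (k + 1) → ℂ) : padZero L 0 = L 0 := by
  rw [← Fin.castSucc_zero, padZero_castSucc]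

@[simp] lemma revConj_padZero_zero (L : Fin k → ℂ) : revConj (padZero L) 0 = 0 := by
  simp [revConj]

lemma revConj_padZero_last (L : Fin (k + 1) → ℂ) :
    revConj (padZero L) (Fin.last (k + 1)) = star (L 0) := by
  simp [revConj]

lemma szegoStep_zero (L : Fin (k + 1) → ℂ) (α : ℂ) : szegoStep L α 0 = L 0 := by
  simp [szegoStep]

lemma szegoStep_last (L : Fin (k + 1) → ℂ) (α : ℂ) :
    szegoStep L α (Fin.last (k + 1)) = -(α * star (L 0)) := by
  rw [szegoStep, Pi.sub_apply, Pi.smul_apply, revConj_padZero_last]; simp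

lemma lastVerblunsky_szegoStep {L : Fin (k + 1) → ℂ} (h : L 0 ≠ 0) (α : ℂ) :
    lastVerblunsky (szegoStep L α) = α := by
  have : star (L 0) ≠ 0 := star_ne_zero.2 h
  rw [lastVerblunsky, szegoStep_last, szegoStep_zero, neg_neg, mul_div_cancel_right₀ _ this]

lemma one_sub_norm_sq_eq (α : ℂ) : ((1 - ‖α‖ ^ 2 : ℝ) : ℂ) = 1 - α * star α := by
  push_cast
  rw [Complex.star_def, Complex.mul_conj']

lemma one_sub_norm_sq_ne_zero {α : ℂ} (h : ‖α‖ < 1) : ((1 - ‖α‖ ^ 2 : ℝ) : ℂ) ≠ 0 := by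
  have : 0 < 1 - ‖α‖ ^ 2 := by nlinarith [norm_nonneg α]
  exact_mod_cast this.ne'

lemma szegoUnstep_szegoStep {L : Fin (k + 1) → ℂ} (h : L 0 ≠ 0) {α : ℂ} (hα : ‖α‖ < 1) :
    szegoUnstep (szegoStep L α) = L := by
  ext j
  rw [szegoUnstep, lastVerblunsky_szegoStep h, div_eq_iff (one_sub_norm_sq_ne_zero hα),
    one_sub_norm_sq_eq, szegoStep, revConj_sub, revConj_smul, revConj_revConj]
  simp only [Pi.sub_apply, Pi.smul_apply, padZero_castSucc, smul_eq_mul]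
  ring

lemma padZero_szegoUnstep {P : Fin (k + 1) → ℂ} (h : P 0 ≠ 0) :
    padZero (szegoUnstep P) = ((1 - ‖lastVerblunsky P‖ ^ 2 : ℝ) : ℂ)⁻¹ •
      (P + lastVerblunsky P • revConj P) := by
  have h' : star (P 0) ≠ 0 := star_ne_zero.2 h
  ext j
  induction j using Fin.lastCases with
  | last =>
    have : lastVerblunsky P * star (P 0) = -P (Fin.last k) := by
      rw [lastVerblunsky, div_mul_cancel₀ _ h']
    simp only [padZero_last, Pi.smul_apply, Pi.add_apply, smul_eq_mul, revConj, Fin.rev_last, this]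
    ring
  | cast j =>
    simp only [padZero_castSucc, szegoUnstep, Pi.smul_apply, Pi.add_apply, smul_eq_mul]
    ring

lemma szegoStep_szegoUnstep {P : Fin (k + 1) → ℂ} (h : P 0 ≠ 0) (hα : ‖lastVerblunsky P‖ < 1) :
    szegoStep (szegoUnstep P) (lastVerblunsky P) = P := by
  have hc := one_sub_norm_sq_ne_zero hα
  rw [szegoStep, padZero_szegoUnstep h]
  set α := lastVerblunsky P
  have hs : star (((1 - ‖α‖ ^ 2 : ℝ) : ℂ)⁻¹) = (((1 - ‖α‖ ^ 2 : ℝ) : ℂ))⁻¹ := by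
    rw [Complex.star_def, map_inv₀, Complex.conj_ofReal]
  rw [revConj_smul, revConj_add, revConj_smul, revConj_revConj, hs]
  ext j
  simp only [Pi.sub_apply, Pi.smul_apply, Pi.add_apply, smul_eq_mul]
  have := one_sub_norm_sq_eq α
  field_simp
  rw [this]
  ring

lemma szegoUnstep_zero {P : Fin (k + 2) → ℂ} (h : P 0 ≠ 0) (hα : ‖lastVerblunsky P‖ < 1) :
    szegoUnstep P 0 = P 0 := by
  conv_rhs => rw [← szegoStep_szegoUnstep h hα, szegoStep_zero]

lemma IsVerblunsky.zero_ne {P : Fin (k + 1) → ℂ} (h : IsVerblunsky k P) : P 0 ≠ 0 := by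
  cases k with
  | zero => exact h
  | succ k => exact h.1

lemma evalCoeffs_sub (P Q : Fin k → ℂ) (z : ℂ) :
    evalCoeffs (P - Q) z = evalCoeffs P z - evalCoeffs Q z := by
  simp [evalCoeffs, sub_mul, Finset.sum_sub_distrib]

lemma evalCoeffs_add (P Q : Fin k → ℂ) (z : ℂ) :
    evalCoeffs (P + Q) z = evalCoeffs P z + evalCoeffs Q z := by
  simp [evalCoeffs, add_mul, Finset.sum_add_distrib]

lemma evalCoeffs_smul (c : ℂ) (P : Fin k → ℂ) (z : ℂ) :
    evalCoeffs (c • P) z = c * evalCoeffs P z := by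
  simp [evalCoeffs, Finset.mul_sum, mul_assoc]

lemma evalCoeffs_padZero (P : Fin k → ℂ) (z : ℂ) :
    evalCoeffs (padZero P) z = evalCoeffs P z := by
  simp [evalCoeffs, Fin.sum_univ_castSucc]

lemma evalCoeffs_zero (P : Fin (k + 1) → ℂ) : evalCoeffs P 0 = P 0 := by
  simp [evalCoeffs, Fin.sum_univ_succ]

lemma evalCoeffs_revConj (P : Fin (k + 1) → ℂ) {z : ℂ} (hz : ‖z‖ = 1) :
    evalCoeffs (revConj P) z = z ^ k * star (evalCoeffs P z) := by
  have hzz : z * star z = 1 := by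
    rw [Complex.star_def, Complex.mul_conj', hz]; simp
  rw [evalCoeffs, evalCoeffs, star_sum, Finset.mul_sum, ← Equiv.sum_comp Fin.revPerm]
  refine Finset.sum_congr rfl fun j _ => ?_
  have hj : k = (j.rev : ℕ) + j := by have := j.isLt; rw [Fin.val_rev]; omega
  simp only [revConj, Fin.revPerm_apply, Fin.rev_rev, star_mul', star_pow]
  have hp : z ^ k = z ^ (j.rev : ℕ) * z ^ (j : ℕ) := by rw [← pow_add, ← hj]
  rw [hp]
  calc star (P j) * z ^ (j.rev : ℕ) = star (P j) * z ^ (j.rev : ℕ) * (z * star z) ^ (j : ℕ) := by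
        rw [hzz, one_pow, mul_one]
    _ = _ := by rw [mul_pow]; ring

lemma evalCoeffs_szegoStep (L : Fin (k + 1) → ℂ) (α : ℂ) {z : ℂ} (hz : ‖z‖ = 1) :
    evalCoeffs (szegoStep L α) z =
      evalCoeffs L z - α * (z ^ (k + 1) * star (evalCoeffs L z)) := by
  rw [szegoStep, evalCoeffs_sub, evalCoeffs_smul, evalCoeffs_revConj _ hz, evalCoeffs_padZero]

end

/-- A continuous increasing phase of the Blaschke product `z P^* / P` along the circle. -/
structure IsPruferPhase (k : ℕ) (P : Fin (k + 1) → ℂ) (Ψ : ℝ → ℝ) : Prop where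
  continuous : Continuous Ψ
  strictMono : StrictMono Ψ
  add_two_pi : ∀ ω, Ψ (ω + 2 * Real.pi) = Ψ ω + 2 * Real.pi * (k + 1)
  eval_ne : ∀ ω : ℝ, evalCoeffs P (Complex.exp (ω * Complex.I)) ≠ 0
  exp_mul : ∀ ω : ℝ, Complex.exp (Ψ ω * Complex.I) * evalCoeffs P (Complex.exp (ω * Complex.I)) =
    Complex.exp (ω * Complex.I) ^ (k + 1) * star (evalCoeffs P (Complex.exp (ω * Complex.I)))

/-- The relative Prüfer phase over the arc from `0` to `θ`. -/
def relPhase (θ : ℝ) : ∀ k : ℕ, (Fin (k + 1) → ℂ) → ℝ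
  | 0, _ => θ
  | k + 1, P => relPhase θ k (szegoUnstep P) + θ +
      phaseIncr (relPhase θ k (szegoUnstep P)) (lastVerblunsky P *
        (star (evalCoeffs (szegoUnstep P) 1) / evalCoeffs (szegoUnstep P) 1))

lemma exp_two_mul_arg_mul_star (a : ℂ) :
    Complex.exp ((2 * a.arg : ℝ) * Complex.I) * star a = a := by
  have h := Complex.norm_mul_exp_arg_mul_I a
  have e : Complex.exp ((2 * a.arg : ℝ) * Complex.I) = Complex.exp (a.arg * Complex.I) *
      Complex.exp (a.arg * Complex.I) := by
    rw [← Complex.exp_add]; congr 1; push_cast; ring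
  have e2 : star a = ‖a‖ * Complex.exp (-(a.arg * Complex.I)) := by
    have h2 := congrArg (starRingEnd ℂ) h
    rw [map_mul, Complex.conj_ofReal, ← Complex.exp_conj, map_mul, Complex.conj_ofReal,
      Complex.conj_I, mul_neg] at h2
    exact h2.symm
  rw [e, e2, Complex.exp_neg]
  conv_rhs => rw [← h]
  have := Complex.exp_ne_zero (a.arg * Complex.I)
  field_simp

lemma exp_phase_mul (w : ℂ) :
    Complex.exp (phase w * Complex.I) * star (1 - w) = 1 - w :=
  exp_two_mul_arg_mul_star (1 - w)

theorem exists_isPruferPhase (θ : ℝ) (k : ℕ) (P : Fin (k + 1) → ℂ) (hP : IsVerblunsky k P) :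
    ∃ Ψ, IsPruferPhase k P Ψ ∧ Ψ θ - Ψ 0 = relPhase θ k P := by
  induction k with
  | zero =>
    have hP0 : P 0 ≠ 0 := hP
    have hev : ∀ z, evalCoeffs P z = P 0 := fun z => by simp [evalCoeffs]
    refine ⟨fun ω => ω - 2 * (P 0).arg, ⟨by fun_prop, ?_, ?_, ?_, ?_⟩, ?_⟩
    · intro x y h; simpa using h
    · intro ω; simp; ring
    · intro ω; rw [hev]; exact hP0
    · intro ω
      rw [hev]
      have h := exp_two_mul_arg_mul_star (P 0)
      have h1 : Complex.exp (ω * Complex.I) ^ (0 + 1) = Complex.exp (ω * Complex.I) := by simp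
      rw [h1, Complex.ofReal_sub, sub_mul, Complex.exp_sub, div_mul_eq_mul_div,
        div_eq_iff (Complex.exp_ne_zero _), mul_assoc, mul_comm (star (P 0)), h]
    · simp [relPhase]
  | succ k ih =>
    obtain ⟨hP0, hα, hL⟩ := hP
    obtain ⟨Ψ, hΨ, hd⟩ := ih _ hL
    set L := szegoUnstep P with hLdef
    set α := lastVerblunsky P with hαdef
    have hPL : szegoStep L α = P := szegoStep_szegoUnstep hP0 hα
    have hw : ∀ ω : ℝ, ‖α * Complex.exp (Ψ ω * Complex.I)‖ < 1 := fun ω => by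
      rw [norm_mul, Complex.norm_exp_ofReal_mul_I, mul_one]; exact hα
    have hPev : ∀ ω : ℝ, evalCoeffs P (Complex.exp (ω * Complex.I)) =
        evalCoeffs L (Complex.exp (ω * Complex.I)) *
          (1 - α * Complex.exp (Ψ ω * Complex.I)) := by
      intro ω
      rw [← hPL, evalCoeffs_szegoStep L α (Complex.norm_exp_ofReal_mul_I ω), ← hΨ.exp_mul]
      ring
    have hne : ∀ ω : ℝ, 1 - α * Complex.exp (Ψ ω * Complex.I) ≠ 0 := fun ω h => by
      have := hw ω
      rw [sub_eq_zero] at h; rw [← h] at this; simp at this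
    refine ⟨fun ω => ω + (Ψ ω - phase (α * Complex.exp (Ψ ω * Complex.I))),
      ⟨?_, ?_, ?_, ?_, ?_⟩, ?_⟩
    · exact continuous_id.add ((continuous_sub_phase hα).comp hΨ.continuous)
    · exact strictMono_id.add ((strictMono_sub_phase hα).comp hΨ.strictMono)
    · intro ω
      have : Complex.exp (Ψ (ω + 2 * Real.pi) * Complex.I) = Complex.exp (Ψ ω * Complex.I) := by
        rw [hΨ.add_two_pi, Complex.exp_eq_exp_iff_exists_int]
        exact ⟨k + 1, by push_cast; ring⟩
      simp only [this]
      rw [hΨ.add_two_pi]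
      push_cast
      ring
    · intro ω
      rw [hPev]
      exact mul_ne_zero (hΨ.eval_ne ω) (hne ω)
    · intro ω
      rw [hPev, star_mul']
      have h1 := hΨ.exp_mul ω
      have h2 := exp_phase_mul (α * Complex.exp (Ψ ω * Complex.I))
      push_cast
      rw [add_mul, sub_mul, Complex.exp_add, Complex.exp_sub]
      have h3 : Complex.exp (phase (α * Complex.exp (Ψ ω * Complex.I)) * Complex.I) ≠ 0 :=
        Complex.exp_ne_zero _
      set E := Complex.exp (Ψ ω * Complex.I)
      set F := Complex.exp (phase (α * E) * Complex.I)
      set p := evalCoeffs L (Complex.exp (ω * Complex.I))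
      set e := Complex.exp (ω * Complex.I)
      calc e * (E / F) * (p * (1 - α * E)) = e * (E * p) / F * (1 - α * E) := by ring
        _ = e * (e ^ (k + 1) * star p) / F * (F * star (1 - α * E)) := by rw [h1, h2]
        _ = _ := by field_simp; ring
    · have e1 : Complex.exp (Ψ 0 * Complex.I) = star (evalCoeffs L 1) / evalCoeffs L 1 := by
        have h1 := hΨ.exp_mul 0
        have h2 := hΨ.eval_ne 0
        simp only [Complex.ofReal_zero, zero_mul, Complex.exp_zero, one_pow, one_mul] at h1 h2
        rw [eq_div_iff h2, h1]
      have e2 : Complex.exp (Ψ θ * Complex.I) = Complex.exp (Ψ 0 * Complex.I) *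
          Complex.exp (relPhase θ k L * Complex.I) := by
        rw [← Complex.exp_add, ← hd]; congr 1; push_cast; ring
      rw [relPhase, ← hLdef, ← hαdef, ← hd, ← e1, phaseIncr, mul_assoc, hd, ← e2, ← hd]
      ring

lemma det_restrictScalars_toLin' {ι : Type*} [Fintype ι] [DecidableEq ι] (M : Matrix ι ι ℂ) :
    LinearMap.det ((Matrix.toLin' M).restrictScalars ℝ) = ‖M.det‖ ^ 2 := by
  rw [LinearMap.det_restrictScalars, LinearMap.det_toLin', Algebra.norm_complex_apply,
    Complex.normSq_eq_norm_sq]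

lemma lintegral_comp_linearMap_mul {E : Type*} [NormedAddCommGroup E] [MeasurableSpace E]
    [BorelSpace E] [NormedSpace ℝ E] [FiniteDimensional ℝ E] (μ : Measure E)
    [μ.IsAddHaarMeasure] {f : E →ₗ[ℝ] E} (hf : LinearMap.det f ≠ 0) {g : E → ENNReal}
    (hg : Measurable g) :
    ENNReal.ofReal |LinearMap.det f| * ∫⁻ x, g (f x) ∂μ = ∫⁻ x, g x ∂μ := by
  have hfm : Measurable f := f.continuous_of_finiteDimensional.measurable
  rw [← lintegral_map hg hfm, Measure.map_linearMap_addHaar_eq_smul_addHaar μ hf,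
    lintegral_smul_measure, smul_eq_mul, ← mul_assoc, ← ENNReal.ofReal_mul (abs_nonneg _),
    ← abs_mul, mul_inv_cancel₀ hf]
  simp

lemma lintegral_comp_mul_complex {c : ℂ} (hc : c ≠ 0) {g : ℂ → ENNReal} (hg : Measurable g) :
    ENNReal.ofReal (‖c‖ ^ 2) * ∫⁻ w, g (c * w) = ∫⁻ w, g w := by
  have hd : LinearMap.det (LinearMap.mulLeft ℝ c) = ‖c‖ ^ 2 := by
    rw [← Complex.normSq_eq_norm_sq, ← Algebra.norm_complex_apply, Algebra.norm_apply]
    rfl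
  have := lintegral_comp_linearMap_mul (volume : Measure ℂ) (f := LinearMap.mulLeft ℝ c)
    (by rw [hd]; positivity) hg
  rwa [hd, abs_of_nonneg (by positivity)] at this

section

variable {k : ℕ}

/-- The antilinear part of the Szegő step, without the leading coefficient. -/
def szegoAnti (k : ℕ) (α : ℂ) : (Fin (k + 1) → ℂ) →ₗ[ℝ] (Fin (k + 1) → ℂ) where
  toFun L j := α * revConj (padZero L) j.castSucc
  map_add' L M := by
    ext j
    have : padZero (L + M) = padZero L + padZero M := by
      ext i; induction i using Fin.lastCases <;> simp
    simp [this, revConj_add, mul_add]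
  map_smul' c L := by
    ext j
    have : padZero (c • L) = (c : ℂ) • padZero L := by
      ext i; induction i using Fin.lastCases <;> simp
    rw [this, revConj_smul]
    simp [mul_left_comm]

lemma szegoAnti_zero (α : ℂ) (L : Fin (k + 1) → ℂ) : szegoAnti k α L 0 = 0 := by
  simp [szegoAnti]

lemma szegoAnti_succ (α : ℂ) (L : Fin (k + 1) → ℂ) (i : Fin k) :
    szegoAnti k α L i.succ = α * star (L i.rev.succ) := by
  have : (i.succ.castSucc).rev = i.rev.succ.castSucc := by ext; simp; omega
  change α * star (padZero L (i.succ.castSucc).rev) = _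
  rw [this, padZero_castSucc]

lemma det_one_sub_szegoAnti_mul (α : ℂ) :
    LinearMap.det (LinearMap.id - szegoAnti k α) * LinearMap.det (LinearMap.id + szegoAnti k α) =
      ((1 - ‖α‖ ^ 2) ^ k) ^ 2 := by
  have h : (LinearMap.id - szegoAnti k α) ∘ₗ (LinearMap.id + szegoAnti k α) =
      (Matrix.toLin'
        (Matrix.diagonal (Fin.cons 1 fun _ : Fin k => 1 - (‖α‖ : ℂ) ^ 2))).restrictScalars
        ℝ := by
    refine LinearMap.ext fun L => funext fun j => ?_
    simp only [LinearMap.comp_apply, LinearMap.sub_apply, LinearMap.add_apply, LinearMap.id_apply,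
      Pi.sub_apply, Pi.add_apply, LinearMap.coe_restrictScalars, Matrix.toLin'_apply,
      Matrix.mulVec_diagonal, map_add]
    induction j using Fin.cases with
    | zero => simp [szegoAnti_zero]
    | succ i =>
      simp only [szegoAnti_succ, Fin.cons_succ, Fin.rev_rev, star_mul', star_star]
      rw [← Complex.mul_conj', ← Complex.star_def]
      ring
  rw [← LinearMap.det_comp, h, det_restrictScalars_toLin', Matrix.det_diagonal,
    Fin.prod_univ_succ]
  simp only [Fin.cons_zero, Fin.cons_succ, Finset.prod_const, Finset.card_univ, Fintype.card_fin,
    one_mul, norm_pow]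
  have : ‖(1 : ℂ) - (‖α‖ : ℂ) ^ 2‖ = |1 - ‖α‖ ^ 2| := by
    rw [← Real.norm_eq_abs, ← Complex.norm_real]; push_cast; rfl
  rw [this, ← abs_pow, sq_abs]

lemma det_one_add_szegoAnti (α : ℂ) :
    LinearMap.det (LinearMap.id + szegoAnti k α) =
      LinearMap.det (LinearMap.id - szegoAnti k α) := by
  let e : (Fin (k + 1) → ℂ) ≃ₗ[ℝ] (Fin (k + 1) → ℂ) :=
    (LinearEquiv.smulOfNeZero ℂ (Fin (k + 1) → ℂ) Complex.I Complex.I_ne_zero).restrictScalars ℝ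
  rw [← LinearMap.det_conj (LinearMap.id - szegoAnti k α) e]
  congr 1
  refine LinearMap.ext fun L => ?_
  have he : ∀ L, e L = Complex.I • L := fun L => rfl
  obtain ⟨M, rfl⟩ := e.surjective L
  simp only [LinearMap.comp_apply, LinearEquiv.coe_coe, LinearEquiv.symm_apply_apply, map_sub,
    LinearMap.sub_apply, LinearMap.add_apply, LinearMap.id_apply]
  rw [sub_eq_add_neg]
  congr 1
  rw [he, he]
  refine funext fun j => ?_
  induction j using Fin.cases with
  | zero => simp [szegoAnti_zero]
  | succ i => simp [szegoAnti_succ]; ring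

lemma abs_det_one_sub_szegoAnti {α : ℂ} (hα : ‖α‖ < 1) :
    |LinearMap.det (LinearMap.id - szegoAnti k α)| = (1 - ‖α‖ ^ 2) ^ k := by
  have h := det_one_sub_szegoAnti_mul (k := k) α
  rw [det_one_add_szegoAnti, ← sq] at h
  have hp : 0 ≤ (1 - ‖α‖ ^ 2) ^ k := pow_nonneg (by nlinarith [norm_nonneg α]) _
  rw [← abs_of_nonneg hp]
  exact (sq_eq_sq_iff_abs_eq_abs _ _).1 h

lemma szegoStep_eq_snoc (L : Fin (k + 1) → ℂ) (α : ℂ) :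
    szegoStep L α = Fin.snoc (α := fun _ => ℂ) (L - szegoAnti k α L)
      (-star (L 0) * α) := by
  ext j
  induction j using Fin.lastCases with
  | last => rw [szegoStep_last, Fin.snoc_last]; ring
  | cast j => rw [Fin.snoc_castSucc]; simp [szegoStep, szegoAnti]

lemma measurable_snoc {X : Type*} [MeasurableSpace X] {f : X → Fin k → ℂ} {g : X → ℂ}
    (hf : Measurable f) (hg : Measurable g) :
    Measurable fun x => (Fin.snoc (α := fun _ => ℂ) (f x) (g x) : Fin (k + 1) → ℂ) := by
  refine measurable_pi_iff.2 fun j => ?_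
  induction j using Fin.lastCases with
  | last => simpa using hg
  | cast j => simpa using! (measurable_pi_apply j).comp hf

lemma lintegral_eq_lintegral_snoc {F : (Fin (k + 1) → ℂ) → ENNReal} (hF : Measurable F) :
    ∫⁻ P, F P = ∫⁻ A : Fin k → ℂ, ∫⁻ t : ℂ, F (Fin.snoc (α := fun _ => ℂ) A t) := by
  have h := volume_preserving_piFinSuccAbove (fun _ : Fin (k + 1) => ℂ) (Fin.last k)
  have h2 := h.symm.lintegral_comp hF
  rw [← h2, Measure.volume_eq_prod, lintegral_prod_symm]
  · refine lintegral_congr fun A => lintegral_congr fun t => ?_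
    congr 1
    ext j
    induction j using Fin.lastCases with
    | last => simp [MeasurableEquiv.piFinSuccAbove]
    | cast j => simp [MeasurableEquiv.piFinSuccAbove]
  · exact (hF.comp (MeasurableEquiv.measurable _)).aemeasurable

lemma volume_eval_zero_eq_zero : ∀ᵐ A : Fin (k + 1) → ℂ, A 0 ≠ 0 := by
  have := (Measure.quasiMeasurePreserving_eval (fun _ : Fin (k + 1) => (volume : Measure ℂ)) 0).ae
    (p := fun z => z ≠ 0) (by simp [ae_iff])
  exact this

lemma measurable_szegoStep : Measurable fun p : (Fin (k + 1) → ℂ) × ℂ => szegoStep p.1 p.2 := by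
  refine measurable_pi_iff.2 fun j => ?_
  simp only [szegoStep, Pi.sub_apply, Pi.smul_apply, smul_eq_mul, revConj]
  have : ∀ i : Fin (k + 2), Measurable fun p : (Fin (k + 1) → ℂ) × ℂ => padZero p.1 i := by
    intro i
    induction i using Fin.lastCases with
    | last => simp
    | cast i => simp only [padZero_castSucc]; fun_prop
  exact (this _).sub (measurable_snd.mul (continuous_star.measurable.comp (this _)))

/-- Change of variables for one step of the Szegő recursion. -/
lemma lintegral_szegoStep {F : (Fin (k + 2) → ℂ) → ENNReal} (hF : Measurable F) :
    ∫⁻ P in {P | ‖lastVerblunsky P‖ < 1}, F P = ∫⁻ α in Metric.ball (0 : ℂ) 1,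
      ∫⁻ L : Fin (k + 1) → ℂ,
        ENNReal.ofReal (‖L 0‖ ^ 2 * (1 - ‖α‖ ^ 2) ^ k) * F (szegoStep L α) := by
  have hmeas : MeasurableSet {P : Fin (k + 2) → ℂ | ‖lastVerblunsky P‖ < 1} := by
    have : Measurable fun P : Fin (k + 2) → ℂ => lastVerblunsky P := by
      unfold lastVerblunsky
      exact (measurable_pi_apply _).neg.div
        (continuous_star.measurable.comp (measurable_pi_apply _))
    exact measurableSet_lt this.norm measurable_const
  have hst : Measurable fun A : Fin (k + 1) → ℂ => -star (A 0) :=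
    (continuous_star.comp (continuous_apply 0)).neg.measurable
  set s := {P : Fin (k + 2) → ℂ | ‖lastVerblunsky P‖ < 1} with hs
  rw [← lintegral_indicator hmeas, lintegral_eq_lintegral_snoc (hF.indicator hmeas)]
  have e1 : ∀ᵐ A : Fin (k + 1) → ℂ, ∫⁻ t : ℂ, s.indicator F (Fin.snoc (α := fun _ => ℂ) A t) =
      ∫⁻ α in Metric.ball (0 : ℂ) 1, ENNReal.ofReal (‖A 0‖ ^ 2) *
        F (Fin.snoc (α := fun _ => ℂ) A (-star (A 0) * α)) := by
    filter_upwards [volume_eval_zero_eq_zero] with A hA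
    have hA' : -star (A 0) ≠ 0 := neg_ne_zero.2 (star_ne_zero.2 hA)
    have hm : Measurable fun t : ℂ => s.indicator F (Fin.snoc (α := fun _ => ℂ) A t) :=
      (hF.indicator hmeas).comp (measurable_snoc measurable_const measurable_id)
    rw [← lintegral_comp_mul_complex hA' hm, ← lintegral_const_mul,
      ← lintegral_indicator measurableSet_ball]
    · refine lintegral_congr fun α => ?_
      have h0 : (Fin.snoc (α := fun _ => ℂ) A (-star (A 0) * α) : Fin (k + 2) → ℂ) 0 = A 0 := by
        exact Fin.snoc_castSucc (α := fun _ => ℂ) _ _ (0 : Fin (k + 1))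
      have h1 : lastVerblunsky (Fin.snoc (α := fun _ => ℂ) A (-star (A 0) * α)) = α := by
        rw [lastVerblunsky, h0, Fin.snoc_last, neg_mul, neg_neg,
          mul_div_cancel_left₀ _ (star_ne_zero.2 hA)]
      simp only [Set.indicator, hs, Set.mem_ofPred_eq, h1, mem_ball_zero_iff, norm_neg, norm_star]
      split_ifs <;> simp
    · exact hm.comp (by fun_prop)
  rw [lintegral_congr_ae e1, lintegral_lintegral_swap]
  · refine setLIntegral_congr_fun measurableSet_ball fun α hα => ?_
    have hα' : ‖α‖ < 1 := by simpa using hα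
    have hd := abs_det_one_sub_szegoAnti (k := k) hα'
    have hp : 0 < (1 - ‖α‖ ^ 2) ^ k := pow_pos (by nlinarith [norm_nonneg α]) _
    have hg : Measurable fun A : Fin (k + 1) → ℂ => ENNReal.ofReal (‖A 0‖ ^ 2) *
        F (Fin.snoc (α := fun _ => ℂ) A (-star (A 0) * α)) :=
      (by fun_prop : Measurable fun A : Fin (k + 1) → ℂ => ENNReal.ofReal (‖A 0‖ ^ 2)).mul
        (hF.comp (measurable_snoc measurable_id (hst.mul_const α)))
    have h := lintegral_comp_linearMap_mul (volume : Measure (Fin (k + 1) → ℂ))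
      (f := LinearMap.id - szegoAnti k α) (fun h => by rw [h, abs_zero] at hd; linarith) hg
    rw [← h, hd, ← lintegral_const_mul]
    · refine lintegral_congr fun L => ?_
      have h0 : (L - szegoAnti k α L) 0 = L 0 := by simp [szegoAnti_zero]
      simp only [LinearMap.sub_apply, LinearMap.id_apply]
      rw [h0, ← szegoStep_eq_snoc, ← mul_assoc, ← ENNReal.ofReal_mul hp.le, mul_comm (_ ^ k)]
    · exact hg.comp (LinearMap.continuous_of_finiteDimensional _).measurable
  · have hst2 : Measurable fun p : (Fin (k + 1) → ℂ) × ℂ => -star (p.1 0) * p.2 :=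
      (hst.comp measurable_fst).mul measurable_snd
    refine Measurable.aemeasurable ?_
    exact (by fun_prop : Measurable fun p : (Fin (k + 1) → ℂ) × ℂ =>
      ENNReal.ofReal (‖p.1 0‖ ^ 2)).mul (hF.comp (measurable_snoc measurable_fst hst2))

end

/-- The joint density, on coefficient vectors, of independent Verblunsky coefficients together with
an independent isotropic constant coefficient whose modulus is Gamma distributed. -/
def szegoDensity (β s : ℝ) : ∀ k : ℕ, (Fin (k + 1) → ℂ) → ENNReal
  | 0, P => if P 0 ≠ 0 then ENNReal.ofReal
      ((2 * Real.pi * Real.Gamma s)⁻¹ * (‖P 0‖ ^ (s - 2) * Real.exp (-‖P 0‖))) else 0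
  | k + 1, P => if P 0 ≠ 0 ∧ ‖lastVerblunsky P‖ < 1 then szegoDensity β s k (szegoUnstep P) *
      ENNReal.ofReal (discDensity ((k + 1) * β / 2) (lastVerblunsky P) /
        (‖P 0‖ ^ 2 * (1 - ‖lastVerblunsky P‖ ^ 2) ^ k)) else 0

/-- The law of the random coefficient vector after `k` Szegő steps. -/
def szegoMeasure (β s : ℝ) (k : ℕ) : Measure (Fin (k + 1) → ℂ) :=
  volume.withDensity (szegoDensity β s k)

section

variable {β s : ℝ} {k : ℕ}

lemma measurable_lastVerblunsky : Measurable (lastVerblunsky : (Fin (k + 1) → ℂ) → ℂ) := by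
  have h : Measurable fun P : Fin (k + 1) → ℂ => star (P 0) :=
    (continuous_star.comp (continuous_apply 0)).measurable
  unfold lastVerblunsky
  exact (measurable_pi_apply _).neg.div h

lemma measurable_szegoUnstep : Measurable (szegoUnstep : (Fin (k + 1) → ℂ) → Fin k → ℂ) := by
  refine measurable_pi_iff.2 fun j => ?_
  have h : Measurable fun P : Fin (k + 1) → ℂ => revConj P j.castSucc :=
    (continuous_star.comp (continuous_apply _)).measurable
  unfold szegoUnstep
  have := measurable_lastVerblunsky (k := k)
  fun_prop

lemma measurable_szegoDensity (β s : ℝ) (k : ℕ) : Measurable (szegoDensity β s k) := by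
  have h0 : ∀ k, MeasurableSet {P : Fin (k + 1) → ℂ | P 0 ≠ 0} := fun k => by
    have hm : Measurable fun P : Fin (k + 1) → ℂ => P 0 := measurable_pi_apply 0
    exact hm (measurableSet_singleton (0 : ℂ)).compl
  induction k with
  | zero =>
    rw [funext (szegoDensity.eq_1 β s)]
    refine Measurable.ite (h0 0) ?_ measurable_const
    fun_prop
  | succ k ih =>
    have hl := measurable_lastVerblunsky (k := k + 1)
    have hd := (measurable_discDensity ((k + 1) * β / 2)).comp hl
    rw [funext (szegoDensity.eq_2 β s k)]
    refine Measurable.ite ((h0 _).inter (measurableSet_lt hl.norm measurable_const)) ?_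
      measurable_const
    refine (ih.comp measurable_szegoUnstep).mul (ENNReal.measurable_ofReal.comp (hd.div ?_))
    fun_prop

lemma isVerblunsky_of_szegoDensity_ne_zero {P : Fin (k + 1) → ℂ}
    (h : szegoDensity β s k P ≠ 0) : IsVerblunsky k P := by
  induction k with
  | zero =>
    simp only [szegoDensity] at h
    by_contra h'
    exact h (if_neg h')
  | succ k ih =>
    simp only [szegoDensity] at h
    split_ifs at h with h'
    · exact ⟨h'.1, h'.2, ih (left_ne_zero_of_mul h)⟩
    · exact absurd rfl h

lemma ae_isVerblunsky : ∀ᵐ P ∂szegoMeasure β s k, IsVerblunsky k P := by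
  rw [szegoMeasure, ae_withDensity_iff (measurable_szegoDensity β s k)]
  exact Eventually.of_forall fun P h => isVerblunsky_of_szegoDensity_ne_zero h

lemma szegoDensity_szegoStep {L : Fin (k + 1) → ℂ} (hL : L 0 ≠ 0) {α : ℂ} (hα : ‖α‖ < 1) :
    ENNReal.ofReal (‖L 0‖ ^ 2 * (1 - ‖α‖ ^ 2) ^ k) * szegoDensity β s (k + 1) (szegoStep L α) =
      szegoDensity β s k L * ENNReal.ofReal (discDensity ((k + 1) * β / 2) α) := by
  have h0 : szegoStep L α 0 ≠ 0 := by rwa [szegoStep_zero]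
  have hp : 0 < 1 - ‖α‖ ^ 2 := by nlinarith [norm_nonneg α]
  have hn : 0 < ‖L 0‖ := norm_pos_iff.2 hL
  rw [szegoDensity, lastVerblunsky_szegoStep hL, if_pos ⟨h0, hα⟩, szegoUnstep_szegoStep hL hα,
    szegoStep_zero, mul_left_comm, ← ENNReal.ofReal_mul (by positivity)]
  congr 2
  field_simp

lemma lintegral_szegoMeasure_succ {F : (Fin (k + 2) → ℂ) → ENNReal} (hF : Measurable F) :
    ∫⁻ P, F P ∂szegoMeasure β s (k + 1) = ∫⁻ α, ∫⁻ L, F (szegoStep L α) ∂szegoMeasure β s k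
      ∂discMeasure ((k + 1) * β / 2) := by
  have hd := measurable_szegoDensity β s
  have hs := measurableSet_lt (measurable_lastVerblunsky (k := k + 1)).norm
    (measurable_const (a := (1 : ℝ)))
  have e : ∀ G : (Fin (k + 2) → ℂ) → ENNReal,
      ∫⁻ P, szegoDensity β s (k + 1) P * G P =
      ∫⁻ P in {P | ‖lastVerblunsky P‖ < 1}, szegoDensity β s (k + 1) P * G P := fun G => by
    rw [← lintegral_indicator hs]
    refine lintegral_congr fun P => ?_
    simp only [Set.indicator, Set.mem_ofPred_eq]
    split_ifs with h
    · rfl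
    · rw [szegoDensity, if_neg fun h' => h h'.2, zero_mul]
  have hin : ∀ α : ℂ, Measurable fun L : Fin (k + 1) → ℂ => F (szegoStep L α) := fun α =>
    hF.comp (measurable_szegoStep.comp (measurable_id.prodMk measurable_const))
  have hjoint : Measurable fun p : ℂ × (Fin (k + 1) → ℂ) => F (szegoStep p.2 p.1) :=
    hF.comp (measurable_szegoStep.comp measurable_swap)
  have hsf : SFinite (szegoMeasure β s k) := by unfold szegoMeasure; infer_instance
  rw [szegoMeasure, lintegral_withDensity_eq_lintegral_mul _ (hd _) hF]
  simp only [Pi.mul_apply]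
  have hm : Measurable fun P => szegoDensity β s (k + 1) P * F P := (hd _).mul hF
  have hdisc : Measurable fun w => ENNReal.ofReal (discDensity ((k + 1) * β / 2) w) :=
    ENNReal.measurable_ofReal.comp (measurable_discDensity _)
  rw [e, lintegral_szegoStep hm, discMeasure,
    lintegral_withDensity_eq_lintegral_mul _ hdisc hjoint.lintegral_prod_right',
    ← lintegral_indicator measurableSet_ball]
  refine lintegral_congr fun α => ?_
  simp only [Set.indicator, mem_ball_zero_iff, Pi.mul_apply]
  split_ifs with hα
  · rw [szegoMeasure, lintegral_withDensity_eq_lintegral_mul _ (hd _) (hin α),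
      ← lintegral_const_mul _ ((hd _).mul (hin α))]
    refine lintegral_congr_ae ?_
    filter_upwards [volume_eval_zero_eq_zero] with L hL
    rw [← mul_assoc, szegoDensity_szegoStep hL hα]
    simp only [Pi.mul_apply]
    ring
  · simp [discDensity, hα]

lemma szegoMeasure_zero_univ (hs : 0 < s) : szegoMeasure β s 0 Set.univ = 1 := by
  have h := volume_preserving_funUnique (Fin 1) ℂ
  have e : szegoMeasure β s 0 Set.univ = ∫⁻ z : ℂ, ENNReal.ofReal
      ((2 * Real.pi * Real.Gamma s)⁻¹ * (‖z‖ ^ (s - 2) * Real.exp (-‖z‖))) := by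
    rw [szegoMeasure, withDensity_apply _ MeasurableSet.univ, Measure.restrict_univ,
      ← h.lintegral_comp (by fun_prop)]
    refine lintegral_congr_ae ?_
    filter_upwards [volume_eval_zero_eq_zero] with P hP
    rw [szegoDensity, if_pos hP]
    rfl
  have hG := Real.Gamma_pos_of_pos hs
  have hI := Complex.integral_rpow_mul_exp_neg_rpow (p := 1) (q := s - 2) le_rfl (by linarith)
  simp only [Real.rpow_one, div_one, sub_add_cancel] at hI
  have hint : Integrable fun z : ℂ => ‖z‖ ^ (s - 2) * Real.exp (-‖z‖) := by
    by_contra hni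
    rw [integral_undef hni] at hI
    have : 0 < 2 * Real.pi * Real.Gamma s := by positivity
    linarith
  rw [e, ← ofReal_integral_eq_lintegral_ofReal (hint.const_mul _)
    (Eventually.of_forall fun z => by positivity), integral_const_mul, hI,
    inv_mul_cancel₀ (by positivity), ENNReal.ofReal_one]

lemma measurable_evalCoeffs (z : ℂ) : Measurable fun P : Fin k → ℂ => evalCoeffs P z := by
  unfold evalCoeffs
  fun_prop

lemma measurable_relPhase (θ : ℝ) (k : ℕ) : Measurable (relPhase θ k) := by
  induction k with
  | zero => exact measurable_const
  | succ k ih =>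
    have h1 := ih.comp measurable_szegoUnstep
    have h2 : Measurable fun P : Fin (k + 2) → ℂ => evalCoeffs (szegoUnstep P) 1 :=
      (measurable_evalCoeffs 1).comp measurable_szegoUnstep
    have h3 : Measurable fun P : Fin (k + 2) → ℂ => lastVerblunsky P *
        (star (evalCoeffs (szegoUnstep P) 1) / evalCoeffs (szegoUnstep P) 1) :=
      measurable_lastVerblunsky.mul ((continuous_star.measurable.comp h2).div h2)
    exact (h1.add_const θ).add (measurable_phaseIncr.comp (h1.prodMk h3))

lemma lintegral_relPhase (hβ : 0 < β) (hs : 0 < s) (θ : ℝ) (k : ℕ) {F : ℝ → ENNReal}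
    (hF : Measurable F) :
    ∫⁻ P, F (relPhase θ k P) ∂szegoMeasure β s k = ∫⁻ d, F d ∂phaseLaw β θ k := by
  induction k generalizing F with
  | zero =>
    simp only [relPhase, phaseLaw]
    rw [lintegral_const, szegoMeasure_zero_univ hs, mul_one, lintegral_dirac' _ hF]
  | succ k ih =>
    have ha : 0 < ((k : ℝ) + 1) * β / 2 := by positivity
    have := isProbabilityMeasure_discMeasure ha
    have := isProbabilityMeasure_phaseLaw hβ θ k
    have hsf : SFinite (szegoMeasure β s k) := by unfold szegoMeasure; infer_instance
    have hm := measurable_relPhase θ (k + 1)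
    have hFd : Measurable fun p : ℝ × ℂ => F (p.1 + θ + phaseIncr p.1 p.2) :=
      hF.comp measurable_phaseStep
    have hFm : Measurable fun P => F (relPhase θ (k + 1) P) := hF.comp hm
    rw [lintegral_szegoMeasure_succ hFm, lintegral_lintegral_swap]
    · have e : ∀ᵐ L ∂szegoMeasure β s k, ∫⁻ α, F (relPhase θ (k + 1) (szegoStep L α))
          ∂discMeasure ((k + 1) * β / 2) = ∫⁻ α, F (relPhase θ k L + θ +
            phaseIncr (relPhase θ k L) α) ∂discMeasure ((k + 1) * β / 2) := by
        filter_upwards [ae_isVerblunsky] with L hL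
        obtain ⟨Ψ, hΨ, -⟩ := exists_isPruferPhase θ k L hL
        have hne : evalCoeffs L 1 ≠ 0 := by simpa using hΨ.eval_ne 0
        have hc : ‖star (evalCoeffs L 1) / evalCoeffs L 1‖ = 1 := by
          rw [norm_div, norm_star, div_self (norm_ne_zero_iff.2 hne)]
        rw [← (measurePreserving_discMeasure_mul _ hc).lintegral_comp
          (f := fun α => F (relPhase θ k L + θ + phaseIncr (relPhase θ k L) α))
          (hFd.comp (measurable_const.prodMk measurable_id))]
        refine lintegral_congr_ae ?_
        filter_upwards [discMeasure_norm_lt _] with α hα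
        rw [relPhase, szegoUnstep_szegoStep hL.zero_ne hα, lastVerblunsky_szegoStep hL.zero_ne]
      rw [lintegral_congr_ae e, ih (F := fun d => ∫⁻ α, F (d + θ + phaseIncr d α)
        ∂discMeasure ((k + 1) * β / 2)) hFd.lintegral_prod_right', phaseLaw,
        lintegral_map hF measurable_phaseStep, lintegral_prod _ hFd.aemeasurable]
    · exact ((hF.comp hm).comp (measurable_szegoStep.comp measurable_swap)).aemeasurable

theorem map_relPhase_szegoMeasure (hβ : 0 < β) (hs : 0 < s) (θ : ℝ) (k : ℕ) :
    (szegoMeasure β s k).map (relPhase θ k) = phaseLaw β θ k := by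
  refine Measure.ext_of_lintegral _ fun F hF => ?_
  rw [lintegral_map hF (measurable_relPhase θ k), lintegral_relPhase hβ hs θ k hF]

end

section

variable {n m : ℕ}

lemma vandermonde_mulVec_eq_evalCoeffs (v : Fin n → ℂ) (P : Fin n → ℂ) (k : Fin n) :
    (Matrix.vandermonde v).mulVec P k = evalCoeffs P (v k) := by
  simp only [Matrix.mulVec, dotProduct, Matrix.vandermonde_apply, evalCoeffs]
  exact Finset.sum_congr rfl fun j _ => mul_comm _ _

lemma eq_of_evalCoeffs_eq {v : Fin n → ℂ} (hv : Function.Injective v) {P Q : Fin n → ℂ}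
    (h : ∀ k, evalCoeffs P (v k) = evalCoeffs Q (v k)) : P = Q := by
  refine Matrix.mulVec_injective_of_isUnit (A := Matrix.vandermonde v) ?_ (funext fun k => ?_)
  · rw [Matrix.isUnit_iff_isUnit_det]
    exact isUnit_iff_ne_zero.2 (Matrix.det_vandermonde_ne_zero_iff.2 hv)
  · rw [vandermonde_mulVec_eq_evalCoeffs, vandermonde_mulVec_eq_evalCoeffs, h k]

/-- The polynomial whose Prüfer phase jumps over the points `t j`, with weights `w j`. -/
def spectralPoly (w t : Fin n → ℝ) : Polynomial ℂ :=
  ∑ j, Polynomial.C (w j * Complex.exp ((t j / 2 : ℝ) * Complex.I)) *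
    ∏ i ∈ Finset.univ.erase j, (Polynomial.C (Complex.exp ((t i / 2 : ℝ) * Complex.I)) -
      Polynomial.C (Complex.exp ((-(t i / 2) : ℝ) * Complex.I)) * Polynomial.X)

/-- The coefficient vector of `spectralPoly`. -/
def spectralCoeffs (w t : Fin n → ℝ) : Fin n → ℂ := fun k => (spectralPoly w t).coeff k

/-- The product of the half-angle sines of all points but the `j`-th. -/
def sinProd (t : Fin n → ℝ) (j : Fin n) (φ : ℝ) : ℝ :=
  ∏ i ∈ Finset.univ.erase j, Real.sin ((t i - φ) / 2)

/-- The normalized real part of `spectralPoly` on the circle. -/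
def trigRe (w t : Fin n → ℝ) (φ : ℝ) : ℝ :=
  ∑ j, w j * (Real.cos ((t j - φ) / 2) * sinProd t j φ)

/-- The normalized imaginary part of `spectralPoly` on the circle. -/
def trigIm (w t : Fin n → ℝ) (φ : ℝ) : ℝ := (∑ j, w j) * ∏ i, Real.sin ((t i - φ) / 2)

lemma sin_mul_sinProd (t : Fin n → ℝ) (j : Fin n) (φ : ℝ) :
    Real.sin ((t j - φ) / 2) * sinProd t j φ = ∏ i, Real.sin ((t i - φ) / 2) :=
  Finset.mul_prod_erase _ (fun i => Real.sin ((t i - φ) / 2)) (Finset.mem_univ j)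

lemma natDegree_spectralPoly_le (w t : Fin (m + 1) → ℝ) : (spectralPoly w t).natDegree ≤ m := by
  refine Polynomial.natDegree_sum_le_of_forall_le _ _ fun j _ => ?_
  refine (Polynomial.natDegree_C_mul_le _ _).trans ((Polynomial.natDegree_prod_le _ _).trans ?_)
  refine (Finset.sum_le_card_nsmul _ _ 1 fun i _ => ?_).trans (by simp)
  exact (Polynomial.natDegree_sub_le _ _).trans (max_le (by simp)
    ((Polynomial.natDegree_C_mul_le _ _).trans Polynomial.natDegree_X_le))

lemma evalCoeffs_eq_eval {p : Polynomial ℂ} (hp : p.natDegree ≤ m) (z : ℂ) :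
    evalCoeffs (fun k : Fin (m + 1) => p.coeff k) z = p.eval z := by
  rw [Polynomial.eval_eq_sum_range' (Nat.lt_succ_of_le hp), Finset.sum_range, evalCoeffs]

lemma evalCoeffs_spectralCoeffs (w t : Fin (m + 1) → ℝ) (z : ℂ) :
    evalCoeffs (spectralCoeffs w t) z = ∑ j, w j * Complex.exp ((t j / 2 : ℝ) * Complex.I) *
      ∏ i ∈ Finset.univ.erase j, (Complex.exp ((t i / 2 : ℝ) * Complex.I) -
        Complex.exp ((-(t i / 2) : ℝ) * Complex.I) * z) := by
  refine (evalCoeffs_eq_eval (natDegree_spectralPoly_le w t) z).trans ?_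
  rw [spectralPoly, Polynomial.eval_finsetSum]
  simp [Polynomial.eval_prod]

lemma exp_sub_exp_mul_exp (a φ : ℝ) :
    Complex.exp ((a / 2 : ℝ) * Complex.I) - Complex.exp ((-(a / 2) : ℝ) * Complex.I) *
      Complex.exp (φ * Complex.I) =
    2 * Complex.I * Complex.exp ((φ / 2 : ℝ) * Complex.I) * (Real.sin ((a - φ) / 2) : ℝ) := by
  have h := Complex.two_sin (((a - φ) / 2 : ℝ) : ℂ)
  have hI : Complex.I * Complex.I = -1 := Complex.I_mul_I
  rw [Complex.ofReal_sin]
  have e1 : Complex.exp ((a / 2 : ℝ) * Complex.I) = Complex.exp (((a - φ) / 2 : ℝ) * Complex.I) *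
      Complex.exp ((φ / 2 : ℝ) * Complex.I) := by
    rw [← Complex.exp_add]; congr 1; push_cast; ring
  have e2 : Complex.exp ((-(a / 2) : ℝ) * Complex.I) * Complex.exp (φ * Complex.I) =
      Complex.exp (-((a - φ) / 2 : ℝ) * Complex.I) * Complex.exp ((φ / 2 : ℝ) * Complex.I) := by
    rw [← Complex.exp_add, ← Complex.exp_add]; congr 1; push_cast; ring
  rw [e1, e2]
  linear_combination (-Complex.I * Complex.exp ((φ / 2 : ℝ) * Complex.I)) * h +
    (Complex.exp (((a - φ) / 2 : ℝ) * Complex.I) - Complex.exp (-((a - φ) / 2 : ℝ) * Complex.I)) *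
    Complex.exp ((φ / 2 : ℝ) * Complex.I) * hI

/-- The unimodular prefactor, up to the scale `2 ^ m`, of `spectralPoly` on the circle. -/
def trigFactor (m : ℕ) (φ : ℝ) : ℂ :=
  (2 * Complex.I) ^ m * Complex.exp ((φ / 2 : ℝ) * Complex.I) ^ (m + 1)

lemma norm_trigFactor (m : ℕ) (φ : ℝ) : ‖trigFactor m φ‖ = 2 ^ m := by
  rw [trigFactor, norm_mul, norm_pow, norm_pow, Complex.norm_exp_ofReal_mul_I]; simp

lemma trigFactor_ne_zero (m : ℕ) (φ : ℝ) : trigFactor m φ ≠ 0 := by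
  rw [← norm_ne_zero_iff, norm_trigFactor]; positivity

lemma evalCoeffs_spectralCoeffs_exp (w t : Fin (m + 1) → ℝ) (φ : ℝ) :
    evalCoeffs (spectralCoeffs w t) (Complex.exp (φ * Complex.I)) =
      trigFactor m φ * (trigRe w t φ + trigIm w t φ * Complex.I) := by
  have e : (trigRe w t φ + trigIm w t φ * Complex.I : ℂ) = ∑ j, (w j : ℂ) *
      Complex.exp (((t j - φ) / 2 : ℝ) * Complex.I) * (sinProd t j φ : ℝ) := by
    rw [trigRe, trigIm, Finset.sum_mul, Complex.ofReal_sum, Complex.ofReal_sum, Finset.sum_mul,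
      ← Finset.sum_add_distrib]
    refine Finset.sum_congr rfl fun j _ => ?_
    rw [← sin_mul_sinProd t j, Complex.exp_mul_I]
    push_cast
    ring
  rw [evalCoeffs_spectralCoeffs, e, Finset.mul_sum]
  refine Finset.sum_congr rfl fun j _ => ?_
  have e1 : Complex.exp ((t j / 2 : ℝ) * Complex.I) =
      Complex.exp (((t j - φ) / 2 : ℝ) * Complex.I) *
      Complex.exp ((φ / 2 : ℝ) * Complex.I) := by
    rw [← Complex.exp_add]; congr 1; push_cast; ring
  simp_rw [exp_sub_exp_mul_exp]
  rw [Finset.prod_mul_distrib, Finset.prod_const, Finset.card_erase_of_mem (Finset.mem_univ j),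
    Finset.card_univ, Fintype.card_fin, Nat.add_sub_cancel, e1, sinProd, trigFactor,
    Complex.ofReal_prod, mul_pow]
  ring

lemma norm_spectralCoeffs_zero (w t : Fin (m + 1) → ℝ) :
    ‖spectralCoeffs w t 0‖ = |∑ j, w j| := by
  have e : spectralCoeffs w t 0 =
      (∑ j, w j : ℝ) * ∏ i, Complex.exp ((t i / 2 : ℝ) * Complex.I) := by
    rw [← evalCoeffs_zero (spectralCoeffs w t), evalCoeffs_spectralCoeffs,
      Complex.ofReal_sum, Finset.sum_mul]
    refine Finset.sum_congr rfl fun j _ => ?_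
    rw [← Finset.mul_prod_erase _ _ (Finset.mem_univ j)]
    simp [mul_assoc]
  rw [e, norm_mul, norm_prod]
  simp only [Complex.norm_exp_ofReal_mul_I, Finset.prod_const_one, mul_one, Complex.norm_real,
    Real.norm_eq_abs]

lemma trigRe_self (w t : Fin n → ℝ) (k : Fin n) : trigRe w t (t k) = w k * sinProd t k (t k) := by
  rw [trigRe, Finset.sum_eq_single k]
  · simp
  · intro j _ hj
    have : sinProd t j (t k) = 0 :=
      Finset.prod_eq_zero (Finset.mem_erase.2 ⟨hj.symm, Finset.mem_univ k⟩) (by simp)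
    simp [this]
  · simp

lemma trigIm_self (w t : Fin n → ℝ) (k : Fin n) : trigIm w t (t k) = 0 := by
  rw [trigIm, Finset.prod_eq_zero (Finset.mem_univ k) (by simp), mul_zero]

lemma sin_half_sub_ne_zero {a b : ℝ} (ha : a ∈ Set.Ico 0 (2 * Real.pi))
    (hb : b ∈ Set.Ico 0 (2 * Real.pi)) (h : a ≠ b) : Real.sin ((a - b) / 2) ≠ 0 := by
  obtain ⟨h1, h2⟩ := ha
  obtain ⟨h3, h4⟩ := hb
  have : (a - b) / 2 ≠ 0 := by intro h'; apply h; linarith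
  exact fun h' => this ((Real.sin_eq_zero_iff_of_lt_of_lt (by linarith) (by linarith)).1 h')

end

section

variable {n m : ℕ}

/-- Splitting a complex vector into its real and imaginary parts. -/
def reImEquiv (n : ℕ) : (Fin n → ℂ) ≃ₗ[ℝ] (Fin n → ℝ) × (Fin n → ℝ) where
  toFun P := (fun k => (P k).re, fun k => (P k).im)
  invFun x := fun k => ⟨x.1 k, x.2 k⟩
  map_add' P Q := by ext <;> simp
  map_smul' c P := by ext <;> simp
  left_inv P := by ext; simp
  right_inv x := by ext <;> simp

lemma measurePreserving_reImEquiv (n : ℕ) :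
    MeasurePreserving (reImEquiv n : (Fin n → ℂ) → (Fin n → ℝ) × (Fin n → ℝ)) volume volume :=
  (volume_measurePreserving_arrowProdEquivProdArrow ℝ ℝ (Fin n)).comp
    (volume_preserving_pi fun _ => Complex.volume_preserving_equiv_real_prod)

/-- The product of the chordal distances between the points of the circle with angles `t`. -/
def circVandermonde (t : Fin n → ℝ) : ℝ :=
  ∏ p ∈ Finset.univ.filter (fun p : Fin n × Fin n => p.1 < p.2),
    ‖Complex.exp (Complex.I * (t p.1 : ℂ)) - Complex.exp (Complex.I * (t p.2 : ℂ))‖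

lemma circVandermonde_eq_prod_Ioi (t : Fin n → ℝ) : circVandermonde t = ∏ i, ∏ j ∈ Finset.Ioi i,
    ‖Complex.exp (t j * Complex.I) - Complex.exp (t i * Complex.I)‖ := by
  rw [circVandermonde, Finset.prod_filter, Fintype.prod_prod_type]
  refine Finset.prod_congr rfl fun i _ => ?_
  rw [← Finset.prod_filter]
  refine Finset.prod_congr (by ext; simp) fun j _ => ?_
  rw [norm_sub_rev, mul_comm Complex.I, mul_comm Complex.I]

lemma norm_det_vandermonde_exp (t : Fin n → ℝ) :
    ‖(Matrix.vandermonde fun k => Complex.exp (t k * Complex.I)).det‖ = circVandermonde t := by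
  rw [Matrix.det_vandermonde, norm_prod, circVandermonde_eq_prod_Ioi]
  simp only [norm_prod]

lemma norm_exp_sub_exp (a b : ℝ) : ‖Complex.exp (a * Complex.I) - Complex.exp (b * Complex.I)‖ =
    2 * |Real.sin ((a - b) / 2)| := by
  have h := exp_sub_exp_mul_exp a b
  have e : Complex.exp (a * Complex.I) - Complex.exp (b * Complex.I) =
      Complex.exp ((a / 2 : ℝ) * Complex.I) * (Complex.exp ((a / 2 : ℝ) * Complex.I) -
        Complex.exp ((-(a / 2) : ℝ) * Complex.I) * Complex.exp (b * Complex.I)) := by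
    rw [mul_sub, ← mul_assoc, ← Complex.exp_add, ← Complex.exp_add]
    congr 2
    · push_cast; ring
    · rw [← add_mul, ← Complex.ofReal_add]; simp
  rw [e, h]
  simp only [norm_mul, Complex.norm_exp_ofReal_mul_I, Complex.norm_I, Complex.norm_real,
    Real.norm_eq_abs]
  simp

lemma prod_two_pow_mul_abs_sinProd (t : Fin (m + 1) → ℝ) :
    ∏ j, (2 ^ m * |sinProd t j (t j)|) = circVandermonde t ^ 2 := by
  have e : ∀ j, 2 ^ m * |sinProd t j (t j)| = ∏ i ∈ {j}ᶜ,
      ‖Complex.exp (t i * Complex.I) - Complex.exp (t j * Complex.I)‖ := fun j => by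
    simp only [norm_exp_sub_exp]
    rw [Finset.prod_mul_distrib, sinProd, Finset.abs_prod, Finset.prod_const, Finset.card_compl,
      Finset.card_singleton, Fintype.card_fin, Nat.add_sub_cancel]
    congr 2
    ext; simp
  simp only [e]
  rw [← Finset.prod_prod_Ioi_mul_eq_prod_prod_off_diag, circVandermonde_eq_prod_Ioi, sq,
    ← Finset.prod_mul_distrib]
  refine Finset.prod_congr rfl fun i _ => ?_
  rw [← Finset.prod_mul_distrib]
  refine Finset.prod_congr rfl fun j _ => ?_
  rw [norm_sub_rev (Complex.exp (t i * Complex.I))]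

lemma differentiable_coeff_prod {ι : Type*} {E : Type*} [NormedAddCommGroup E] [NormedSpace ℝ E]
    {f g : ι → E → ℂ} (hf : ∀ i, Differentiable ℝ (f i)) (hg : ∀ i, Differentiable ℝ (g i))
    (s : Finset ι) (k : ℕ) : Differentiable ℝ fun x => (∏ i ∈ s, (Polynomial.C (f i x) -
      Polynomial.C (g i x) * Polynomial.X)).coeff k := by
  classical
  induction s using Finset.induction_on generalizing k with
  | empty => simp
  | insert a s ha ih =>
    simp only [Finset.prod_insert ha, sub_mul, Polynomial.coeff_sub, Polynomial.coeff_C_mul,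
      mul_assoc]
    refine ((hf a).mul (ih k)).sub ((hg a).mul ?_)
    cases k with
    | zero => simp
    | succ k => simpa using ih k

lemma differentiable_spectralCoeffs : Differentiable ℝ
    fun p : (Fin n → ℝ) × (Fin n → ℝ) => spectralCoeffs p.1 p.2 := by
  refine differentiable_pi.2 fun k => ?_
  simp only [spectralCoeffs, spectralPoly, Polynomial.finsetSum_coeff, Polynomial.coeff_C_mul]
  have hof : Differentiable ℝ (fun x : ℝ => (x : ℂ)) := Complex.ofRealCLM.differentiable
  have he : ∀ i, Differentiable ℝ fun p : (Fin n → ℝ) × (Fin n → ℝ) =>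
      Complex.exp ((p.2 i / 2 : ℝ) * Complex.I) := fun i =>
    (((hof.comp (by fun_prop : Differentiable ℝ fun p : (Fin n → ℝ) × (Fin n → ℝ) => p.2 i / 2))
      ).mul_const _).cexp
  have he' : ∀ i, Differentiable ℝ fun p : (Fin n → ℝ) × (Fin n → ℝ) =>
      Complex.exp ((-(p.2 i / 2) : ℝ) * Complex.I) := fun i =>
    (((hof.comp (by fun_prop : Differentiable ℝ fun p : (Fin n → ℝ) × (Fin n → ℝ) => -(p.2 i / 2)))
      ).mul_const _).cexp
  refine Differentiable.fun_sum fun j _ => Differentiable.mul (Differentiable.mul ?_ (he j))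
    (differentiable_coeff_prod he he' _ _)
  exact hof.comp (by fun_prop : Differentiable ℝ fun p : (Fin n → ℝ) × (Fin n → ℝ) => p.1 j)

lemma det_of_blockTriangular {B : (Fin n → ℝ) × (Fin n → ℝ) →ₗ[ℝ] (Fin n → ℝ) × (Fin n → ℝ)}
    {p d : Fin n → ℝ} (hp : ∀ a k, (B (a, 0)).1 k = p k * a k)
    (hd : ∀ x k, (B x).2 k = d k * x.2 k) : LinearMap.det B = (∏ k, p k) * ∏ k, d k := by
  set b := (Pi.basisFun ℝ (Fin n)).prod (Pi.basisFun ℝ (Fin n)) with hb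
  set R : Matrix (Fin n) (Fin n) ℝ :=
    Matrix.of fun i j => LinearMap.toMatrix b b B (Sum.inl i) (Sum.inr j) with hR
  have e : LinearMap.toMatrix b b B =
      Matrix.fromBlocks (Matrix.diagonal p) R 0 (Matrix.diagonal d) := by
    ext i j
    rcases i with i | i <;> rcases j with j | j
    · rw [Matrix.fromBlocks_apply₁₁]
      simp [hb, LinearMap.toMatrix_apply, hp, Matrix.diagonal_apply, Pi.single_apply]
    · rfl
    · rw [Matrix.fromBlocks_apply₂₁]
      simp [hb, LinearMap.toMatrix_apply, hd]
    · rw [Matrix.fromBlocks_apply₂₂]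
      simp [hb, LinearMap.toMatrix_apply, hd, Matrix.diagonal_apply, Pi.single_apply]
  rw [← LinearMap.det_toMatrix b, e, Matrix.det_fromBlocks_zero₂₁, Matrix.det_diagonal,
    Matrix.det_diagonal]

/-- The coefficient map in real coordinates. -/
def spectralMap (n : ℕ) (p : (Fin n → ℝ) × (Fin n → ℝ)) : (Fin n → ℝ) × (Fin n → ℝ) :=
  reImEquiv n (spectralCoeffs p.1 p.2)

lemma differentiable_spectralMap : Differentiable ℝ (spectralMap n) :=
  (reImEquiv n).toContinuousLinearEquiv.differentiable.comp differentiable_spectralCoeffs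

lemma abs_det_fderiv_spectralMap (p : (Fin (m + 1) → ℝ) × (Fin (m + 1) → ℝ))
    (hp : circVandermonde p.2 ≠ 0) : |(fderiv ℝ (spectralMap (m + 1)) p).det| =
      circVandermonde p.2 ^ 2 * |(∑ j, p.1 j) / 2| ^ (m + 1) := by
  set e := (reImEquiv (m + 1)).toContinuousLinearEquiv with he
  set S : (Fin (m + 1) → ℝ) × (Fin (m + 1) → ℝ) → Fin (m + 1) → ℂ :=
    fun x => spectralCoeffs x.1 x.2 with hS
  set L := fderiv ℝ S p with hLdef
  have hL : HasFDerivAt S L p := (differentiable_spectralCoeffs p).hasFDerivAt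
  set v : Fin (m + 1) → ℂ := fun k => Complex.exp (p.2 k * Complex.I) with hv
  set M : Matrix (Fin (m + 1)) (Fin (m + 1)) ℂ :=
    Matrix.diagonal (fun k => (trigFactor m (p.2 k))⁻¹) * Matrix.vandermonde v with hM
  set A : (Fin (m + 1) → ℂ) →ₗ[ℝ] (Fin (m + 1) → ℂ) := (Matrix.toLin' M).restrictScalars ℝ with hA
  have hAS : ∀ x k, A (S x) k =
      trigRe x.1 x.2 (p.2 k) + trigIm x.1 x.2 (p.2 k) * Complex.I := fun x k => by
    have : A (S x) = M.mulVec (S x) := rfl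
    rw [this, hM, ← Matrix.mulVec_mulVec, Matrix.mulVec_diagonal, vandermonde_mulVec_eq_evalCoeffs,
      evalCoeffs_spectralCoeffs_exp, inv_mul_cancel_left₀ (trigFactor_ne_zero _ _)]
  have hdetA : LinearMap.det A = circVandermonde p.2 ^ 2 / (2 ^ m) ^ (2 * (m + 1)) := by
    rw [hA, det_restrictScalars_toLin', hM, Matrix.det_mul, Matrix.det_diagonal, norm_mul,
      norm_det_vandermonde_exp, norm_prod]
    simp only [norm_inv, norm_trigFactor, Finset.prod_const, Finset.card_univ, Fintype.card_fin]
    rw [mul_pow, inv_pow, inv_pow, ← pow_mul, mul_comm (m + 1) 2, div_eq_inv_mul]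
  set B : (Fin (m + 1) → ℝ) × (Fin (m + 1) → ℝ) →L[ℝ] (Fin (m + 1) → ℝ) × (Fin (m + 1) → ℝ) :=
    (e : (Fin (m + 1) → ℂ) →L[ℝ] _) ∘L (LinearMap.toContinuousLinearMap A) ∘L L with hB
  have hG : HasFDerivAt (fun x => e (A (S x))) B p :=
    e.hasFDerivAt.comp p ((LinearMap.toContinuousLinearMap A).hasFDerivAt.comp p hL)
  have hG1 : ∀ x k, (e (A (S x))).1 k = trigRe x.1 x.2 (p.2 k) := fun x k => by
    change (A (S x) k).re = _
    rw [hAS]; simp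
  have hG2 : ∀ x k, (e (A (S x))).2 k = trigIm x.1 x.2 (p.2 k) := fun x k => by
    change (A (S x) k).im = _
    rw [hAS]; simp
  have hdetB : LinearMap.det B.toLinearMap = (∏ k, sinProd p.2 k (p.2 k)) *
      ∏ k, ((∑ j, p.1 j) / 2 * sinProd p.2 k (p.2 k)) := by
    refine det_of_blockTriangular (fun a k => ?_) fun x k => ?_
    · set pr : (Fin (m + 1) → ℝ) × (Fin (m + 1) → ℝ) →L[ℝ] ℝ :=
        (ContinuousLinearMap.proj k : (Fin (m + 1) → ℝ) →L[ℝ] ℝ) ∘L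
          ContinuousLinearMap.fst ℝ _ _ with hpr
      have h1 : HasFDerivAt (fun x => (e (A (S x))).1 k)
          (pr ∘L B) p :=
        pr.hasFDerivAt.comp p hG
      have h2 : HasDerivAt (fun s : ℝ => (e (A (S (p + s • (a, 0))))).1 k)
          ((pr ∘L B) (a, 0)) 0 := h1.hasLineDerivAt (a, 0)
      simp only [hG1] at h2
      have h3 : HasDerivAt (fun s : ℝ => trigRe (p + s • (a, 0)).1 (p + s • (a, 0)).2 (p.2 k))
          (sinProd p.2 k (p.2 k) * a k) 0 := by
        have h4 : (fun s : ℝ => trigRe (p + s • (a, 0)).1 (p + s • (a, 0)).2 (p.2 k)) =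
            fun s => (p.1 k + s * a k) * sinProd p.2 k (p.2 k) := by
          ext s
          simp [trigRe_self]
        rw [h4]
        have h5 := (((hasDerivAt_id (0 : ℝ)).mul_const (a k)).const_add (p.1 k)).mul_const
          (sinProd p.2 k (p.2 k))
        simpa [mul_comm] using h5
      exact h2.unique h3
    · set pr : (Fin (m + 1) → ℝ) × (Fin (m + 1) → ℝ) →L[ℝ] ℝ :=
        (ContinuousLinearMap.proj k : (Fin (m + 1) → ℝ) →L[ℝ] ℝ) ∘L
          ContinuousLinearMap.snd ℝ _ _ with hpr
      have h1 : HasFDerivAt (fun x => (e (A (S x))).2 k)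
          (pr ∘L B) p :=
        pr.hasFDerivAt.comp p hG
      simp only [hG2] at h1
      have h2 : HasFDerivAt (fun x : (Fin (m + 1) → ℝ) × (Fin (m + 1) → ℝ) =>
          Real.sin ((x.2 k - p.2 k) / 2)) ((2⁻¹ : ℝ) • pr) p := by
        have h3 : HasFDerivAt (fun x : (Fin (m + 1) → ℝ) × (Fin (m + 1) → ℝ) => x.2 k) pr p :=
          pr.hasFDerivAt
        have h4 := ((h3.sub_const (p.2 k)).mul_const (2⁻¹)).sin
        simpa [div_eq_mul_inv] using h4
      have hd : Differentiable ℝ (fun x : (Fin (m + 1) → ℝ) × (Fin (m + 1) → ℝ) =>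
          (∑ j, x.1 j) * sinProd x.2 k (p.2 k)) := by
        unfold sinProd
        fun_prop
      have h5 := h2.mul (hd p).hasFDerivAt
      have h6 : (fun x : (Fin (m + 1) → ℝ) × (Fin (m + 1) → ℝ) => trigIm x.1 x.2 (p.2 k)) =
          fun x => Real.sin ((x.2 k - p.2 k) / 2) * ((∑ j, x.1 j) * sinProd x.2 k (p.2 k)) := by
        ext x
        rw [trigIm, ← sin_mul_sinProd x.2 k]
        ring
      rw [h6] at h1
      have h7 := DFunLike.congr_fun (h1.unique h5) x
      simp [hpr] at h7
      change (B x).2 k = _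
      rw [h7]
      ring
  have hT : fderiv ℝ (spectralMap (m + 1)) p = (e : (Fin (m + 1) → ℂ) →L[ℝ] _) ∘L L :=
    (e.hasFDerivAt.comp p hL).fderiv
  have hBT : B.toLinearMap = ((reImEquiv (m + 1) : (Fin (m + 1) → ℂ) →ₗ[ℝ] _) ∘ₗ A ∘ₗ
      ((reImEquiv (m + 1)).symm : _ →ₗ[ℝ] (Fin (m + 1) → ℂ))) ∘ₗ
        (fderiv ℝ (spectralMap (m + 1)) p).toLinearMap := by
    refine LinearMap.ext fun x => ?_
    simp [hB, hT, he]
  have hdet := congrArg LinearMap.det hBT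
  rw [LinearMap.det_comp, LinearMap.det_conj, hdetA, hdetB] at hdet
  have hkey := prod_two_pow_mul_abs_sinProd p.2
  rw [Finset.prod_mul_distrib, Finset.prod_const, Finset.card_univ, Fintype.card_fin,
    ← Finset.abs_prod] at hkey
  have habs := congrArg abs hdet
  rw [Finset.prod_mul_distrib, Finset.prod_const, Finset.card_univ, Fintype.card_fin, abs_mul,
    abs_mul, abs_mul, abs_pow, abs_of_nonneg
      (show 0 ≤ circVandermonde p.2 ^ 2 / (2 ^ m) ^ (2 * (m + 1)) by positivity)] at habs
  change |LinearMap.det _| = _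
  have hD : 0 < circVandermonde p.2 ^ 2 := by positivity
  refine mul_left_cancel₀ hD.ne' ?_
  rw [div_mul_eq_mul_div, eq_div_iff (by positivity)] at habs
  rw [← habs]
  conv_rhs => rw [← hkey]
  ring

end

section

variable {m : ℕ}

/-- The polynomial with a given coefficient vector. -/
def coeffsPoly {k : ℕ} (P : Fin k → ℂ) : Polynomial ℂ :=
  ∑ j, Polynomial.C (P j) * Polynomial.X ^ (j : ℕ)

lemma coeffsPoly_sub {k : ℕ} (P Q : Fin k → ℂ) :
    coeffsPoly (P - Q) = coeffsPoly P - coeffsPoly Q := by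
  simp [coeffsPoly, sub_mul, Finset.sum_sub_distrib]

lemma coeffsPoly_smul {k : ℕ} (c : ℂ) (P : Fin k → ℂ) :
    coeffsPoly (c • P) = Polynomial.C c * coeffsPoly P := by
  simp [coeffsPoly, Finset.mul_sum, mul_assoc]

lemma coeffsPoly_padZero {k : ℕ} (P : Fin k → ℂ) : coeffsPoly (padZero P) = coeffsPoly P := by
  simp [coeffsPoly, Fin.sum_univ_castSucc]

lemma coeffsPoly_revConj_padZero {k : ℕ} (P : Fin k → ℂ) :
    coeffsPoly (revConj (padZero P)) = Polynomial.X * coeffsPoly (revConj P) := by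
  rw [coeffsPoly, Fin.sum_univ_succ, coeffsPoly, Finset.mul_sum]
  simp only [revConj, Fin.rev_zero, padZero_last, star_zero, map_zero, zero_mul, zero_add,
    Fin.rev_succ, padZero_castSucc, Fin.val_succ, pow_succ']
  exact Finset.sum_congr rfl fun j _ => by ring

lemma eval_coeffsPoly {k : ℕ} (P : Fin k → ℂ) (z : ℂ) :
    (coeffsPoly P).eval z = evalCoeffs P z := by
  simp [coeffsPoly, evalCoeffs, Polynomial.eval_finsetSum]

lemma coeff_coeffsPoly {k : ℕ} (P : Fin k → ℂ) (j : Fin k) : (coeffsPoly P).coeff j = P j := by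
  rw [coeffsPoly, Polynomial.finsetSum_coeff, Finset.sum_eq_single j]
  · simp
  · intro i _ hi
    rw [Polynomial.coeff_C_mul, Polynomial.coeff_X_pow, if_neg fun h => hi (Fin.ext h.symm),
      mul_zero]
  · simp

lemma natDegree_coeffsPoly_le (P : Fin (m + 1) → ℂ) : (coeffsPoly P).natDegree ≤ m :=
  Polynomial.natDegree_sum_le_of_forall_le _ _ fun j _ =>
    (Polynomial.natDegree_C_mul_X_pow_le _ _).trans (Nat.le_of_lt_succ j.isLt)

lemma coeff_coeffsPoly_revConj (P : Fin (m + 1) → ℂ) :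
    (coeffsPoly (revConj P)).coeff m = star (P 0) := by
  have h := coeff_coeffsPoly (revConj P) (Fin.last m)
  rw [Fin.val_last] at h
  rw [h, revConj, Fin.rev_last]

lemma natDegree_coeffsPoly_revConj {P : Fin (m + 1) → ℂ} (hP : P 0 ≠ 0) :
    (coeffsPoly (revConj P)).natDegree = m :=
  Polynomial.natDegree_eq_of_le_of_coeff_ne_zero (natDegree_coeffsPoly_le _)
    (by rw [coeff_coeffsPoly_revConj]; exact star_ne_zero.2 hP)

/-- The product of the powers `(1 - ‖α_k‖ ^ 2) ^ (k + 1)` over the Verblunsky coefficients. -/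
def verblunskyProd : ∀ k : ℕ, (Fin (k + 1) → ℂ) → ℝ
  | 0, _ => 1
  | k + 1, P => verblunskyProd k (szegoUnstep P) * (1 - ‖lastVerblunsky P‖ ^ 2) ^ (k + 1)

lemma verblunskyProd_pos {P : Fin (m + 1) → ℂ} (hP : IsVerblunsky m P) :
    0 < verblunskyProd m P := by
  induction m with
  | zero => exact one_pos
  | succ m ih =>
    have := norm_nonneg (lastVerblunsky P)
    exact mul_pos (ih hP.2.2) (pow_pos (by nlinarith [hP.2.1]) _)

lemma resultant_X_mul_revConj {P : Fin (m + 1) → ℂ} (hP : P 0 ≠ 0) {F : Polynomial ℂ}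
    (hF : F.natDegree ≤ m) :
    Polynomial.resultant (Polynomial.X * coeffsPoly (revConj P)) F (m + 1) m =
      F.eval 0 * Polynomial.resultant (coeffsPoly (revConj P)) F m m := by
  have h := Polynomial.resultant_mul_left Polynomial.X (coeffsPoly (revConj P)) F m hF
  rw [natDegree_coeffsPoly_revConj hP, Polynomial.natDegree_X, add_comm 1 m] at h
  rw [h]
  congr 1
  have := Polynomial.resultant_X_sub_C_left (g := F) m 0 hF
  rwa [Polynomial.C_0, sub_zero] at this

lemma norm_resultant_revConj {P : Fin (m + 1) → ℂ} (hP : IsVerblunsky m P) :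
    ‖Polynomial.resultant (coeffsPoly (revConj P)) (coeffsPoly P) m m‖ =
      ‖P 0‖ ^ (2 * m) * verblunskyProd m P := by
  induction m with
  | zero => simp [verblunskyProd]
  | succ m ih =>
    obtain ⟨hP0, hα, hL⟩ := hP
    set L := szegoUnstep P with hLdef
    set α := lastVerblunsky P with hαdef
    have hPL : szegoStep L α = P := szegoStep_szegoUnstep hP0 hα
    have hL0 : L 0 = P 0 := by rw [← hPL, szegoStep_zero]
    set F := coeffsPoly L with hF
    set G := Polynomial.X * coeffsPoly (revConj L) with hG
    have hp : coeffsPoly P = F - Polynomial.C α * G := by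
      rw [← hPL, szegoStep, coeffsPoly_sub, coeffsPoly_smul, coeffsPoly_padZero,
        coeffsPoly_revConj_padZero]
    have hq : coeffsPoly (revConj P) = G - Polynomial.C (star α) * F := by
      rw [← hPL, szegoStep, revConj_sub, revConj_smul, revConj_revConj, coeffsPoly_sub,
        coeffsPoly_smul, coeffsPoly_padZero, coeffsPoly_revConj_padZero]
    have hFd : F.natDegree ≤ m := natDegree_coeffsPoly_le L
    have hGd : G.natDegree ≤ m + 1 := by
      rw [hG, ← coeffsPoly_revConj_padZero]; exact natDegree_coeffsPoly_le _
    have hPd : (coeffsPoly P).natDegree ≤ m + 1 := natDegree_coeffsPoly_le P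
    have hGc : G.coeff (m + 1) = star (L 0) := by
      rw [hG, Polynomial.coeff_X_mul, coeff_coeffsPoly_revConj]
    have h1 : coeffsPoly (revConj P) + coeffsPoly P * Polynomial.C (star α) =
        Polynomial.C (1 - α * star α) * G := by
      rw [hp, hq, Polynomial.C_sub, Polynomial.C_mul, Polynomial.C_1]; ring
    have h2 := Polynomial.resultant_add_mul_left (coeffsPoly (revConj P)) (coeffsPoly P)
      (Polynomial.C (star α)) (m + 1) (m + 1) (by simp) hPd
    have h3 := Polynomial.resultant_add_mul_right G F (Polynomial.C (-α)) (m + 1) (m + 1)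
      (by simp) hGd
    have h4 : F + G * Polynomial.C (-α) = coeffsPoly P := by
      rw [hp, Polynomial.C_neg]; ring
    rw [← h2, h1, Polynomial.resultant_C_mul_left, ← h4, h3,
      Polynomial.resultant_add_right_deg _ _ _ _ 1 hFd, hGc,
      resultant_X_mul_revConj (hL0 ▸ hP0) hFd, hF, eval_coeffsPoly, evalCoeffs_zero,
      norm_mul, norm_mul, norm_mul, ih hL, ← one_sub_norm_sq_eq, norm_pow, norm_pow, norm_star,
      Complex.norm_real, Real.norm_of_nonneg (by nlinarith [norm_nonneg α]), hL0, verblunskyProd]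
    ring

theorem prod_norm_evalCoeffs {P : Fin (m + 1) → ℂ} (hP : IsVerblunsky m P)
    {z : Fin (m + 1) → ℂ} (hz : Function.Injective z) (ε : ℂ)
    (h : ∀ j, z j * evalCoeffs (revConj P) (z j) = ε * evalCoeffs P (z j)) :
    ∏ j, ‖evalCoeffs P (z j)‖ = ‖P 0‖ ^ (m + 1) * verblunskyProd m P := by
  have hP0 := hP.zero_ne
  set Q := Polynomial.X * coeffsPoly (revConj P) + coeffsPoly P * Polynomial.C (-ε) with hQ
  set M : Polynomial ℂ := ∏ j, (Polynomial.X - Polynomial.C (z j)) with hM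
  have hMm : M.Monic := Polynomial.monic_prod_of_monic _ _ fun j _ => Polynomial.monic_X_sub_C _
  have hMd : M.natDegree = m + 1 := by
    rw [hM, Polynomial.natDegree_finsetProd_X_sub_C_eq_card]; simp
  have hPd := natDegree_coeffsPoly_le P
  have hQM : Q = Polynomial.C (star (P 0)) * M := by
    refine Polynomial.eq_of_degree_sub_lt_of_eval_index_eq (v := z) Finset.univ hz.injOn ?_
      fun j _ => ?_
    · rw [Finset.card_univ, Fintype.card_fin, Polynomial.degree_lt_iff_coeff_zero]
      intro i hi
      rcases Nat.exists_eq_succ_of_ne_zero (n := i) (by omega) with ⟨i, rfl⟩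
      have hi' : m ≤ i := by omega
      have h0 : (coeffsPoly P).coeff (i + 1) = 0 :=
        Polynomial.coeff_eq_zero_of_natDegree_lt (by omega)
      rw [Polynomial.coeff_sub, hQ, Polynomial.coeff_add, Polynomial.coeff_mul_C,
        Polynomial.coeff_X_mul, Polynomial.coeff_C_mul, h0, zero_mul, add_zero]
      rcases hi'.eq_or_lt with rfl | hlt
      · have h1 := hMm.coeff_natDegree
        rw [hMd] at h1
        rw [coeff_coeffsPoly_revConj, h1, mul_one, sub_self]
      · rw [Polynomial.coeff_eq_zero_of_natDegree_lt
          ((natDegree_coeffsPoly_le (revConj P)).trans_lt hlt),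
          Polynomial.coeff_eq_zero_of_natDegree_lt (p := M) (by omega), mul_zero, sub_zero]
    · have h0 : M.eval (z j) = 0 := by
        rw [hM, Polynomial.eval_prod]
        exact Finset.prod_eq_zero (Finset.mem_univ j) (by simp)
      simp only [hQ, Polynomial.eval_add, Polynomial.eval_mul, Polynomial.eval_X,
        Polynomial.eval_C, eval_coeffsPoly, h0, h j]
      ring
  have h1 := Polynomial.resultant_add_mul_left (Polynomial.X * coeffsPoly (revConj P))
    (coeffsPoly P) (Polynomial.C (-ε)) (m + 1) m (by simp) hPd
  have h2 := Polynomial.resultant_prod_left Finset.univ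
    (fun j => Polynomial.X - Polynomial.C (z j)) (coeffsPoly P) m (by simp) hPd
  rw [← hM, hMd] at h2
  rw [← hQ, hQM, Polynomial.resultant_C_mul_left, h2, resultant_X_mul_revConj hP0 hPd,
    eval_coeffsPoly, evalCoeffs_zero] at h1
  have hx : ∀ j, (Polynomial.X - Polynomial.C (z j)).resultant (coeffsPoly P) 1 m =
      evalCoeffs P (z j) := fun j =>
    (Polynomial.resultant_X_sub_C_left (g := coeffsPoly P) m (z j) hPd).trans (eval_coeffsPoly _ _)
  simp only [Polynomial.natDegree_X_sub_C, hx] at h1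
  have h3 := congrArg norm h1
  rw [norm_mul, norm_mul, norm_pow, norm_star, norm_prod, norm_resultant_revConj hP] at h3
  have h4 : 0 < ‖P 0‖ ^ m := pow_pos (norm_pos_iff.2 hP0) _
  refine mul_left_cancel₀ h4.ne' (h3.trans ?_)
  ring

end

section

variable {k m : ℕ}

lemma one_le_norm_prod {s : Multiset ℂ} (h : ∀ x ∈ s, 1 ≤ ‖x‖) : 1 ≤ ‖s.prod‖ := by
  induction s using Multiset.induction_on with
  | empty => simp
  | cons a s ih =>
    rw [Multiset.prod_cons, norm_mul]
    exact one_le_mul_of_one_le_of_one_le (h a (Multiset.mem_cons_self a s))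
      (ih fun x hx => h x (Multiset.mem_cons_of_mem hx))

lemma norm_last_lt_norm_zero {P : Fin (k + 2) → ℂ} (h : ∀ z, ‖z‖ ≤ 1 → evalCoeffs P z ≠ 0) :
    ‖P (Fin.last (k + 1))‖ < ‖P 0‖ := by
  have h0 : P 0 ≠ 0 := by
    have := h 0 (by simp)
    rwa [evalCoeffs_zero] at this
  by_cases hl : P (Fin.last (k + 1)) = 0
  · rw [hl, norm_zero]; exact norm_pos_iff.2 h0
  set p := coeffsPoly P with hp
  have hc : p.coeff (k + 1) = P (Fin.last (k + 1)) := coeff_coeffsPoly P (Fin.last (k + 1))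
  have hd : p.natDegree = k + 1 := Polynomial.natDegree_eq_of_le_of_coeff_ne_zero
    (natDegree_coeffsPoly_le P) (by rwa [hc])
  have hp0 : p ≠ 0 := fun h' => by simp [h'] at hd
  have hr : ∀ x ∈ p.roots, 1 < ‖x‖ := fun x hx => by
    by_contra hx'
    refine h x (not_lt.1 hx') ?_
    rw [← eval_coeffsPoly]
    exact (Polynomial.mem_roots hp0).1 hx
  have hs := IsAlgClosed.splits p
  have hcard : p.roots.card = k + 1 := by rw [← hd]; exact hs.natDegree_eq_card_roots.symm
  have h1 : 1 < ‖p.roots.prod‖ := by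
    obtain ⟨a, ha⟩ := Multiset.card_pos_iff_exists_mem.1 (by omega : 0 < p.roots.card)
    obtain ⟨t, ht⟩ := Multiset.exists_cons_of_mem ha
    rw [ht] at hr ⊢
    rw [Multiset.prod_cons, norm_mul]
    exact one_lt_mul_of_lt_of_le (hr a (Multiset.mem_cons_self a t))
      (one_le_norm_prod fun x hx => (hr x (Multiset.mem_cons_of_mem hx)).le)
  have h2 := hs.coeff_zero_eq_leadingCoeff_mul_prod_roots
  rw [Polynomial.leadingCoeff, hd, hc] at h2
  have h3 : p.coeff 0 = P 0 := coeff_coeffsPoly P 0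
  rw [← h3, h2, norm_mul, norm_mul, norm_pow, norm_neg, norm_one, one_pow, one_mul]
  exact lt_mul_of_one_lt_right (norm_pos_iff.2 hl) h1

lemma differentiable_evalCoeffs (P : Fin k → ℂ) : Differentiable ℂ (evalCoeffs P) := by
  unfold evalCoeffs
  fun_prop

lemma norm_evalCoeffs_revConj_le {P : Fin (k + 1) → ℂ} (h : ∀ z, ‖z‖ ≤ 1 → evalCoeffs P z ≠ 0)
    {z : ℂ} (hz : ‖z‖ ≤ 1) : ‖evalCoeffs (revConj P) z‖ ≤ ‖evalCoeffs P z‖ := by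
  have hb : Metric.closedBall (0 : ℂ) 1 = closure (Metric.ball 0 1) :=
    (closure_ball 0 one_ne_zero).symm
  have hd : DiffContOnCl ℂ (fun z => evalCoeffs (revConj P) z / evalCoeffs P z)
      (Metric.ball 0 1) := by
    refine DifferentiableOn.diffContOnCl ?_
    rw [← hb]
    exact (differentiable_evalCoeffs _).differentiableOn.fun_div
      (differentiable_evalCoeffs _).differentiableOn fun x hx => h x (by simpa using hx)
  have h1 := Complex.norm_le_of_forall_mem_frontier_norm_le (C := 1) Metric.isBounded_ball hd
    (fun x hx => ?_) (z := z) (by rw [← hb]; simpa using hz)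
  · rw [norm_div] at h1
    have := norm_pos_iff.2 (h z hz)
    rwa [div_le_one this] at h1
  · rw [frontier_ball 0 one_ne_zero, mem_sphere_zero_iff_norm] at hx
    have := norm_pos_iff.2 (h x hx.le)
    rw [norm_div, evalCoeffs_revConj P hx, norm_mul, norm_pow, hx, one_pow, one_mul, norm_star,
      div_self this.ne']

theorem isVerblunsky_of_forall_evalCoeffs_ne_zero {P : Fin (k + 1) → ℂ}
    (h : ∀ z, ‖z‖ ≤ 1 → evalCoeffs P z ≠ 0) : IsVerblunsky k P := by
  induction k with
  | zero =>
    have := h 0 (by simp)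
    rwa [evalCoeffs_zero] at this
  | succ k ih =>
    have h0 : P 0 ≠ 0 := by
      have := h 0 (by simp)
      rwa [evalCoeffs_zero] at this
    have hα : ‖lastVerblunsky P‖ < 1 := by
      rw [lastVerblunsky, norm_div, norm_neg, norm_star, div_lt_one (norm_pos_iff.2 h0)]
      exact norm_last_lt_norm_zero h
    refine ⟨h0, hα, ih fun z hz => ?_⟩
    rw [← evalCoeffs_padZero, padZero_szegoUnstep h0, evalCoeffs_smul, evalCoeffs_add,
      evalCoeffs_smul]
    refine mul_ne_zero (inv_ne_zero (one_sub_norm_sq_ne_zero hα)) fun h' => ?_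
    have h1 : ‖evalCoeffs P z‖ = ‖lastVerblunsky P‖ * ‖evalCoeffs (revConj P) z‖ := by
      rw [← norm_mul, eq_neg_of_add_eq_zero_left h', norm_neg]
    have h2 := norm_evalCoeffs_revConj_le h hz
    have h3 := norm_pos_iff.2 (h z hz)
    nlinarith [norm_nonneg (lastVerblunsky P), norm_nonneg (evalCoeffs (revConj P) z)]

lemma re_inv_one_sub_pos {v : ℂ} (hv : ‖v‖ ≤ 1) (h1 : v ≠ 1) : 0 < ((1 - v)⁻¹).re := by
  rw [Complex.inv_re]
  have h2 : 1 - v ≠ 0 := sub_ne_zero.2 h1.symm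
  refine div_pos ?_ (Complex.normSq_pos.2 h2)
  have h3 : v.re ≤ 1 := (Complex.re_le_norm v).trans hv
  rcases h3.lt_or_eq with h3 | h3
  · simpa using h3
  · exfalso
    apply h1
    have h4 := Complex.sq_norm v
    rw [Complex.normSq_apply, h3] at h4
    have h5 : v.im = 0 := by nlinarith [norm_nonneg v, mul_self_nonneg v.im]
    exact Complex.ext (by simpa using h3) (by simpa using h5)

/-- The parameter domain: increasing angles in `[0, 2π)` and weights of one common sign. -/
def spectralDomain (n : ℕ) : Set ((Fin n → ℝ) × (Fin n → ℝ)) :=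
  {p | StrictMono p.2 ∧ (∀ j, p.2 j ∈ Set.Ico 0 (2 * Real.pi)) ∧
    ((∀ j, 0 < p.1 j) ∨ ∀ j, p.1 j < 0)}

lemma spectralCoeffs_neg (w t : Fin k → ℝ) :
    spectralCoeffs (-w) t = -spectralCoeffs w t := by
  ext j
  simp [spectralCoeffs, spectralPoly, Polynomial.finsetSum_coeff]

lemma exp_half_ne {t : ℝ} {z : ℂ} (hz : z ≠ Complex.exp (t * Complex.I)) :
    Complex.exp ((t / 2 : ℝ) * Complex.I) - Complex.exp ((-(t / 2) : ℝ) * Complex.I) * z ≠ 0 := by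
  intro h
  apply hz
  have h1 : Complex.exp ((t / 2 : ℝ) * Complex.I) *
      Complex.exp ((-(t / 2) : ℝ) * Complex.I) = 1 := by
    rw [← Complex.exp_add, ← add_mul, ← Complex.ofReal_add]; simp
  have h2 : Complex.exp (t * Complex.I) =
      Complex.exp ((t / 2 : ℝ) * Complex.I) * Complex.exp ((t / 2 : ℝ) * Complex.I) := by
    rw [← Complex.exp_add]; congr 1; push_cast; ring
  rw [h2]
  linear_combination -(Complex.exp ((t / 2 : ℝ) * Complex.I)) * h - z * h1

lemma evalCoeffs_spectralCoeffs_ne_zero {w t : Fin (m + 1) → ℝ} (ht : Function.Injective t)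
    (htm : ∀ j, t j ∈ Set.Ico 0 (2 * Real.pi)) (hw : ∀ j, 0 < w j) {z : ℂ} (hz : ‖z‖ ≤ 1) :
    evalCoeffs (spectralCoeffs w t) z ≠ 0 := by
  by_cases hk : ∃ k, z = Complex.exp (t k * Complex.I)
  · obtain ⟨k, rfl⟩ := hk
    rw [evalCoeffs_spectralCoeffs_exp, trigRe_self, trigIm_self]
    refine mul_ne_zero (trigFactor_ne_zero _ _) ?_
    have : w k * sinProd t k (t k) ≠ 0 := by
      refine mul_ne_zero (hw k).ne' (Finset.prod_ne_zero_iff.2 fun i hi => ?_)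
      exact sin_half_sub_ne_zero (htm i) (htm k) (ht.ne (Finset.ne_of_mem_erase hi))
    simpa using this
  · push Not at hk
    set F : Fin (m + 1) → ℂ := fun i => Complex.exp ((t i / 2 : ℝ) * Complex.I) -
      Complex.exp ((-(t i / 2) : ℝ) * Complex.I) * z with hF
    have hF0 : ∀ i, F i ≠ 0 := fun i => exp_half_ne (hk i)
    set v : Fin (m + 1) → ℂ := fun i => Complex.exp ((-(t i)) * Complex.I) * z with hv
    have hv1 : ∀ i, v i ≠ 1 := fun i h => by
      apply hk i
      have : Complex.exp (t i * Complex.I) * v i = z := by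
        rw [hv]
        simp only
        rw [← mul_assoc, ← Complex.exp_add]
        simp
      rw [← this, h, mul_one]
    have hvn : ∀ i, ‖v i‖ ≤ 1 := fun i => by
      have := Complex.norm_exp_ofReal_mul_I (-(t i))
      push_cast at this
      rw [hv, norm_mul, this, one_mul]
      exact hz
    have hFv : ∀ i, F i = Complex.exp ((t i / 2 : ℝ) * Complex.I) * (1 - v i) := fun i => by
      rw [hF, hv]
      simp only
      rw [mul_sub, ← mul_assoc, ← Complex.exp_add, mul_one]
      congr 4
      push_cast; ring
    have e : evalCoeffs (spectralCoeffs w t) z = (∏ i, F i) * ∑ j, w j * (1 - v j)⁻¹ := by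
      rw [evalCoeffs_spectralCoeffs, Finset.mul_sum]
      refine Finset.sum_congr rfl fun j _ => ?_
      rw [← Finset.mul_prod_erase _ F (Finset.mem_univ j)]
      have h2 := sub_ne_zero.2 (hv1 j).symm
      change _ * ∏ i ∈ Finset.univ.erase j, F i = _
      rw [hFv j]
      field_simp
    rw [e]
    refine mul_ne_zero (Finset.prod_ne_zero_iff.2 fun i _ => hF0 i) fun h => ?_
    have h1 := congrArg Complex.re h
    rw [Complex.re_sum, Complex.zero_re] at h1
    refine absurd h1 (Finset.sum_pos (fun j _ => ?_) Finset.univ_nonempty).ne'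
    rw [Complex.re_ofReal_mul]
    exact mul_pos (hw j) (re_inv_one_sub_pos (hvn j) (hv1 j))

theorem isVerblunsky_spectralCoeffs {p : (Fin (m + 1) → ℝ) × (Fin (m + 1) → ℝ)}
    (hp : p ∈ spectralDomain (m + 1)) : IsVerblunsky m (spectralCoeffs p.1 p.2) := by
  obtain ⟨h1, h2, h3⟩ := hp
  refine isVerblunsky_of_forall_evalCoeffs_ne_zero fun z hz => ?_
  rcases h3 with h3 | h3
  · exact evalCoeffs_spectralCoeffs_ne_zero h1.injective h2 h3 hz
  · have h4 := evalCoeffs_spectralCoeffs_ne_zero (w := -p.1) h1.injective h2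
      (fun j => by simpa using h3 j) hz
    intro h5
    apply h4
    have : spectralCoeffs (-p.1) p.2 = (-1 : ℂ) • spectralCoeffs p.1 p.2 := by
      rw [spectralCoeffs_neg]; simp
    rw [this, evalCoeffs_smul, h5, mul_zero]

end

section

variable {m : ℕ}

lemma injective_exp_mul_I {t : Fin m → ℝ} (ht : Function.Injective t)
    (htm : ∀ j, t j ∈ Set.Ico 0 (2 * Real.pi)) :
    Function.Injective fun j => Complex.exp (t j * Complex.I) := by
  intro i j hij
  by_contra hne
  have := norm_exp_sub_exp (t i) (t j)
  rw [sub_eq_zero.2 hij, norm_zero] at this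
  exact sin_half_sub_ne_zero (htm i) (htm j) (ht.ne hne) (by simpa using this.symm)

/-- The restriction to the circle of a polynomial, divided by `trigFactor`. -/
def circleTrig (P : Fin (m + 1) → ℂ) (φ : ℝ) : ℂ :=
  evalCoeffs P (Complex.exp (φ * Complex.I)) / trigFactor m φ

lemma trigFactor_mul_circleTrig (P : Fin (m + 1) → ℂ) (φ : ℝ) :
    trigFactor m φ * circleTrig P φ = evalCoeffs P (Complex.exp (φ * Complex.I)) :=
  mul_div_cancel₀ _ (trigFactor_ne_zero m φ)

lemma circleTrig_spectralCoeffs (w t : Fin (m + 1) → ℝ) (φ : ℝ) :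
    circleTrig (spectralCoeffs w t) φ = trigRe w t φ + trigIm w t φ * Complex.I := by
  rw [circleTrig, evalCoeffs_spectralCoeffs_exp, mul_div_cancel_left₀ _ (trigFactor_ne_zero m φ)]

lemma exp_pow_mul_star_trigFactor (m : ℕ) (φ : ℝ) :
    Complex.exp (φ * Complex.I) ^ (m + 1) * star (trigFactor m φ) = (-1) ^ m * trigFactor m φ := by
  have h1 : Complex.exp (φ * Complex.I) = Complex.exp ((φ / 2 : ℝ) * Complex.I) *
      Complex.exp ((φ / 2 : ℝ) * Complex.I) := by
    rw [← Complex.exp_add]; congr 1; push_cast; ring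
  have h2 : Complex.exp ((φ / 2 : ℝ) * Complex.I) * star (Complex.exp ((φ / 2 : ℝ) * Complex.I)) =
      1 := by
    rw [Complex.star_def, Complex.mul_conj', Complex.norm_exp_ofReal_mul_I]; simp
  have h3 : star (2 * Complex.I : ℂ) = -1 * (2 * Complex.I) := by simp
  rw [trigFactor, star_mul', star_pow, star_pow, h3, mul_pow (-1 : ℂ), h1, mul_pow]
  set E := Complex.exp ((φ / 2 : ℝ) * Complex.I)
  calc _ = (-1) ^ m * ((2 * Complex.I) ^ m * E ^ (m + 1)) * (E * star E) ^ (m + 1) := by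
        rw [mul_pow E]; ring
    _ = _ := by rw [h2, one_pow, mul_one]

lemma continuous_circleTrig (P : Fin (m + 1) → ℂ) : Continuous (circleTrig P) := by
  have h := (differentiable_evalCoeffs P).continuous
  refine Continuous.div (h.comp (by fun_prop)) ?_ fun φ => trigFactor_ne_zero m φ
  unfold trigFactor
  fun_prop

namespace IsPruferPhase

variable {P : Fin (m + 1) → ℂ} {Ψ : ℝ → ℝ}

lemma circleTrig_ne_zero (h : IsPruferPhase m P Ψ) (φ : ℝ) : circleTrig P φ ≠ 0 :=
  div_ne_zero (h.eval_ne φ) (trigFactor_ne_zero m φ)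

lemma exp_mul_circleTrig (h : IsPruferPhase m P Ψ) (φ : ℝ) :
    Complex.exp (Ψ φ * Complex.I) * circleTrig P φ = (-1) ^ m * star (circleTrig P φ) := by
  have h1 := h.exp_mul φ
  rw [← trigFactor_mul_circleTrig, star_mul', ← mul_assoc _ (star (trigFactor m φ)),
    exp_pow_mul_star_trigFactor] at h1
  refine mul_left_cancel₀ (trigFactor_ne_zero m φ) ?_
  linear_combination h1

lemma exp_phase_sub (φ : ℝ) : Complex.exp (((Ψ φ - Real.pi * m : ℝ) : ℂ) * Complex.I) =
    (-1) ^ m * Complex.exp (Ψ φ * Complex.I) := by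
  have h1 : Complex.exp (-(Real.pi * Complex.I)) = -1 := by
    rw [Complex.exp_neg, Complex.exp_pi_mul_I]; norm_num
  have h2 : ((Ψ φ - Real.pi * m : ℝ) : ℂ) * Complex.I =
      (m : ℂ) * (-(Real.pi * Complex.I)) + Ψ φ * Complex.I := by push_cast; ring
  rw [h2, Complex.exp_add, Complex.exp_nat_mul, h1]

lemma exp_sub_mul_circleTrig (h : IsPruferPhase m P Ψ) (φ : ℝ) :
    Complex.exp (((Ψ φ - Real.pi * m : ℝ) : ℂ) * Complex.I) * circleTrig P φ =
      star (circleTrig P φ) := by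
  rw [exp_phase_sub, mul_assoc, h.exp_mul_circleTrig, ← mul_assoc, ← mul_pow]
  simp

lemma im_circleTrig_eq_zero_iff (h : IsPruferPhase m P Ψ) (φ : ℝ) :
    (circleTrig P φ).im = 0 ↔ ∃ k : ℤ, Ψ φ = Real.pi * m + 2 * Real.pi * k := by
  have h1 : (circleTrig P φ).im = 0 ↔ star (circleTrig P φ) = circleTrig P φ := by
    rw [Complex.star_def, Complex.conj_eq_iff_im]
  rw [h1, ← h.exp_sub_mul_circleTrig, mul_eq_right₀ (h.circleTrig_ne_zero φ),
    Complex.exp_eq_one_iff]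
  refine exists_congr fun k => ?_
  have h2 : (k : ℂ) * (2 * Real.pi * Complex.I) = ((k * (2 * Real.pi) : ℝ) : ℂ) * Complex.I := by
    push_cast; ring
  rw [h2, mul_left_inj' Complex.I_ne_zero, Complex.ofReal_inj]
  constructor <;> intro h3 <;> linarith

end IsPruferPhase

lemma range_eq_setOf_im_circleTrig {w t : Fin (m + 1) → ℝ}
    (htm : ∀ j, t j ∈ Set.Ico 0 (2 * Real.pi)) (hw : ∑ j, w j ≠ 0) :
    Set.range t = {φ ∈ Set.Ico 0 (2 * Real.pi) | (circleTrig (spectralCoeffs w t) φ).im = 0} := by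
  ext φ
  simp only [Set.mem_range, Set.mem_ofPred_eq, circleTrig_spectralCoeffs]
  constructor
  · rintro ⟨j, rfl⟩
    exact ⟨htm j, by simp [trigIm_self]⟩
  · rintro ⟨h1, h2⟩
    have h3 : trigIm w t φ = 0 := by simpa using h2
    rcases mul_eq_zero.1 h3 with h3 | h3
    · exact absurd h3 hw
    · obtain ⟨i, -, hi⟩ := Finset.prod_eq_zero_iff.1 h3
      refine ⟨i, ?_⟩
      by_contra hne
      exact sin_half_sub_ne_zero (htm i) h1 hne hi

lemma sum_ne_zero_of_mem_spectralDomain {p : (Fin (m + 1) → ℝ) × (Fin (m + 1) → ℝ)}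
    (hp : p ∈ spectralDomain (m + 1)) : ∑ j, p.1 j ≠ 0 := by
  rcases hp.2.2 with h | h
  · exact (Finset.sum_pos (fun j _ => h j) Finset.univ_nonempty).ne'
  · exact (Finset.sum_neg (fun j _ => h j) Finset.univ_nonempty).ne

lemma sinProd_self_ne_zero {t : Fin m → ℝ} (ht : Function.Injective t)
    (htm : ∀ j, t j ∈ Set.Ico 0 (2 * Real.pi)) (k : Fin m) : sinProd t k (t k) ≠ 0 :=
  Finset.prod_ne_zero_iff.2 fun i hi =>
    sin_half_sub_ne_zero (htm i) (htm k) (ht.ne (Finset.ne_of_mem_erase hi))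

theorem injOn_spectralMap : Set.InjOn (spectralMap (m + 1)) (spectralDomain (m + 1)) := by
  rintro ⟨w, t⟩ hp ⟨w', t'⟩ hp' h
  have h1 : spectralCoeffs w t = spectralCoeffs w' t' := (reImEquiv (m + 1)).injective h
  have hr := range_eq_setOf_im_circleTrig hp.2.1 (sum_ne_zero_of_mem_spectralDomain hp)
  have hr' := range_eq_setOf_im_circleTrig hp'.2.1 (sum_ne_zero_of_mem_spectralDomain hp')
  simp only at hr hr'
  rw [h1, ← hr'] at hr
  obtain rfl : t = t' := (hp.1.range_inj hp'.1).1 hr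
  congr 1
  ext k
  have h2 := congrArg (fun P => (circleTrig P (t k)).re) h1
  simp only [circleTrig_spectralCoeffs, trigRe_self, trigIm_self] at h2
  exact mul_right_cancel₀ (sinProd_self_ne_zero hp.1.injective hp.2.1 k) (by simpa using h2)

lemma forall_pos_or_forall_neg {f : ℝ → ℝ} (hf : Continuous f) (h0 : ∀ x, f x ≠ 0) :
    (∀ x, 0 < f x) ∨ ∀ x, f x < 0 := by
  by_contra! h
  obtain ⟨⟨x, hx⟩, y, hy⟩ := h
  obtain ⟨z, hz⟩ := mem_range_of_exists_le_of_exists_ge hf ⟨x, hx⟩ ⟨y, hy⟩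
  exact h0 z hz

lemma neg_one_pow_mul_sinProd_pos {t : Fin (m + 1) → ℝ} (ht : StrictMono t)
    (htm : ∀ j, t j ∈ Set.Ico 0 (2 * Real.pi)) (j : Fin (m + 1)) :
    0 < (-1) ^ (j : ℕ) * sinProd t j (t j) := by
  have h1 : (-1 : ℝ) ^ (j : ℕ) = ∏ i ∈ Finset.univ.erase j, if i < j then (-1 : ℝ) else 1 := by
    rw [Finset.prod_ite, Finset.prod_const_one, mul_one, Finset.prod_const]
    congr 1
    have : (Finset.univ.erase j).filter (· < j) = Finset.Iio j := by
      ext i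
      simp only [Finset.mem_filter, Finset.mem_erase, Finset.mem_univ, Finset.mem_Iio, and_true]
      exact ⟨fun h => h.2, fun h => ⟨h.ne, h⟩⟩
    rw [this, Fin.card_Iio]
  rw [h1, sinProd, ← Finset.prod_mul_distrib]
  refine Finset.prod_pos fun i hi => ?_
  obtain ⟨h2, h3⟩ := htm i
  obtain ⟨h4, h5⟩ := htm j
  split_ifs with hij
  · have := Real.sin_neg_of_neg_of_neg_pi_lt (x := (t i - t j) / 2) (by linarith [ht hij])
      (by linarith)
    linarith
  · have hlt : j < i := lt_of_le_of_ne (not_lt.1 hij) (Finset.ne_of_mem_erase hi).symm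
    rw [one_mul]
    exact Real.sin_pos_of_pos_of_lt_pi (by linarith [ht hlt]) (by linarith)

theorem IsPruferPhase.exists_spectralCoeffs_eq {P : Fin (m + 1) → ℂ} {Ψ : ℝ → ℝ}
    (h : IsPruferPhase m P Ψ) : ∃ p ∈ spectralDomain (m + 1), spectralCoeffs p.1 p.2 = P := by
  have hpi := Real.pi_pos
  set a : ℝ := (Ψ 0 - Real.pi * m) / (2 * Real.pi) with ha
  have hΨ0 : Ψ 0 = Real.pi * m + 2 * Real.pi * a := by rw [ha]; field_simp; ring
  have hΨ1 : Ψ (2 * Real.pi) = Ψ 0 + 2 * Real.pi * (m + 1) := by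
    simpa using h.add_two_pi 0
  have hex : ∀ j : Fin (m + 1), ∃ t ∈ Set.Ico 0 (2 * Real.pi),
      Ψ t = Real.pi * m + 2 * Real.pi * (⌈a⌉ + (j : ℕ)) := fun j => by
    have h1 := Int.le_ceil a
    have h2 := Int.ceil_lt_add_one a
    have h3 : ((j : ℕ) : ℝ) ≤ m := by exact_mod_cast Nat.le_of_lt_succ j.isLt
    have h4 : (0 : ℝ) ≤ (j : ℕ) := Nat.cast_nonneg _
    refine intermediate_value_Ico (by positivity) h.continuous.continuousOn ⟨?_, ?_⟩
    · rw [hΨ0]; nlinarith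
    · have h5 := mul_lt_mul_of_pos_left (show ⌈a⌉ + ((j : ℕ) : ℝ) < a + (m + 1) by linarith)
        Real.two_pi_pos
      rw [hΨ1, hΨ0]
      linarith
  choose t htm hΨt using hex
  have ht : StrictMono t := fun i j hij => by
    rw [← h.strictMono.lt_iff_lt, hΨt, hΨt]
    have : ((i : ℕ) : ℝ) < (j : ℕ) := by exact_mod_cast hij
    gcongr
  have him : ∀ j, (circleTrig P (t j)).im = 0 := fun j =>
    (h.im_circleTrig_eq_zero_iff _).2 ⟨⌈a⌉ + (j : ℕ), by rw [hΨt]; push_cast; ring⟩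
  set w : Fin (m + 1) → ℝ := fun j => (circleTrig P (t j)).re / sinProd t j (t j) with hw
  have hs := sinProd_self_ne_zero ht.injective htm
  set ρ : ℝ → ℂ := fun φ =>
    Complex.exp (((Ψ φ - Real.pi * m) / 2 : ℝ) * Complex.I) * circleTrig P φ with hρ
  have hρim : ∀ φ, (ρ φ).im = 0 := fun φ => by
    have h1 : ((Ψ φ - Real.pi * m : ℝ) : ℂ) * Complex.I =
        ((Ψ φ - Real.pi * m) / 2 : ℝ) * Complex.I +
        ((Ψ φ - Real.pi * m) / 2 : ℝ) * Complex.I := by push_cast; ring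
    have h2 := h.exp_sub_mul_circleTrig φ
    rw [h1, Complex.exp_add] at h2
    rw [← Complex.conj_eq_iff_im]
    have h3 : star (Complex.exp (((Ψ φ - Real.pi * m) / 2 : ℝ) * Complex.I)) *
        Complex.exp (((Ψ φ - Real.pi * m) / 2 : ℝ) * Complex.I) = 1 := by
      rw [Complex.star_def, Complex.conj_mul', Complex.norm_exp_ofReal_mul_I]; simp
    change star (_ * _) = _ * _
    rw [star_mul', ← h2]
    linear_combination (Complex.exp (((Ψ φ - Real.pi * m) / 2 : ℝ) * Complex.I) *
      circleTrig P φ) * h3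
  have hρ0 : ∀ φ, (ρ φ).re ≠ 0 := fun φ h1 =>
    mul_ne_zero (Complex.exp_ne_zero _) (h.circleTrig_ne_zero φ) (Complex.ext h1 (hρim φ))
  have hρc : Continuous fun φ => (ρ φ).re := by
    have := h.continuous
    have := continuous_circleTrig P
    fun_prop
  set σ : ℝ := (-1) ^ ⌈a⌉ with hσ
  have hσ1 : σ = 1 ∨ σ = -1 := (Int.even_or_odd ⌈a⌉).imp (fun h => h.neg_one_zpow)
    fun h => h.neg_one_zpow
  have hwρ : ∀ j, w j = (ρ (t j)).re * σ * ((-1) ^ (j : ℕ) * sinProd t j (t j))⁻¹ := fun j => by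
    have h1 : Complex.exp (((Ψ (t j) - Real.pi * m) / 2 : ℝ) * Complex.I) =
        ((σ * (-1) ^ (j : ℕ) : ℝ) : ℂ) := by
      have h2 : (((Ψ (t j) - Real.pi * m) / 2 : ℝ) : ℂ) * Complex.I =
          (⌈a⌉ : ℂ) * (Real.pi * Complex.I) + (j : ℕ) * (Real.pi * Complex.I) := by
        rw [hΨt]; push_cast; ring
      rw [h2, Complex.exp_add, Complex.exp_int_mul, Complex.exp_nat_mul, Complex.exp_pi_mul_I]
      rw [hσ]
      push_cast
      rfl
    have h2 : (ρ (t j)).re = σ * (-1) ^ (j : ℕ) * (circleTrig P (t j)).re := by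
      rw [hρ]
      simp only
      rw [h1, Complex.re_ofReal_mul]
    have h3 : (-1 : ℝ) ^ (j : ℕ) ≠ 0 := by positivity
    have h4 : σ * σ = 1 := by rcases hσ1 with h | h <;> rw [h] <;> norm_num
    rw [h2, hw, mul_inv]
    simp only
    rw [div_eq_mul_inv]
    calc _ = (σ * σ) * ((-1 : ℝ) ^ (j : ℕ) * ((-1 : ℝ) ^ (j : ℕ))⁻¹) *
          ((circleTrig P (t j)).re * (sinProd t j (t j))⁻¹) := by
          rw [h4, mul_inv_cancel₀ h3, one_mul, one_mul]
      _ = _ := by ring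
  have hz : (∀ j, 0 < w j) ∨ ∀ j, w j < 0 := by
    have hp : ∀ j : Fin (m + 1), 0 < ((-1) ^ (j : ℕ) * sinProd t j (t j))⁻¹ := fun j =>
      inv_pos.2 (neg_one_pow_mul_sinProd_pos ht htm j)
    have hsgn := forall_pos_or_forall_neg (f := fun φ => (ρ φ).re * σ) (hρc.mul_const σ)
      fun φ => mul_ne_zero (hρ0 φ) (by rcases hσ1 with h | h <;> rw [h] <;> norm_num)
    simp only [hwρ]
    exact hsgn.imp (fun h j => mul_pos (h _) (hp j)) fun h j => mul_neg_of_neg_of_pos (h _) (hp j)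
  refine ⟨(w, t), ⟨ht, htm, hz⟩, ?_⟩
  refine eq_of_evalCoeffs_eq (injective_exp_mul_I ht.injective htm) fun k => ?_
  rw [evalCoeffs_spectralCoeffs_exp, ← trigFactor_mul_circleTrig P, trigRe_self, trigIm_self]
  congr 1
  rw [hw]
  simp only
  rw [div_mul_cancel₀ _ (hs k)]
  exact Complex.ext (by simp) (by simp [him k])

end

section

variable {m : ℕ}

theorem abs_countIn_sub_relPhase_le {θ : ℝ} (hθ : 0 ≤ θ) (hθ' : θ ≤ 2 * Real.pi)
    {p : (Fin (m + 1) → ℝ) × (Fin (m + 1) → ℝ)} (hp : p ∈ spectralDomain (m + 1)) :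
    |(countIn 0 θ p.2 : ℝ) - relPhase θ m (spectralCoeffs p.1 p.2) / (2 * Real.pi)| ≤ 1 := by
  obtain ⟨w, t⟩ := p
  obtain ⟨Ψ, hΨ, hrel⟩ := exists_isPruferPhase θ m _ (isVerblunsky_spectralCoeffs hp)
  have hr := range_eq_setOf_im_circleTrig hp.2.1 (sum_ne_zero_of_mem_spectralDomain hp)
  simp only at hr hrel ⊢
  have hpi := Real.two_pi_pos
  set a : ℝ := (Ψ 0 - Real.pi * m) / (2 * Real.pi) with ha
  set b : ℝ := (Ψ θ - Real.pi * m) / (2 * Real.pi) with hb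
  have hΨ0 : Ψ 0 = Real.pi * m + 2 * Real.pi * a := by rw [ha]; field_simp; ring
  have hΨθ : Ψ θ = Real.pi * m + 2 * Real.pi * b := by rw [hb]; field_simp; ring
  have hk : ∀ j, ∃ k : ℤ, Ψ (t j) = Real.pi * m + 2 * Real.pi * k := fun j => by
    have h1 : t j ∈ Set.range t := ⟨j, rfl⟩
    rw [hr] at h1
    exact (hΨ.im_circleTrig_eq_zero_iff _).1 h1.2
  choose k hk using hk
  have hcard : countIn 0 θ t = (Finset.Ico ⌈a⌉ ⌈b⌉).card := by
    rw [countIn]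
    refine Finset.card_bij (fun j _ => k j) (fun j hj => ?_) (fun i _ j _ hij => ?_)
      fun l hl => ?_
    · rw [Finset.mem_filter] at hj
      have h1 := hΨ.strictMono.monotone hj.2.1
      have h2 := hΨ.strictMono hj.2.2
      rw [hk, hΨ0] at h1
      rw [hk, hΨθ] at h2
      rw [Finset.mem_Ico, Int.ceil_le, Int.lt_ceil]
      exact ⟨le_of_mul_le_mul_left (by linarith) hpi, lt_of_mul_lt_mul_left (by linarith) hpi.le⟩
    · exact hp.1.injective (hΨ.strictMono.injective (by rw [hk, hk, hij]))
    · rw [Finset.mem_Ico, Int.ceil_le, Int.lt_ceil] at hl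
      have h1 := mul_le_mul_of_nonneg_left hl.1 hpi.le
      have h2 := mul_lt_mul_of_pos_left hl.2 hpi
      obtain ⟨φ, hφ, hφl⟩ := intermediate_value_Ico hθ hΨ.continuous.continuousOn
        (show Real.pi * m + 2 * Real.pi * l ∈ Set.Ico (Ψ 0) (Ψ θ) by
          rw [hΨ0, hΨθ]; constructor <;> linarith)
      have h3 : φ ∈ Set.range t := by
        rw [hr]
        exact ⟨⟨hφ.1, hφ.2.trans_le hθ'⟩, (hΨ.im_circleTrig_eq_zero_iff _).2 ⟨l, hφl⟩⟩
      obtain ⟨j, rfl⟩ := h3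
      refine ⟨j, by simpa using hφ, ?_⟩
      rw [hk] at hφl
      have h4 := mul_left_cancel₀ hpi.ne' (add_left_cancel hφl)
      exact_mod_cast h4
  have hab : a ≤ b := by
    have := hΨ.strictMono.monotone hθ
    rw [hΨ0, hΨθ] at this
    exact le_of_mul_le_mul_left (by linarith) hpi
  have hcast : (countIn 0 θ t : ℝ) = ⌈b⌉ - ⌈a⌉ := by
    rw [hcard, Int.card_Ico]
    have h1 : 0 ≤ ⌈b⌉ - ⌈a⌉ := sub_nonneg.2 (Int.ceil_mono hab)
    have h2 : (((⌈b⌉ - ⌈a⌉).toNat : ℤ) : ℝ) = ((⌈b⌉ - ⌈a⌉ : ℤ) : ℝ) := by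
      rw [Int.toNat_of_nonneg h1]
    rw [Int.cast_natCast] at h2
    rw [h2, Int.cast_sub]
  have hrel' : relPhase θ m (spectralCoeffs w t) / (2 * Real.pi) = b - a := by
    rw [← hrel, ha, hb]; ring
  rw [hcast, hrel', abs_le]
  have h1 := Int.le_ceil a
  have h2 := Int.ceil_lt_add_one a
  have h3 := Int.le_ceil b
  have h4 := Int.ceil_lt_add_one b
  constructor <;> linarith

end

section

variable {β s : ℝ} {m : ℕ}

/-- The constant in front of `szegoDensity`. -/
def szegoConst (β s : ℝ) (k : ℕ) : ℝ :=
  (2 * Real.pi * Real.Gamma s)⁻¹ * ∏ j ∈ Finset.range k, ((j + 1) * β / 2 / Real.pi)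

lemma szegoConst_succ (β s : ℝ) (k : ℕ) :
    szegoConst β s (k + 1) = szegoConst β s k * ((k + 1) * β / 2 / Real.pi) := by
  rw [szegoConst, szegoConst, Finset.prod_range_succ, ← mul_assoc]

lemma szegoConst_pos (hβ : 0 < β) (hs : 0 < s) (k : ℕ) : 0 < szegoConst β s k := by
  have := Real.Gamma_pos_of_pos hs
  have := Real.pi_pos
  exact mul_pos (by positivity) (Finset.prod_pos fun j _ => by positivity)

lemma szegoDensity_eq (hβ : 0 < β) (hs : 0 < s) {k : ℕ} {P : Fin (k + 1) → ℂ}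
    (hP : IsVerblunsky k P) : szegoDensity β s k P = ENNReal.ofReal (szegoConst β s k *
      ‖P 0‖ ^ (s - 2 - 2 * k) * Real.exp (-‖P 0‖) * verblunskyProd k P ^ (β / 2 - 1)) := by
  induction k with
  | zero =>
    have h : P 0 ≠ 0 := hP
    rw [szegoDensity, if_pos h, szegoConst]
    congr 1
    simp [verblunskyProd]
    ring
  | succ k ih =>
    obtain ⟨h0, hα, hL⟩ := hP
    have hV := verblunskyProd_pos hL
    have hA := norm_pos_iff.2 h0
    have hc := szegoConst_pos hβ hs k
    rw [szegoDensity, if_pos ⟨h0, hα⟩, ih hL, ← ENNReal.ofReal_mul (by positivity),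
      szegoUnstep_zero h0 hα, verblunskyProd, szegoConst_succ, discDensity, if_pos hα]
    set α := lastVerblunsky P
    set A := ‖P 0‖
    have hr : 0 < 1 - ‖α‖ ^ 2 := by nlinarith [norm_nonneg α]
    set r := 1 - ‖α‖ ^ 2
    congr 1
    rw [Real.mul_rpow hV.le (by positivity), ← Real.rpow_natCast r (k + 1), ← Real.rpow_mul hr.le]
    have e1 : A ^ (s - 2 - 2 * ((k + 1 : ℕ) : ℝ)) = A ^ (s - 2 - 2 * (k : ℝ)) / A ^ 2 := by
      rw [← Real.rpow_natCast A 2, ← Real.rpow_sub hA]; congr 1; push_cast; ring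
    have e2 : r ^ (((k + 1 : ℕ) : ℝ) * (β / 2 - 1)) = r ^ ((k + 1) * β / 2 - 1) / r ^ k := by
      rw [← Real.rpow_natCast r k, ← Real.rpow_sub hr]; congr 1; push_cast; ring
    rw [e1, e2]
    field_simp

/-- The density of the spectral parameters. -/
def spectralDensity (β s : ℝ) (m : ℕ) (p : (Fin (m + 1) → ℝ) × (Fin (m + 1) → ℝ)) : ℝ :=
  szegoConst β s m * (2⁻¹ ^ (m + 1) * (Real.exp (-|∑ j, p.1 j|) *
    ((∏ j, |p.1 j| ^ (β / 2 - 1)) * circVandermonde p.2 ^ β)))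

lemma circVandermonde_pos {t : Fin m → ℝ} (ht : Function.Injective t)
    (htm : ∀ j, t j ∈ Set.Ico 0 (2 * Real.pi)) : 0 < circVandermonde t := by
  refine Finset.prod_pos fun p hp => norm_pos_iff.2 (sub_ne_zero.2 fun h => ?_)
  rw [mul_comm, mul_comm Complex.I] at h
  exact (Finset.mem_filter.1 hp).2.ne (injective_exp_mul_I ht htm h)

lemma verblunskyProd_spectralCoeffs {p : (Fin (m + 1) → ℝ) × (Fin (m + 1) → ℝ)}
    (hp : p ∈ spectralDomain (m + 1)) :
    |∑ j, p.1 j| ^ (m + 1) * verblunskyProd m (spectralCoeffs p.1 p.2) =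
      (∏ j, |p.1 j|) * circVandermonde p.2 ^ 2 := by
  obtain ⟨w, t⟩ := p
  have ht := hp.1.injective
  have hz := injective_exp_mul_I ht hp.2.1
  simp only at ht hz ⊢
  rw [← norm_spectralCoeffs_zero w t, ← prod_norm_evalCoeffs (isVerblunsky_spectralCoeffs hp) hz
    ((-1) ^ m) fun j => ?_, ← prod_two_pow_mul_abs_sinProd, ← Finset.prod_mul_distrib]
  · refine Finset.prod_congr rfl fun j _ => ?_
    rw [evalCoeffs_spectralCoeffs_exp, norm_mul, norm_trigFactor, trigIm_self, trigRe_self,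
      Complex.ofReal_zero, zero_mul, add_zero, Complex.norm_real, Real.norm_eq_abs, abs_mul]
    ring
  · have h1 := exp_pow_mul_star_trigFactor m (t j)
    rw [evalCoeffs_revConj _ (Complex.norm_exp_ofReal_mul_I _), ← mul_assoc, ← pow_succ',
      evalCoeffs_spectralCoeffs_exp, trigIm_self, Complex.ofReal_zero, zero_mul, add_zero,
      star_mul', ← mul_assoc, h1, Complex.star_def, Complex.conj_ofReal, mul_assoc]

lemma szegoDensity_mul_abs_det (hβ : 0 < β) {p : (Fin (m + 1) → ℝ) × (Fin (m + 1) → ℝ)}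
    (hp : p ∈ spectralDomain (m + 1)) :
    ENNReal.ofReal |(fderiv ℝ (spectralMap (m + 1)) p).det| *
      szegoDensity β ((m + 1) * β / 2) m (spectralCoeffs p.1 p.2) =
      ENNReal.ofReal (spectralDensity β ((m + 1) * β / 2) m p) := by
  have hs : 0 < (m + 1) * β / 2 := by positivity
  have hV := circVandermonde_pos hp.1.injective hp.2.1
  have hA := abs_pos.2 (sum_ne_zero_of_mem_spectralDomain hp)
  have hv := verblunskyProd_pos (isVerblunsky_spectralCoeffs hp)
  have hW : 0 < ∏ j, |p.1 j| := Finset.prod_pos fun j _ => by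
    rcases hp.2.2 with h | h
    · exact abs_pos.2 (h j).ne'
    · exact abs_pos.2 (h j).ne
  rw [szegoDensity_eq hβ hs (isVerblunsky_spectralCoeffs hp), ← ENNReal.ofReal_mul (abs_nonneg _),
    abs_det_fderiv_spectralMap p hV.ne', norm_spectralCoeffs_zero, spectralDensity,
    Real.finsetProd_rpow _ _ fun j _ => abs_nonneg _, abs_div, abs_two]
  have hvp := verblunskyProd_spectralCoeffs hp
  set A := |∑ j, p.1 j|
  set V := circVandermonde p.2
  set W := ∏ j, |p.1 j|
  set v := verblunskyProd m (spectralCoeffs p.1 p.2)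
  have e : v = W * V ^ 2 / A ^ (m + 1) := by field_simp; linarith
  congr 1
  have key : V ^ 2 * A ^ (m + 1) * (A ^ ((m + 1) * β / 2 - 2 - 2 * m) * v ^ (β / 2 - 1)) =
      W ^ (β / 2 - 1) * V ^ β := by
    rw [e, ← Real.exp_log hA, ← Real.exp_log hV, ← Real.exp_log hW]
    simp only [← Real.exp_nat_mul, ← Real.exp_add, ← Real.exp_sub, ← Real.exp_mul]
    congr 1
    push_cast
    ring
  calc _ = szegoConst β ((m + 1) * β / 2) m * (2⁻¹ ^ (m + 1) * (Real.exp (-A) *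
        (V ^ 2 * A ^ (m + 1) * (A ^ ((m + 1) * β / 2 - 2 - 2 * m) * v ^ (β / 2 - 1))))) := by
        rw [div_pow, inv_pow]; ring
    _ = _ := by rw [key]

lemma measurableSet_spectralDomain (n : ℕ) : MeasurableSet (spectralDomain n) := by
  have h1 : MeasurableSet {p : (Fin n → ℝ) × (Fin n → ℝ) | StrictMono p.2} := by
    have : {p : (Fin n → ℝ) × (Fin n → ℝ) | StrictMono p.2} =
        ⋂ i, ⋂ j, ⋂ _ : i < j, {p | p.2 i < p.2 j} := by
      ext p
      simp only [Set.mem_ofPred_eq, Set.mem_iInter]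
      exact Iff.rfl
    rw [this]
    exact MeasurableSet.iInter fun i => MeasurableSet.iInter fun j => MeasurableSet.iInter fun _ =>
      measurableSet_lt (by fun_prop) (by fun_prop)
  have h2 : MeasurableSet {p : (Fin n → ℝ) × (Fin n → ℝ) |
      ∀ j, p.2 j ∈ Set.Ico 0 (2 * Real.pi)} := by
    rw [Set.ofPred_forall]
    exact MeasurableSet.iInter fun j =>
      (by fun_prop : Measurable fun p : (Fin n → ℝ) × (Fin n → ℝ) => p.2 j) measurableSet_Ico
  have h3 : MeasurableSet {p : (Fin n → ℝ) × (Fin n → ℝ) | ∀ j, 0 < p.1 j} := by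
    rw [Set.ofPred_forall]
    exact MeasurableSet.iInter fun j => measurableSet_lt (by fun_prop) (by fun_prop)
  have h4 : MeasurableSet {p : (Fin n → ℝ) × (Fin n → ℝ) | ∀ j, p.1 j < 0} := by
    rw [Set.ofPred_forall]
    exact MeasurableSet.iInter fun j => measurableSet_lt (by fun_prop) (by fun_prop)
  exact h1.inter (h2.inter (h3.union h4))

theorem lintegral_szegoMeasure_eq (hβ : 0 < β) {G : (Fin (m + 1) → ℂ) → ENNReal}
    (hG : Measurable G) : ∫⁻ P, G P ∂szegoMeasure β ((m + 1) * β / 2) m =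
      ∫⁻ p in spectralDomain (m + 1), ENNReal.ofReal (spectralDensity β ((m + 1) * β / 2) m p) *
        G (spectralCoeffs p.1 p.2) := by
  set s : ℝ := (m + 1) * β / 2 with hs
  have hd := measurable_szegoDensity β s m
  set F : (Fin (m + 1) → ℝ) × (Fin (m + 1) → ℝ) → ENNReal := fun x =>
    szegoDensity β s m ((reImEquiv (m + 1)).symm x) * G ((reImEquiv (m + 1)).symm x) with hF
  have hsymm : Measurable (reImEquiv (m + 1)).symm :=
    (reImEquiv (m + 1)).symm.toContinuousLinearEquiv.continuous.measurable
  have hFm : Measurable F := (hd.comp hsymm).mul (hG.comp hsymm)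
  have h1 : ∫⁻ P, G P ∂szegoMeasure β s m = ∫⁻ x, F x := by
    rw [szegoMeasure, lintegral_withDensity_eq_lintegral_mul _ hd hG,
      ← (measurePreserving_reImEquiv (m + 1)).lintegral_comp hFm]
    simp [hF]
  have h2 : ∫⁻ x, F x = ∫⁻ x in spectralMap (m + 1) '' spectralDomain (m + 1), F x := by
    refine (setLIntegral_eq_of_support_subset ?_).symm
    intro x hx
    have h3 : szegoDensity β s m ((reImEquiv (m + 1)).symm x) ≠ 0 := left_ne_zero_of_mul hx
    obtain ⟨Ψ, hΨ, -⟩ := exists_isPruferPhase 0 m _ (isVerblunsky_of_szegoDensity_ne_zero h3)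
    obtain ⟨p, hp, hpe⟩ := hΨ.exists_spectralCoeffs_eq
    exact ⟨p, hp, by rw [spectralMap, hpe, LinearEquiv.apply_symm_apply]⟩
  have : (volume : Measure ((Fin (m + 1) → ℝ) × (Fin (m + 1) → ℝ))).IsAddHaarMeasure :=
    Measure.prod.instIsAddHaarMeasure volume volume
  rw [h1, h2, lintegral_image_eq_lintegral_abs_det_fderiv_mul volume
    (measurableSet_spectralDomain _) (fun p _ =>
      (differentiable_spectralMap p).hasFDerivAt.hasFDerivWithinAt) injOn_spectralMap]
  refine setLIntegral_congr_fun (measurableSet_spectralDomain _) fun p hp => ?_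
  simp only [hF, spectralMap, LinearEquiv.symm_apply_apply]
  rw [← szegoDensity_mul_abs_det hβ hp, mul_assoc]

end

section

variable {n : ℕ}

lemma lintegral_ofReal_prod_eq {f : ℝ → ℝ} (hf : Integrable f) (hf0 : ∀ x, 0 ≤ f x) :
    ∫⁻ w : Fin n → ℝ, ENNReal.ofReal (∏ j, f (w j)) = ENNReal.ofReal ((∫ x, f x) ^ n) := by
  rw [← ofReal_integral_eq_lintegral_ofReal]
  · rw [integral_fintype_prod_volume_eq_pow, Fintype.card_fin]
  · exact Integrable.fintype_prod (μ := fun _ => (volume : Measure ℝ))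
      (f := fun _ : Fin n => f) fun _ => hf
  · exact ae_of_all _ fun w => Finset.prod_nonneg fun j _ => hf0 _

/-- The weights of the spectral domain. -/
def weightDomain (n : ℕ) : Set (Fin n → ℝ) := {w | (∀ j, 0 < w j) ∨ ∀ j, w j < 0}

/-- Increasing sequences of angles. -/
def angleDomain (n : ℕ) : Set (Fin n → ℝ) :=
  {t | StrictMono t ∧ ∀ j, t j ∈ Set.Ico 0 (2 * Real.pi)}

lemma spectralDomain_eq : spectralDomain n = weightDomain n ×ˢ angleDomain n := by
  ext p
  simp only [spectralDomain, weightDomain, angleDomain, Set.mem_prod, Set.mem_ofPred_eq]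
  tauto

lemma measurableSet_angleDomain (n : ℕ) : MeasurableSet (angleDomain n) := by
  have h : angleDomain n = {t : Fin n → ℝ | ∀ i j, i < j → t i < t j} ∩
      ⋂ j, {t | t j ∈ Set.Ico 0 (2 * Real.pi)} := by
    ext t
    simp [angleDomain, StrictMono]
  rw [h]
  refine MeasurableSet.inter ?_
    (MeasurableSet.iInter fun j => measurable_pi_apply j measurableSet_Ico)
  simp only [Set.ofPred_forall]
  exact MeasurableSet.iInter fun i => MeasurableSet.iInter fun j => MeasurableSet.iInter fun _ =>
    measurableSet_lt (measurable_pi_apply i) (measurable_pi_apply j)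

lemma measurableSet_forall_pos (n : ℕ) : MeasurableSet {w : Fin n → ℝ | ∀ j, 0 < w j} := by
  simp only [Set.ofPred_forall]
  exact MeasurableSet.iInter fun j => measurableSet_lt measurable_const (measurable_pi_apply j)

lemma measurableSet_forall_neg (n : ℕ) : MeasurableSet {w : Fin n → ℝ | ∀ j, w j < 0} := by
  simp only [Set.ofPred_forall]
  exact MeasurableSet.iInter fun j => measurableSet_lt (measurable_pi_apply j) measurable_const

lemma integrable_gamma_indicator {a : ℝ} (ha : 0 < a) :
    Integrable ((Set.Ioi 0).indicator fun x : ℝ => Real.exp (-x) * x ^ (a - 1)) :=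
  (integrable_indicator_iff measurableSet_Ioi).2 (Real.GammaIntegral_convergent ha)

lemma integral_gamma_indicator {a : ℝ} (ha : 0 < a) :
    ∫ x, (Set.Ioi 0).indicator (fun x : ℝ => Real.exp (-x) * x ^ (a - 1)) x = Real.Gamma a := by
  rw [integral_indicator measurableSet_Ioi, Real.Gamma_eq_integral ha]

lemma gamma_indicator_nonneg (a x : ℝ) :
    0 ≤ (Set.Ioi 0).indicator (fun x : ℝ => Real.exp (-x) * x ^ (a - 1)) x :=
  Set.indicator_nonneg (fun _ hx => mul_nonneg (Real.exp_pos _).le (Real.rpow_nonneg hx.le _)) x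

lemma prod_gamma_indicator (a : ℝ) (w : Fin n → ℝ) :
    ENNReal.ofReal (∏ j, (Set.Ioi 0).indicator (fun x : ℝ => Real.exp (-x) * x ^ (a - 1)) (w j)) =
      {w : Fin n → ℝ | ∀ j, 0 < w j}.indicator (fun w => ENNReal.ofReal
        (Real.exp (-|∑ j, w j|) * ∏ j, |w j| ^ (a - 1))) w := by
  by_cases h : ∀ j, 0 < w j
  · rw [Set.indicator_of_mem (by exact h)]
    rw [abs_of_nonneg (Finset.sum_nonneg fun j _ => (h j).le), ← Finset.sum_neg_distrib,
      Real.exp_sum, ← Finset.prod_mul_distrib]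
    congr 1
    refine Finset.prod_congr rfl fun j _ => ?_
    rw [Set.indicator_of_mem (by exact h j), abs_of_pos (h j)]
  · rw [Set.indicator_of_notMem (by exact h)]
    push Not at h
    obtain ⟨j, hj⟩ := h
    have h0 : (Set.Ioi 0).indicator (fun x : ℝ => Real.exp (-x) * x ^ (a - 1)) (w j) = 0 :=
      Set.indicator_of_notMem (by simpa using hj) _
    rw [Finset.prod_eq_zero (Finset.mem_univ j) h0, ENNReal.ofReal_zero]

lemma lintegral_weightDomain {a : ℝ} (ha : 0 < a) (m : ℕ) :
    ∫⁻ w in weightDomain (m + 1), ENNReal.ofReal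
      (Real.exp (-|∑ j, w j|) * ∏ j, |w j| ^ (a - 1)) =
        ENNReal.ofReal (2 * Real.Gamma a ^ (m + 1)) := by
  have hG := Real.Gamma_pos_of_pos ha
  have h1 := lintegral_ofReal_prod_eq (n := m + 1) (integrable_gamma_indicator ha)
    (gamma_indicator_nonneg a)
  have h2 := lintegral_ofReal_prod_eq (n := m + 1) (integrable_gamma_indicator ha).comp_neg
    fun x => gamma_indicator_nonneg a (-x)
  rw [integral_neg_eq_self
    (f := (Set.Ioi 0).indicator fun x : ℝ => Real.exp (-x) * x ^ (a - 1))] at h2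
  rw [integral_gamma_indicator ha] at h1 h2
  have h3 : ∀ w : Fin (m + 1) → ℝ, ENNReal.ofReal (∏ j, (Set.Ioi 0).indicator
      (fun x : ℝ => Real.exp (-x) * x ^ (a - 1)) (-w j)) =
      {w : Fin (m + 1) → ℝ | ∀ j, w j < 0}.indicator (fun w => ENNReal.ofReal
        (Real.exp (-|∑ j, w j|) * ∏ j, |w j| ^ (a - 1))) w := by
    intro w
    have := prod_gamma_indicator a (-w)
    simp only [Pi.neg_apply] at this
    rw [this]
    simp [Set.indicator]
  simp_rw [prod_gamma_indicator] at h1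
  simp_rw [h3] at h2
  rw [lintegral_indicator (measurableSet_forall_pos _)] at h1
  rw [lintegral_indicator (measurableSet_forall_neg _)] at h2
  have h4 : weightDomain (m + 1) = {w | ∀ j, 0 < w j} ∪ {w | ∀ j, w j < 0} := rfl
  rw [h4, lintegral_union (measurableSet_forall_neg _), h1, h2,
    ← ENNReal.ofReal_add (by positivity) (by positivity), two_mul]
  refine Set.disjoint_left.2 fun w hw hw' => ?_
  exact lt_asymm (hw 0) (hw' 0)

lemma volume_not_injective (n : ℕ) :
    volume {x : Fin n → ℝ | ¬ Function.Injective x} = 0 := by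
  have h : {x : Fin n → ℝ | ¬ Function.Injective x} ⊆
      ⋃ i, ⋃ j, ⋃ _ : i ≠ j, (LinearMap.ker (LinearMap.proj (R := ℝ) (φ := fun _ : Fin n => ℝ) i -
        LinearMap.proj j) : Set (Fin n → ℝ)) := by
    intro x hx
    simp only [Set.mem_ofPred_eq, Function.Injective] at hx
    push Not at hx
    obtain ⟨i, j, hij, hne⟩ := hx
    simp only [Set.mem_iUnion]
    exact ⟨i, j, hne, by simp [hij]⟩
  refine measure_mono_null h (measure_iUnion_null fun i => measure_iUnion_null fun j =>
    measure_iUnion_null fun hij => Measure.addHaar_submodule _ _ fun htop => ?_)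
  have : (Pi.single i 1 : Fin n → ℝ) ∈ LinearMap.ker
      (LinearMap.proj (R := ℝ) (φ := fun _ : Fin n => ℝ) i - LinearMap.proj j) := by
    rw [htop]; trivial
  simp [hij.symm] at this

lemma measurePreserving_comp_perm (σ : Equiv.Perm (Fin n)) :
    MeasurePreserving (fun x : Fin n → ℝ => x ∘ σ) := by
  have h := volume_measurePreserving_piCongrLeft (fun _ : Fin n => ℝ) σ.symm
  have e : (fun x : Fin n → ℝ => x ∘ σ) =
      MeasurableEquiv.piCongrLeft (fun _ : Fin n => ℝ) σ.symm := by
    funext x i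
    have := MeasurableEquiv.piCongrLeft_apply_apply (β := fun _ : Fin n => ℝ) σ.symm x (σ i)
    rw [Equiv.symm_apply_apply] at this
    exact this.symm
  rw [e]
  exact h

lemma sum_perm_indicator (F : (Fin n → ℝ) → ENNReal) (x : Fin n → ℝ) (hx : Function.Injective x) :
    ∑ σ : Equiv.Perm (Fin n), (angleDomain n).indicator (fun _ => F x) (x ∘ σ) =
      (Set.univ.pi fun _ => Set.Ico 0 (2 * Real.pi)).indicator F x := by
  by_cases hb : x ∈ Set.univ.pi fun _ => Set.Ico 0 (2 * Real.pi)
  · rw [Set.indicator_of_mem hb, Finset.sum_eq_single (Tuple.sort x)]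
    · rw [Set.indicator_of_mem]
      exact ⟨(Tuple.monotone_sort x).strictMono_of_injective (hx.comp (Equiv.injective _)),
        fun j => hb _ trivial⟩
    · intro σ _ hσ
      refine Set.indicator_of_notMem (fun h => hσ ?_) _
      have h1 := (Tuple.monotone_sort x).strictMono_of_injective (hx.comp (Equiv.injective _))
      have h2 : x ∘ σ = x ∘ Tuple.sort x := by
        refine (StrictMono.range_inj h.1 h1).1 ?_
        rw [(Equiv.surjective _).range_comp, (Equiv.surjective _).range_comp]
      ext j
      exact congrArg Fin.val (hx (congrFun h2 j))
    · simp
  · rw [Set.indicator_of_notMem hb]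
    refine Finset.sum_eq_zero fun σ _ => Set.indicator_of_notMem (fun h => hb fun j _ => ?_) _
    simpa using h.2 (σ.symm j)

lemma lintegral_box_eq {F : (Fin n → ℝ) → ENNReal} (hF : Measurable F)
    (hσ : ∀ (σ : Equiv.Perm (Fin n)) x, F (x ∘ σ) = F x) :
    ∫⁻ x in Set.univ.pi fun _ => Set.Ico 0 (2 * Real.pi), F x =
      n.factorial * ∫⁻ x in angleDomain n, F x := by
  have h1 : ∀ σ : Equiv.Perm (Fin n), ∫⁻ x in angleDomain n, F x =
      ∫⁻ x, (angleDomain n).indicator (fun _ => F x) (x ∘ σ) := by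
    intro σ
    rw [← lintegral_indicator (measurableSet_angleDomain n),
      ← (measurePreserving_comp_perm σ).lintegral_comp (hF.indicator (measurableSet_angleDomain n))]
    simp [Set.indicator, hσ]
  have h2 : (n.factorial : ENNReal) * ∫⁻ x in angleDomain n, F x =
      ∑ _σ : Equiv.Perm (Fin n), ∫⁻ x in angleDomain n, F x := by
    simp [Fintype.card_perm]
  rw [h2, Finset.sum_congr rfl fun σ _ => h1 σ, ← lintegral_finsetSum,
    ← lintegral_indicator (MeasurableSet.univ_pi fun _ => measurableSet_Ico)]
  · refine lintegral_congr_ae ?_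
    filter_upwards [measure_eq_zero_iff_ae_notMem.1 (volume_not_injective n)] with x hx
    exact (sum_perm_indicator F x (not_not.1 hx)).symm
  · intro σ _
    have : Measurable fun x : Fin n → ℝ => (angleDomain n).indicator F (x ∘ σ) :=
      (hF.indicator (measurableSet_angleDomain n)).comp (measurePreserving_comp_perm σ).measurable
    have e : (fun x : Fin n → ℝ => (angleDomain n).indicator (fun _ => F x) (x ∘ σ)) =
        fun x => (angleDomain n).indicator F (x ∘ σ) := by
      funext x
      simp only [Set.indicator, hσ]
    rw [e]
    exact this

lemma circVandermonde_comp_perm (σ : Equiv.Perm (Fin n)) (t : Fin n → ℝ) :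
    circVandermonde (t ∘ σ) = circVandermonde t := by
  rw [← norm_det_vandermonde_exp, ← norm_det_vandermonde_exp]
  have e : (Matrix.vandermonde fun k => Complex.exp (((t ∘ σ) k : ℝ) * Complex.I)) =
      (Matrix.vandermonde fun k => Complex.exp (t k * Complex.I)).submatrix σ id := rfl
  rw [e, Matrix.det_permute, norm_mul]
  rcases Int.units_eq_one_or (Equiv.Perm.sign σ) with h | h <;> simp [h]

lemma measurable_circVandermonde : Measurable (circVandermonde (n := n)) :=
  Finset.measurable_fun_prod _ fun p _ => by fun_prop

lemma cbe_eq (β : ℝ) (n : ℕ) : cbe β n =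
    ((volume : Measure (Fin n → ℝ)).restrict
      (Set.univ.pi fun _ => Set.Ico 0 (2 * Real.pi))).withDensity
    fun y => ENNReal.ofReal (1 / cbeConst β n * circVandermonde y ^ β) := by
  rw [cbe]
  congr 1
  funext y
  rw [circVandermonde, Real.finsetProd_rpow _ _ fun _ _ => norm_nonneg _]

lemma spectralConst_eq {β : ℝ} (hβ : 0 < β) (m : ℕ) :
    szegoConst β ((m + 1) * β / 2) m * 2⁻¹ ^ (m + 1) * (2 * Real.Gamma (β / 2) ^ (m + 1)) =
      (m + 1).factorial * (1 / cbeConst β (m + 1)) := by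
  have hG := Real.Gamma_pos_of_pos (half_pos hβ)
  have hs : 0 < (m + 1) * β / 2 := by positivity
  have hG' := Real.Gamma_pos_of_pos hs
  have hp : ∏ j ∈ Finset.range m, (((j : ℝ) + 1) * β / 2 / Real.pi) =
      m.factorial * (β / 2 / Real.pi) ^ m := by
    rw [← Finset.prod_range_add_one_eq_factorial]
    push_cast
    rw [← Finset.card_range m, ← Finset.prod_const, Finset.card_range, ← Finset.prod_mul_distrib]
    exact Finset.prod_congr rfl fun j _ => by ring
  have hc : (1 : ℝ) + β * ((m + 1 : ℕ) : ℝ) / 2 = (m + 1) * β / 2 + 1 := by push_cast; ring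
  rw [szegoConst, hp, cbeConst, hc, Real.Gamma_add_one hs.ne', add_comm 1 (β / 2),
    Real.Gamma_add_one (half_pos hβ).ne', Nat.factorial_succ]
  have := Real.pi_pos
  push_cast
  generalize Real.Gamma (β / 2) = a at *
  generalize Real.Gamma ((m + 1) * β / 2) = b at *
  simp only [div_pow, mul_pow, inv_pow, pow_succ]
  field_simp

/-- Integrating out the weights in the spectral parametrization gives the circular ensemble. -/
theorem lintegral_spectralDensity_mul {β : ℝ} (hβ : 0 < β) (m : ℕ)
    {g : (Fin (m + 1) → ℝ) → ENNReal} (hg : Measurable g)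
    (hσ : ∀ (σ : Equiv.Perm (Fin (m + 1))) x, g (x ∘ σ) = g x) :
    ∫⁻ p in spectralDomain (m + 1),
        ENNReal.ofReal (spectralDensity β ((m + 1) * β / 2) m p) * g p.2 =
      ∫⁻ y, g y ∂cbe β (m + 1) := by
  have hs : 0 < (m + 1) * β / 2 := by positivity
  have hK := szegoConst_pos hβ hs m
  set K := szegoConst β ((m + 1) * β / 2) m * 2⁻¹ ^ (m + 1)
  have hVm : Measurable fun y : Fin (m + 1) → ℝ => ENNReal.ofReal (circVandermonde y ^ β) :=
    (measurable_circVandermonde.pow_const β).ennreal_ofReal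
  have hF : Measurable fun y : Fin (m + 1) → ℝ => ENNReal.ofReal (circVandermonde y ^ β) * g y :=
    hVm.mul hg
  have hC : 0 < cbeConst β (m + 1) := by
    have h1 := Real.Gamma_pos_of_pos (s := 1 + β * ((m + 1 : ℕ) : ℝ) / 2) (by positivity)
    have h2 := Real.Gamma_pos_of_pos (s := 1 + β / 2) (by positivity)
    have := Real.pi_pos
    rw [cbeConst]
    positivity
  have hW : Measurable fun w : Fin (m + 1) → ℝ =>
      ENNReal.ofReal (Real.exp (-|∑ j, w j|) * ∏ j, |w j| ^ (β / 2 - 1)) := by fun_prop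
  have hWF : Measurable fun p : (Fin (m + 1) → ℝ) × (Fin (m + 1) → ℝ) =>
      ENNReal.ofReal (Real.exp (-|∑ j, p.1 j|) * ∏ j, |p.1 j| ^ (β / 2 - 1)) *
        (ENNReal.ofReal (circVandermonde p.2 ^ β) * g p.2) :=
    (hW.comp measurable_fst).mul (hF.comp measurable_snd)
  have hR : ∫⁻ y, g y ∂cbe β (m + 1) = ENNReal.ofReal (1 / cbeConst β (m + 1)) *
      ((m + 1).factorial * ∫⁻ y in angleDomain (m + 1),
        ENNReal.ofReal (circVandermonde y ^ β) * g y) := by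
    have hd : Measurable fun y : Fin (m + 1) → ℝ =>
        ENNReal.ofReal (1 / cbeConst β (m + 1) * circVandermonde y ^ β) :=
      ((measurable_circVandermonde.pow_const β).const_mul _).ennreal_ofReal
    rw [cbe_eq, lintegral_withDensity_eq_lintegral_mul _ hd hg, ← lintegral_box_eq hF
      fun σ x => by rw [circVandermonde_comp_perm, hσ], ← lintegral_const_mul _ hF]
    refine lintegral_congr fun y => ?_
    rw [Pi.mul_apply, ENNReal.ofReal_mul (by positivity), mul_assoc]
  have hL : ∫⁻ p in spectralDomain (m + 1),
        ENNReal.ofReal (spectralDensity β ((m + 1) * β / 2) m p) * g p.2 =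
      ENNReal.ofReal K * (ENNReal.ofReal (2 * Real.Gamma (β / 2) ^ (m + 1)) *
        ∫⁻ y in angleDomain (m + 1), ENNReal.ofReal (circVandermonde y ^ β) * g y) := by
    rw [← lintegral_weightDomain (half_pos hβ), ← lintegral_prod_mul hW.aemeasurable
      hF.aemeasurable, ← lintegral_const_mul _ hWF, Measure.prod_restrict,
      ← spectralDomain_eq]
    refine lintegral_congr fun p => ?_
    rw [← mul_assoc, ← mul_assoc, ← ENNReal.ofReal_mul (by positivity), ← ENNReal.ofReal_mul
      (by positivity), spectralDensity]
    congr 2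
    simp only [K]
    ring
  rw [hL, hR, ← mul_assoc, ← mul_assoc, ← ENNReal.ofReal_mul (by positivity), spectralConst_eq hβ,
    ENNReal.ofReal_mul (by positivity), ENNReal.ofReal_natCast, mul_comm (ENNReal.ofReal _)]

end

section

variable {n m : ℕ} {β θ : ℝ}

lemma measurableSet_countIn_le (a b c : ℝ) :
    MeasurableSet {y : Fin n → ℝ | (countIn a b y : ℝ) ≤ c} := by
  have h : (fun y : Fin n → ℝ => (countIn a b y : ℝ)) =
      fun y => ∑ j, (Set.Ico a b).indicator (fun _ => (1 : ℝ)) (y j) := by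
    funext y
    simp [countIn, Set.indicator]
  have hm : Measurable fun y : Fin n → ℝ => (countIn a b y : ℝ) := by
    rw [h]
    exact Finset.measurable_fun_sum _ fun j _ =>
      (measurable_const.indicator measurableSet_Ico).comp (measurable_pi_apply j)
  exact measurableSet_le hm measurable_const

lemma countIn_comp_perm (a b : ℝ) (σ : Equiv.Perm (Fin n)) (y : Fin n → ℝ) :
    countIn a b (y ∘ σ) = countIn a b y :=
  Finset.card_bij (fun j _ => σ j) (by simp) (fun _ _ _ _ h => σ.injective h)
    fun j hj => ⟨σ.symm j, by simpa using hj, by simp⟩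

lemma phaseLaw_eq_lintegral (hβ : 0 < β) (θ : ℝ) (m : ℕ) (c : ℝ) :
    phaseLaw β θ m {d | d ≤ c} = ∫⁻ p in spectralDomain (m + 1),
      ENNReal.ofReal (spectralDensity β ((m + 1) * β / 2) m p) *
        {P | relPhase θ m P ≤ c}.indicator 1 (spectralCoeffs p.1 p.2) := by
  have hS : MeasurableSet {P | relPhase θ m P ≤ c} :=
    measurableSet_le (measurable_relPhase θ m) measurable_const
  have hI : MeasurableSet {d : ℝ | d ≤ c} := measurableSet_Iic
  rw [← lintegral_szegoMeasure_eq hβ (measurable_one.indicator hS), lintegral_indicator_one hS,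
    ← map_relPhase_szegoMeasure hβ (s := (m + 1) * β / 2) (by positivity) θ m,
    Measure.map_apply (measurable_relPhase θ m) hI]
  rfl

lemma cbe_countIn_eq_lintegral (hβ : 0 < β) (θ : ℝ) (m : ℕ) (c : ℝ) :
    cbe β (m + 1) {y | (countIn 0 θ y : ℝ) ≤ c} = ∫⁻ p in spectralDomain (m + 1),
      ENNReal.ofReal (spectralDensity β ((m + 1) * β / 2) m p) *
        {y : Fin (m + 1) → ℝ | (countIn 0 θ y : ℝ) ≤ c}.indicator 1 p.2 := by
  have hT := measurableSet_countIn_le (n := m + 1) 0 θ c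
  rw [lintegral_spectralDensity_mul hβ m (measurable_one.indicator hT) fun σ x => by
    simp [Set.indicator, countIn_comp_perm], lintegral_indicator_one hT]

lemma phaseLaw_le_cbe_countIn (hβ : 0 < β) (hθ : 0 ≤ θ) (hθ' : θ ≤ 2 * Real.pi) (m : ℕ) (c : ℝ) :
    phaseLaw β θ m {d | d ≤ 2 * Real.pi * (c - 1)} ≤
      cbe β (m + 1) {y | (countIn 0 θ y : ℝ) ≤ c} := by
  rw [phaseLaw_eq_lintegral hβ, cbe_countIn_eq_lintegral hβ]
  refine setLIntegral_mono' (measurableSet_spectralDomain _) fun p hp => mul_le_mul_right ?_ _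
  have h := (abs_le.1 (abs_countIn_sub_relPhase_le hθ hθ' hp)).2
  simp only [Set.indicator, Set.mem_ofPred_eq, Pi.one_apply]
  split_ifs with h1 h2
  · rfl
  · rw [mul_comm, ← div_le_iff₀ Real.two_pi_pos] at h1
    exact absurd (by linarith) h2
  · exact zero_le
  · rfl

lemma cbe_countIn_le_phaseLaw (hβ : 0 < β) (hθ : 0 ≤ θ) (hθ' : θ ≤ 2 * Real.pi) (m : ℕ) (c : ℝ) :
    cbe β (m + 1) {y | (countIn 0 θ y : ℝ) ≤ c} ≤
      phaseLaw β θ m {d | d ≤ 2 * Real.pi * (c + 1)} := by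
  rw [phaseLaw_eq_lintegral hβ, cbe_countIn_eq_lintegral hβ]
  refine setLIntegral_mono' (measurableSet_spectralDomain _) fun p hp => mul_le_mul_right ?_ _
  have h := (abs_le.1 (abs_countIn_sub_relPhase_le hθ hθ' hp)).1
  simp only [Set.indicator, Set.mem_ofPred_eq, Pi.one_apply]
  split_ifs with h1 h2
  · rfl
  · rw [mul_comm (2 * Real.pi), ← div_le_iff₀ Real.two_pi_pos] at h2
    exact absurd (by linarith) h2
  · exact zero_le
  · rfl

lemma gaussian_integral_eq {v : NNReal} (hv : v ≠ 0) (x : ℝ) :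
    ∫ t in Set.Iic x, Real.exp (-t ^ 2 / 2) / Real.sqrt (2 * Real.pi) =
      (gaussianReal 0 v).real (Set.Iic (√v * x)) := by
  have hv' : 0 < √(v : ℝ) := Real.sqrt_pos.2 (by positivity)
  have h1 : (gaussianReal 0 v).real (Set.Iic (√v * x)) = (gaussianReal 0 1).real (Set.Iic x) := by
    have h := gaussianReal_map_const_mul (μ := 0) (v := 1) (√v)
    have e : gaussianReal (√v * 0) (NNReal.mk (√v ^ 2) (sq_nonneg _) * 1) = gaussianReal 0 v := by
      congr 1
      · simp
      · ext
        simp [Real.sq_sqrt]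
    rw [e] at h
    rw [← h, map_measureReal_apply (by fun_prop) measurableSet_Iic]
    congr 1
    ext y
    simp [mul_le_mul_iff_right₀ hv']
  rw [h1, measureReal_def, gaussianReal_apply_eq_integral _ one_ne_zero, ENNReal.toReal_ofReal
    (integral_nonneg fun _ => gaussianPDFReal_nonneg _ _ _)]
  refine integral_congr_ae (ae_of_all _ fun t => ?_)
  simp [gaussianPDFReal]
  ring


end

/-- Berry–Esseen theorem for the counting function of the circular β-ensemble. -/
theorem berry_esseen_cbe (β : ℝ) (hβ : 0 < β) :
    ∃ C > 0, ∀ n : ℕ, 1 ≤ n → ∀ θ : ℝ, θ ∈ Set.Ioc 0 Real.pi → ∀ x : ℝ,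
      |((cbe β n) {y | Real.sqrt (Real.pi ^ 2 * β / (2 * Real.log (2 + n * θ))) *
            ((countIn 0 θ y : ℝ) - n * θ / (2 * Real.pi)) ≤ x}).toReal
          - ∫ t in Set.Iic x, Real.exp (-t ^ 2 / 2) / Real.sqrt (2 * Real.pi)|
        ≤ C / Real.sqrt (Real.log (2 + n * θ)) := by
  obtain ⟨A, hA, hbound⟩ := exists_phaseLaw_bound hβ
  have hπ := Real.pi_pos
  refine ⟨A + 2 * Real.pi / √(2 * Real.pi * (8 / β)), by positivity, ?_⟩
  rintro n hn θ ⟨hθ, hθ'⟩ x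
  obtain ⟨m, rfl⟩ : ∃ m, n = m + 1 := ⟨n - 1, by omega⟩
  have hsc : (2 : ℝ) + ((m + 1 : ℕ) : ℝ) * θ = scale θ m := by rw [scale]; push_cast; ring
  rw [hsc]
  have hL : 0 < Real.log (scale θ m) := Real.log_pos (by linarith [two_le_scale hθ m])
  have hb := hbound m θ hθ hθ'
  set L := Real.log (scale θ m)
  set v : NNReal := (8 / β * L).toNNReal with hvdef
  have hv : (v : ℝ) = 8 / β * L := Real.coe_toNNReal _ (by positivity)
  have hv0 : v ≠ 0 := by
    rw [← NNReal.coe_ne_zero, hv]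
    positivity
  have ha : 0 < √(Real.pi ^ 2 * β / (2 * L)) := Real.sqrt_pos.2 (by positivity)
  have hav : √(Real.pi ^ 2 * β / (2 * L)) * √v = 2 * Real.pi := by
    rw [hv, ← Real.sqrt_mul (by positivity), ← Real.sqrt_sq Real.two_pi_pos.le]
    congr 1
    field_simp
    norm_num
  set a := √(Real.pi ^ 2 * β / (2 * L))
  set c : ℝ := x / a + ((m + 1 : ℕ) : ℝ) * θ / (2 * Real.pi) with hc
  have hset : {y : Fin (m + 1) → ℝ |
      a * ((countIn 0 θ y : ℝ) - ((m + 1 : ℕ) : ℝ) * θ / (2 * Real.pi)) ≤ x} =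
      {y | (countIn 0 θ y : ℝ) ≤ c} := by
    ext y
    rw [Set.mem_ofPred_eq, Set.mem_ofPred_eq, hc, ← sub_le_iff_le_add, le_div_iff₀ ha, mul_comm]
  have := isProbabilityMeasure_phaseLaw hβ θ m
  have hup := cbe_countIn_le_phaseLaw hβ hθ.le (hθ'.trans (by linarith)) m c
  have hlo := phaseLaw_le_cbe_countIn hβ hθ.le (hθ'.trans (by linarith)) m c
  have hfin : cbe β (m + 1) {y | (countIn 0 θ y : ℝ) ≤ c} ≠ ⊤ :=
    ne_top_of_le_ne_top (measure_ne_top _ _) hup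
  have hup' := ENNReal.toReal_mono (measure_ne_top _ _) hup
  have hlo' := ENNReal.toReal_mono hfin hlo
  have hx : 2 * Real.pi * (x / a) = √v * x := by
    rw [← hav]
    field_simp
  have e : ∀ r : ℝ, (phaseLaw β θ m {d | d ≤ 2 * Real.pi * (c + r)}).toReal =
      (phaseLaw β θ m).real {d | d - (m + 1) * θ ≤ √v * x + 2 * Real.pi * r} := fun r => by
    rw [measureReal_def]
    congr 2
    ext d
    have : 2 * Real.pi * (c + r) = √v * x + 2 * Real.pi * r + (m + 1) * θ := by
      rw [hc, ← hx]
      push_cast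
      field_simp
      ring
    rw [Set.mem_ofPred_eq, Set.mem_ofPred_eq, this, sub_le_iff_le_add]
  rw [e] at hup'
  rw [sub_eq_add_neg c, e] at hlo'
  have hbu := (abs_le.1 (hb (√v * x + 2 * Real.pi * 1))).2
  have hbl := (abs_le.1 (hb (√v * x + 2 * Real.pi * -1))).1
  have hgu := gaussianReal_real_Ioc_le (v := v) hv0
    (x := √v * x) (y := √v * x + 2 * Real.pi * 1) (by linarith)
  have hgl := gaussianReal_real_Ioc_le (v := v) hv0
    (x := √v * x + 2 * Real.pi * -1) (y := √v * x) (by linarith)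
  have hIoc : ∀ p q : ℝ, p ≤ q → (gaussianReal 0 v).real (Set.Ioc p q) =
      (gaussianReal 0 v).real (Set.Iic q) - (gaussianReal 0 v).real (Set.Iic p) := fun p q hpq => by
    have : Set.Ioc p q = Set.Iic q \ Set.Iic p := by
      ext
      simp [and_comm]
    rw [this, measureReal_sdiff (Set.Iic_subset_Iic.2 hpq) measurableSet_Iic]
  rw [hIoc _ _ (by linarith)] at hgu hgl
  have hK : (√(2 * Real.pi * v))⁻¹ * (2 * Real.pi) =
      2 * Real.pi / √(2 * Real.pi * (8 / β)) / √L := by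
    rw [hv, ← mul_assoc (2 * Real.pi), Real.sqrt_mul (by positivity) L]
    field_simp
  have e1 : √v * x + 2 * Real.pi * 1 - √v * x = 2 * Real.pi := by ring
  have e2 : √v * x - (√v * x + 2 * Real.pi * -1) = 2 * Real.pi := by ring
  rw [e1, hK] at hgu
  rw [e2, hK] at hgl
  rw [hset, gaussian_integral_eq hv0, add_div, abs_le]
  constructor <;> linarith
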